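/- arXiv:1307.0746 — 2 statements merged into one kernel-verified Lean document; each statement's English description precedes it below -/
import Mathlib

section
/- Let Ω ⊂ ℝ² be a nonempty open, connected and simply connected set. Then the following three conditions are equivalent: (1) the Moser–Trudinger inequality holds, i.e. sup { ∫_Ω (e^{4π u(x)²} − 1) dx : u ∈ C_c^∞(Ω), ∫_Ω |∇u(x)|² dx ≤ 1 } < +∞; (2) the Poincaré inequality holds, i.e. λ₁(Ω) := inf { ∫_Ω |∇u(x)|² dx / ∫_Ω u(x)² dx : u ∈ C_c^∞(Ω), u ≢ 0 } > 0; (3) the inradius r(Ω) := sup { R > 0 : there exists x ∈ Ω with B_R(x) ⊆ Ω } is finite. -/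
open MeasureTheory Real

/-- `u ∈ C_c^∞(Ω)`: smooth, compactly supported, with support contained in `Ω`. -/
def IsTest (Ω : Set (EuclideanSpace ℝ (Fin 2)))
    (u : EuclideanSpace ℝ (Fin 2) → ℝ) : Prop :=
  ContDiff ℝ (⊤ : ℕ∞) u ∧ HasCompactSupport u ∧ tsupport u ⊆ Ω

/-- The Moser–Trudinger inequality holds on `Ω`. -/
def MoserTrudinger (Ω : Set (EuclideanSpace ℝ (Fin 2))) : Prop :=
  BddAbove {r : ℝ | ∃ u : EuclideanSpace ℝ (Fin 2) → ℝ, IsTest Ω u ∧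
    (∫ x in Ω, ‖fderiv ℝ u x‖ ^ 2) ≤ 1 ∧
    r = ∫ x in Ω, (Real.exp (4 * Real.pi * u x ^ 2) - 1)}

/-- The Poincaré inequality holds on `Ω`, i.e. `λ₁(Ω) > 0`. -/
def Poincare (Ω : Set (EuclideanSpace ℝ (Fin 2))) : Prop :=
  ∃ lam : ℝ, 0 < lam ∧ ∀ u : EuclideanSpace ℝ (Fin 2) → ℝ, IsTest Ω u →
    lam * ∫ x in Ω, u x ^ 2 ≤ ∫ x in Ω, ‖fderiv ℝ u x‖ ^ 2

/-- The inradius of `Ω` is finite. -/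
def FiniteInradius (Ω : Set (EuclideanSpace ℝ (Fin 2))) : Prop :=
  BddAbove {R : ℝ | 0 < R ∧ ∃ x ∈ Ω, Metric.ball x R ⊆ Ω}

/-- unit vector -/
noncomputable def cs (θ : ℝ) : ℂ := ((Real.cos θ : ℝ) : ℂ) + ((Real.sin θ : ℝ) : ℂ) * Complex.I

lemma cs_eq (θ : ℝ) : cs θ = Complex.exp (θ * Complex.I) := by
  rw [Complex.exp_mul_I, cs]; simp

lemma norm_cs (θ : ℝ) : ‖cs θ‖ = 1 := by
  rw [cs_eq, Complex.norm_exp_ofReal_mul_I]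

lemma continuous_cs : Continuous cs := by
  unfold cs; fun_prop

lemma winding {E : Type*} [TopologicalSpace E] [LocallyPathConnectedSpace E] (e : ℂ ≃ₜ E)
    (Ω : Set E) (hΩ : IsOpen Ω) (hsc : IsSimplyConnected Ω) (z : ℂ) (hz : e z ∉ Ω) (ρ : ℝ)
    (hρ : 0 < ρ) : ∃ θ ∈ Set.Icc (-π) π, e (z + ρ * cs θ) ∉ Ω := by
  by_contra hcon
  push Not at hcon
  obtain ⟨f, hf, hfe⟩ := Complex.exists_continuousOn_eqOn_exp_comp hsc hΩ
    (g := fun x => e.symm x - z) (by fun_prop) (by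
      rintro ⟨x, hx, hx0⟩
      apply hz
      have : e.symm x = z := sub_eq_zero.mp hx0
      rw [← this]; simpa using hx)
  set h : ℝ → ℂ := fun θ => f (e (z + ρ * cs θ)) with hh
  have hc : ContinuousOn h (Set.Icc (-π) π) := by
    apply hf.comp _ hcon
    have := continuous_cs
    fun_prop
  have hexp : ∀ θ ∈ Set.Icc (-π) π, Complex.exp (h θ) = ρ * Complex.exp (θ * Complex.I) := by
    intro θ hθ
    have := hfe (hcon θ hθ)
    simp only [Function.comp_apply, Homeomorph.symm_apply_apply, add_sub_cancel_left] at this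
    rw [hh, this, cs_eq]
  have hρ' : Complex.exp (Real.log ρ : ℝ) = ρ := by
    rw [← Complex.ofReal_exp, Real.exp_log hρ]
  have hinteger : ∀ θ ∈ Set.Icc (-π) π, ∃ n : ℤ, (h θ).im - θ = n * (2 * π) := by
    intro θ hθ
    have h1 : Complex.exp (h θ - (Real.log ρ : ℝ) - θ * Complex.I) = 1 := by
      rw [Complex.exp_sub, Complex.exp_sub, hexp θ hθ, hρ']
      have : (ρ : ℂ) ≠ 0 := by exact_mod_cast hρ.ne'
      field_simp
    obtain ⟨n, hn⟩ := Complex.exp_eq_one_iff.mp h1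
    refine ⟨n, ?_⟩
    have := congrArg Complex.im hn
    simpa using this
  have hpc : IsPreconnected (Set.Icc (-π) π) := isPreconnected_Icc
  have hk : ContinuousOn (fun θ : ℝ => ((h θ).im - θ) / (2 * π)) (Set.Icc (-π) π) := by
    have : ContinuousOn (fun θ => (h θ).im) (Set.Icc (-π) π) :=
      Complex.continuous_im.comp_continuousOn hc
    fun_prop
  have hm : Set.MapsTo (fun θ : ℝ => ((h θ).im - θ) / (2 * π)) (Set.Icc (-π) π)
      (Set.range ((↑) : ℤ → ℝ)) := by
    intro θ hθ
    obtain ⟨n, hn⟩ := hinteger θ hθ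
    refine ⟨n, ?_⟩
    simp only [hn]
    field_simp
  have hpi := Real.pi_pos
  have hd : DiscreteTopology (Set.range ((↑) : ℤ → ℝ)) :=
    (Int.isClosedEmbedding_coe_real.isEmbedding.toHomeomorph.symm.isEmbedding.discreteTopology)
  have := hpc.constant_of_mapsTo (isDiscrete_iff_discreteTopology.mpr hd) hk hm (x := -π) (y := π) ⟨le_rfl, by linarith⟩
    ⟨by linarith, le_rfl⟩
  have hs : h (-π) = h π := by
    simp [hh, cs]
  simp only [hs] at this
  field_simp at this
  linarith

/-- polar coordinates, centered at `x`. -/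
lemma polar1 (f : ℂ → ENNReal) (hf : Measurable f) (x : ℂ) :
    ∫⁻ y, f y = ∫⁻ θ in Set.Ioo (-π) π, ∫⁻ r in Set.Ioi (0:ℝ),
      ENNReal.ofReal r * f (x + r * cs θ) := by
  rw [← lintegral_add_left_eq_self f x, ← Complex.lintegral_comp_polarCoord_symm]
  simp only [Complex.polarCoord_symm_apply, smul_eq_mul, polarCoord_target, Measure.volume_eq_prod]
  rw [← Measure.prod_restrict, lintegral_prod_symm]
  · rfl
  · apply Measurable.aemeasurable; fun_prop

lemma polar2 (f : ℂ → ENNReal) (hf : Measurable f) (x : ℂ) :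
    ∫⁻ y, f y = ∫⁻ r in Set.Ioi (0:ℝ), ∫⁻ θ in Set.Ioo (-π) π,
      ENNReal.ofReal r * f (x + r * cs θ) := by
  rw [← lintegral_add_left_eq_self f x, ← Complex.lintegral_comp_polarCoord_symm]
  simp only [Complex.polarCoord_symm_apply, smul_eq_mul, polarCoord_target, Measure.volume_eq_prod]
  rw [← Measure.prod_restrict, lintegral_prod]
  · rfl
  · apply Measurable.aemeasurable; fun_prop

lemma ftc_bound (h : ℝ → ℝ) (hh : ContDiff ℝ 1 h) (a b : ℝ) :
    ‖h b - h a‖ₑ ≤ ∫⁻ t in Set.uIoc a b, ‖deriv h t‖ₑ := by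
  have hc : Continuous (deriv h) := hh.continuous_deriv le_rfl
  rw [← intervalIntegral.integral_deriv_eq_sub (fun x _ => hh.differentiable one_ne_zero x)
    (hc.intervalIntegrable _ _)]
  rw [← enorm_norm, intervalIntegral.norm_integral_eq_norm_integral_uIoc, enorm_norm]
  exact enorm_integral_le_lintegral_enorm _

lemma deriv_ray (u : ℂ → ℝ) (hu : ContDiff ℝ 1 u) (x : ℂ) (θ r : ℝ) :
    ‖deriv (fun r : ℝ => u (x + r * cs θ)) r‖ₑ ≤ ‖fderiv ℝ u (x + r * cs θ)‖ₑ := by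
  have h1 : HasDerivAt (fun r : ℝ => x + r * cs θ) (cs θ) r := by
    have := (Complex.ofRealCLM.hasDerivAt (x := r)).mul_const (cs θ)
    simpa using this.const_add x
  have h2 := ((hu.differentiable one_ne_zero _).hasFDerivAt.comp_hasDerivAt r h1).deriv
  simp only [Function.comp_def] at h2
  rw [h2]
  have := (fderiv ℝ u (x + r * cs θ)).le_opENorm (cs θ)
  rwa [← ofReal_norm (cs θ), norm_cs, ENNReal.ofReal_one, mul_one] at this

lemma deriv_circ (u : ℂ → ℝ) (hu : ContDiff ℝ 1 u) (x : ℂ) (θ r : ℝ) :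
    ‖deriv (fun t : ℝ => u (x + r * cs t)) θ‖ₑ ≤ ‖r‖ₑ * ‖fderiv ℝ u (x + r * cs θ)‖ₑ := by
  have h0 : HasDerivAt cs (Complex.I * cs θ) θ := by
    have h1 : HasDerivAt (fun t : ℝ => (t : ℂ) * Complex.I) Complex.I θ := by
      simpa using (Complex.ofRealCLM.hasDerivAt (x := θ)).mul_const Complex.I
    have := h1.cexp
    have hcs : cs = fun t : ℝ => Complex.exp ((t : ℂ) * Complex.I) := funext cs_eq
    rw [hcs]
    simpa [mul_comm] using this
  have h1 : HasDerivAt (fun t : ℝ => x + r * cs t) (r * (Complex.I * cs θ)) θ := by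
    simpa using (h0.const_mul (r : ℂ)).const_add x
  have h2 := ((hu.differentiable one_ne_zero _).hasFDerivAt.comp_hasDerivAt θ h1).deriv
  simp only [Function.comp_def] at h2
  rw [h2]
  have := (fderiv ℝ u (x + r * cs θ)).le_opENorm (r * (Complex.I * cs θ))
  rw [mul_comm ‖r‖ₑ]
  convert this using 2
  rw [← ofReal_norm, ← ofReal_norm]
  simp [norm_cs]

lemma contDiff_cs : ContDiff ℝ 1 cs := by
  have hcs : cs = fun t : ℝ => Complex.exp ((t : ℂ) * Complex.I) := funext cs_eq
  rw [hcs]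
  exact (Complex.ofRealCLM.contDiff.mul contDiff_const).cexp

/-- Radial representation bound. -/
lemma radial_rep (u : ℂ → ℝ) (hu : ContDiff ℝ 1 u) (hc : HasCompactSupport u) (x : ℂ) :
    ENNReal.ofReal (2 * π) * ‖u x‖ₑ ≤ ∫⁻ y, ‖fderiv ℝ u y‖ₑ * ‖y - x‖ₑ⁻¹ := by
  have hcf : Continuous (fderiv ℝ u) := hu.continuous_fderiv one_ne_zero
  rw [polar1 _ (by fun_prop) x]
  have key : ∀ θ : ℝ, ‖u x‖ₑ ≤ ∫⁻ r in Set.Ioi (0:ℝ),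
      ENNReal.ofReal r * (‖fderiv ℝ u (x + r * cs θ)‖ₑ * ‖x + r * cs θ - x‖ₑ⁻¹) := by
    intro θ
    obtain ⟨R, hR⟩ := hc.isCompact.isBounded.subset_ball x
    set R' := max R 1
    have hR' : 0 < R' := lt_of_lt_of_le one_pos (le_max_right _ _)
    have hz : u (x + R' * cs θ) = 0 := by
      by_contra hne
      have := hR (subset_tsupport u hne)
      rw [Metric.mem_ball, dist_eq_norm] at this
      simp [norm_cs, abs_of_pos hR'] at this
      exact absurd this (not_lt.mpr (le_max_left _ _))
    have h1 := ftc_bound (fun r : ℝ => u (x + r * cs θ)) (by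
      apply hu.comp
      exact contDiff_const.add (Complex.ofRealCLM.contDiff.mul contDiff_const)) 0 R'
    simp only [hz] at h1
    simp only [Complex.ofReal_zero, zero_mul, add_zero, zero_sub, enorm_neg] at h1
    refine h1.trans ?_
    rw [Set.uIoc_of_le hR'.le]
    refine (lintegral_mono_set (Set.Ioc_subset_Ioi_self)).trans ?_
    apply setLIntegral_mono' measurableSet_Ioi
    intro r hr
    refine (deriv_ray u hu x θ r).trans ?_
    have : ‖x + r * cs θ - x‖ₑ = ENNReal.ofReal r := by
      rw [← ofReal_norm]
      simp [norm_cs, abs_of_pos (show 0 < r from hr)]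
    rw [this, mul_comm (ENNReal.ofReal r), mul_assoc, ENNReal.inv_mul_cancel, mul_one]
    · simpa using hr
    · simp
  calc ENNReal.ofReal (2 * π) * ‖u x‖ₑ = ∫⁻ θ in Set.Ioo (-π) π, ‖u x‖ₑ := by
        rw [setLIntegral_const, Real.volume_Ioo, mul_comm]; congr 2; ring
    _ ≤ _ := by
      apply lintegral_mono
      intro θ
      exact key θ

lemma cauchy_schwarz {α : Type*} [MeasurableSpace α] (μ : Measure α) (f g : α → ENNReal)
    (hf : AEMeasurable f μ) (hg : AEMeasurable g μ) :
    (∫⁻ a, f a * g a ∂μ) ^ 2 ≤ (∫⁻ a, f a ^ 2 ∂μ) * (∫⁻ a, g a ^ 2 ∂μ) := by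
  have := ENNReal.lintegral_mul_le_Lp_mul_Lq μ (Real.HolderConjugate.two_two) hf hg
  simp only [Pi.mul_apply, ENNReal.rpow_two] at this
  calc _ ≤ _ := pow_le_pow_left₀ (by positivity) this 2
    _ = _ := by
      rw [mul_pow, ← ENNReal.rpow_two, ← ENNReal.rpow_two, ← ENNReal.rpow_mul, ← ENNReal.rpow_mul]
      norm_num

lemma poincare_ball (u : ℂ → ℝ) (hu : ContDiff ℝ 1 u) (z : ℂ)
    (hv : ∀ ρ : ℝ, 0 < ρ → ∃ θ ∈ Set.Icc (-π) π, u (z + ρ * cs θ) = 0) (R : ℝ) :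
    ∫⁻ y in Metric.ball z R, ‖u y‖ₑ ^ 2 ≤
      ENNReal.ofReal (4 * π ^ 2 * R ^ 2) * ∫⁻ y in Metric.ball z R, ‖fderiv ℝ u y‖ₑ ^ 2 := by
  have hcf : Continuous (fderiv ℝ u) := hu.continuous_fderiv one_ne_zero
  have hcu := hu.continuous
  have hpi := Real.pi_pos
  have hcs := continuous_cs
  rw [← lintegral_indicator measurableSet_ball, ← lintegral_indicator measurableSet_ball,
    polar2 _ (Measurable.indicator (by fun_prop) measurableSet_ball) z,
    polar2 _ (Measurable.indicator (by fun_prop) measurableSet_ball) z,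
    ← lintegral_const_mul' _ _ ENNReal.ofReal_ne_top]
  apply setLIntegral_mono' measurableSet_Ioi
  intro r hr
  have hr : 0 < r := hr
  have hmem : ∀ θ, (z + r * cs θ) ∈ Metric.ball z R ↔ r < R := by
    intro θ
    rw [Metric.mem_ball, dist_eq_norm]
    simp [norm_cs, abs_of_pos hr]
  by_cases hrR : r < R
  swap
  · simp [Set.indicator, hmem, hrR]
  simp only [Set.indicator, hmem, hrR, if_true]
  obtain ⟨θ₀, hθ₀, hz⟩ := hv r hr
  rw [lintegral_const_mul' _ _ ENNReal.ofReal_ne_top, lintegral_const_mul' _ _ ENNReal.ofReal_ne_top]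
  rw [mul_left_comm]
  gcongr
  have hh : ContDiff ℝ 1 (fun t : ℝ => u (z + r * cs t)) := by
    apply hu.comp
    exact contDiff_const.add (contDiff_const.mul contDiff_cs)
  set Q := ∫⁻ θ in Set.Ioo (-π) π, ‖fderiv ℝ u (z + r * cs θ)‖ₑ ^ 2 with hQ
  have key : ∀ θ ∈ Set.Ioo (-π) π, ‖u (z + r * cs θ)‖ₑ ^ 2 ≤ ENNReal.ofReal (2 * π * R ^ 2) * Q := by
    intro θ hθ
    have h1 := ftc_bound _ hh θ₀ θ
    simp only [hz, sub_zero] at h1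
    have h2 : ‖u (z + r * cs θ)‖ₑ ≤ ∫⁻ t in Set.Ioo (-π) π, (‖r‖ₑ * ‖fderiv ℝ u (z + r * cs t)‖ₑ) * 1 := by
      refine h1.trans ?_
      rw [restrict_Ioo_eq_restrict_Ioc]
      have hsub : Set.uIoc θ₀ θ ⊆ Set.Ioc (-π) π := by
        intro t ht
        rw [Set.mem_uIoc] at ht
        rcases ht with ht | ht
        · exact ⟨by linarith [hθ₀.1], by linarith [hθ.2]⟩
        · exact ⟨by linarith [hθ.1], by linarith [hθ₀.2]⟩
      refine (lintegral_mono_set hsub).trans ?_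
      apply lintegral_mono
      intro t
      simp only [mul_one]
      exact deriv_circ u hu z t r
    calc _ ≤ _ := pow_le_pow_left₀ (by positivity) h2 2
      _ ≤ _ := cauchy_schwarz _ _ _ (by fun_prop) (by fun_prop)
      _ = (‖r‖ₑ ^ 2 * Q) * ENNReal.ofReal (2 * π) := by
        simp only [mul_pow, one_pow]
        rw [lintegral_const_mul' _ _ (by simp), setLIntegral_const, Real.volume_Ioo]
        congr 1
        rw [one_mul]; congr 1; ring
      _ ≤ (ENNReal.ofReal (R ^ 2) * Q) * ENNReal.ofReal (2 * π) := by
        gcongr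
        rw [← ofReal_norm, ← ENNReal.ofReal_pow (norm_nonneg _)]
        apply ENNReal.ofReal_le_ofReal
        rw [Real.norm_eq_abs, sq_abs]
        gcongr
      _ = _ := by
        rw [mul_right_comm, ← ENNReal.ofReal_mul (by positivity)]
        congr 2; ring
  calc _ ≤ ∫⁻ θ in Set.Ioo (-π) π, ENNReal.ofReal (2 * π * R ^ 2) * Q :=
        setLIntegral_mono' measurableSet_Ioo key
    _ = _ := by
      rw [setLIntegral_const, Real.volume_Ioo, mul_right_comm, ← ENNReal.ofReal_mul (by positivity)]
      congr 2; ring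

lemma ball_average (f : ℂ → ENNReal) (hf : Measurable f) (R : ℝ) :
    ∫⁻ x, ∫⁻ y in Metric.ball x R, f y = volume (Metric.ball (0:ℂ) R) * ∫⁻ y, f y := by
  have h1 : ∀ x, ∫⁻ y in Metric.ball x R, f y = ∫⁻ y, if dist y x < R then f y else 0 := by
    intro x
    rw [← lintegral_indicator measurableSet_ball]
    simp [Set.indicator, Metric.mem_ball]
  simp_rw [h1]
  have hm : Measurable (Function.uncurry fun x y : ℂ => if dist y x < R then f y else 0) := by
    apply Measurable.ite
    · apply measurableSet_lt <;> fun_prop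
    · fun_prop
    · fun_prop
  rw [lintegral_lintegral_swap hm.aemeasurable]
  have h2 : ∀ y, ∫⁻ x, (if dist y x < R then f y else 0) = volume (Metric.ball (0:ℂ) R) * f y := by
    intro y
    have : ∀ x, (if dist y x < R then f y else 0) = (Metric.ball y R).indicator (fun _ => f y) x := by
      intro x
      simp [Set.indicator, Metric.mem_ball, dist_comm]
    simp_rw [this]
    rw [lintegral_indicator measurableSet_ball, setLIntegral_const, mul_comm]
    simp [Complex.volume_ball]
  simp_rw [h2]
  rw [lintegral_const_mul _ hf]

lemma poincare_global (u : ℂ → ℝ) (hu : ContDiff ℝ 1 u) (Z : Set ℂ)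
    (hv : ∀ z ∈ Z, ∀ ρ : ℝ, 0 < ρ → ∃ θ ∈ Set.Icc (-π) π, u (z + ρ * cs θ) = 0) (R : ℝ)
    (hR : 0 < R) (hZ : ∀ x, ∃ z ∈ Z, dist z x < R) :
    ∫⁻ y, ‖u y‖ₑ ^ 2 ≤
      ENNReal.ofReal (144 * π ^ 2 * R ^ 2) * ∫⁻ y, ‖fderiv ℝ u y‖ₑ ^ 2 := by
  have hcf : Continuous (fderiv ℝ u) := hu.continuous_fderiv one_ne_zero
  have hcu := hu.continuous
  have hpi := Real.pi_pos
  have h1 : ∀ x, ∫⁻ y in Metric.ball x R, ‖u y‖ₑ ^ 2 ≤ ENNReal.ofReal (4 * π ^ 2 * (2 * R) ^ 2) *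
      ∫⁻ y in Metric.ball x (3 * R), ‖fderiv ℝ u y‖ₑ ^ 2 := by
    intro x
    obtain ⟨z, hz, hzx⟩ := hZ x
    calc _ ≤ ∫⁻ y in Metric.ball z (2 * R), ‖u y‖ₑ ^ 2 := by
          apply lintegral_mono_set
          apply Metric.ball_subset_ball'
          rw [dist_comm]; linarith
      _ ≤ _ := poincare_ball u hu z (hv z hz) (2 * R)
      _ ≤ _ := by
        gcongr
        apply Metric.ball_subset_ball'
        linarith
  have h2 : volume (Metric.ball (0:ℂ) R) * ∫⁻ y, ‖u y‖ₑ ^ 2 ≤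
    ENNReal.ofReal (4 * π ^ 2 * (2 * R) ^ 2) *
     (volume (Metric.ball (0:ℂ) (3 * R)) * ∫⁻ y, ‖fderiv ℝ u y‖ₑ ^ 2) := by
    rw [← ball_average _ (by fun_prop), ← ball_average _ (by fun_prop),
      ← lintegral_const_mul' _ _ ENNReal.ofReal_ne_top]
    exact lintegral_mono h1
  have h3 : volume (Metric.ball (0:ℂ) (3 * R)) = ENNReal.ofReal 9 * volume (Metric.ball (0:ℂ) R) := by
    rw [Complex.volume_ball, Complex.volume_ball, ENNReal.ofReal_mul (by norm_num), mul_pow,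
      ← ENNReal.ofReal_pow (by norm_num), mul_assoc]
    norm_num
  have h4 : volume (Metric.ball (0:ℂ) R) ≠ 0 := (Metric.measure_ball_pos _ _ hR).ne'
  have h5 : volume (Metric.ball (0:ℂ) R) ≠ ⊤ := measure_ball_lt_top.ne
  rw [← ENNReal.mul_le_mul_iff_right h4 h5]
  refine h2.trans (le_of_eq ?_)
  rw [h3, show 144 * π ^ 2 * R ^ 2 = (4 * π ^ 2 * (2 * R) ^ 2) * 9 by ring,
    ENNReal.ofReal_mul (p := 4 * π ^ 2 * (2 * R) ^ 2) (by positivity)]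
  ring

lemma kernel_ball (x : ℂ) (ρ : ℝ) (hρ : 0 < ρ) :
    ∫⁻ y in Metric.ball x ρ, ‖y - x‖ₑ⁻¹ = ENNReal.ofReal (2 * π * ρ) := by
  rw [← lintegral_indicator measurableSet_ball,
    polar1 _ (Measurable.indicator (by fun_prop) measurableSet_ball) x]
  have : ∀ θ : ℝ, ∫⁻ r in Set.Ioi (0:ℝ), ENNReal.ofReal r *
      (Metric.ball x ρ).indicator (fun y => ‖y - x‖ₑ⁻¹) (x + r * cs θ) = ENNReal.ofReal ρ := by
    intro θ
    calc _ = ∫⁻ r in Set.Ioi (0:ℝ), (Set.Iio ρ).indicator 1 r := by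
          apply setLIntegral_congr_fun measurableSet_Ioi
          intro r hr
          have hr : 0 < r := hr
          have hn : ‖x + r * cs θ - x‖ₑ = ENNReal.ofReal r := by
            rw [← ofReal_norm]
            simp [norm_cs, abs_of_pos hr]
          have hmem : (x + r * cs θ) ∈ Metric.ball x ρ ↔ r < ρ := by
            rw [Metric.mem_ball, dist_eq_norm]
            simp [norm_cs, abs_of_pos hr]
          by_cases h : r < ρ
          · simp only [Set.indicator, hmem, h, if_true, hn, Set.mem_Iio, Pi.one_apply]
            exact ENNReal.mul_inv_cancel (by simpa using hr) (by simp)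
          · simp [Set.indicator, hmem, h]
      _ = _ := by
        rw [lintegral_indicator measurableSet_Iio, Measure.restrict_restrict measurableSet_Iio]
        simp [Set.Iio_inter_Ioi]
  simp_rw [this]
  rw [setLIntegral_const, Real.volume_Ioo, ← ENNReal.ofReal_mul hρ.le]
  congr 1; ring

lemma kernel_annulus (x : ℂ) (ρ R : ℝ) (hρ : 0 < ρ) (hR : ρ ≤ R) :
    ∫⁻ y in Metric.ball x R \ Metric.ball x ρ, (‖y - x‖ₑ⁻¹) ^ 2 =
      ENNReal.ofReal (2 * π * Real.log (R / ρ)) := by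
  have hms : MeasurableSet (Metric.ball x R \ Metric.ball x ρ) :=
    measurableSet_ball.diff measurableSet_ball
  rw [← lintegral_indicator hms, polar1 _ (Measurable.indicator (by fun_prop) hms) x]
  have : ∀ θ : ℝ, ∫⁻ r in Set.Ioi (0:ℝ), ENNReal.ofReal r *
      (Metric.ball x R \ Metric.ball x ρ).indicator (fun y => (‖y - x‖ₑ⁻¹) ^ 2) (x + r * cs θ)
        = ENNReal.ofReal (Real.log (R / ρ)) := by
    intro θ
    calc _ = ∫⁻ r in Set.Ioi (0:ℝ), (Set.Ico ρ R).indicator (fun r => ENNReal.ofReal (1 / r)) r := by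
          apply setLIntegral_congr_fun measurableSet_Ioi
          intro r hr
          have hr : 0 < r := hr
          have hn : ‖x + r * cs θ - x‖ₑ = ENNReal.ofReal r := by
            rw [← ofReal_norm]
            simp [norm_cs, abs_of_pos hr]
          have hmem : (x + r * cs θ) ∈ Metric.ball x R \ Metric.ball x ρ ↔ r ∈ Set.Ico ρ R := by
            rw [Set.mem_diff, Metric.mem_ball, Metric.mem_ball, dist_eq_norm]
            simp [norm_cs, abs_of_pos hr, and_comm]
          by_cases h : r ∈ Set.Ico ρ R
          · simp only [Set.indicator, hmem, h, if_true, hn]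
            rw [← ENNReal.ofReal_inv_of_pos hr, ← ENNReal.ofReal_pow (by positivity),
              ← ENNReal.ofReal_mul hr.le]
            congr 1; field_simp
          · simp only [Set.indicator, hmem, h, if_false, mul_zero]
      _ = ∫⁻ r in Set.Ioc ρ R, ENNReal.ofReal (1 / r) := by
        rw [lintegral_indicator measurableSet_Ico, Measure.restrict_restrict measurableSet_Ico,
          Set.inter_eq_left.mpr, restrict_Ico_eq_restrict_Ioc]
        intro r hr
        exact lt_of_lt_of_le hρ hr.1
      _ = _ := by
        rw [← ofReal_integral_eq_lintegral_ofReal, ← intervalIntegral.integral_of_le hR,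
          integral_one_div_of_pos hρ (lt_of_lt_of_le hρ hR)]
        · rw [← IntegrableOn, ← intervalIntegrable_iff_integrableOn_Ioc_of_le hR]
          apply intervalIntegral.intervalIntegrable_one_div
          · intro r hr
            rw [Set.uIcc_of_le hR] at hr
            exact (lt_of_lt_of_le hρ hr.1).ne'
          · fun_prop
        · filter_upwards [ae_restrict_mem measurableSet_Ioc] with r hr
          have : 0 < r := hρ.trans hr.1
          simp only [Pi.zero_apply]; positivity
  simp_rw [this]
  rw [setLIntegral_const, Real.volume_Ioo, ← ENNReal.ofReal_mul]
  · congr 1; ring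
  · apply Real.log_nonneg
    rw [le_div_iff₀ hρ]; linarith

lemma kernel_far (x : ℂ) (ρ s t : ℝ) (hρ : 0 < ρ) (hs : π * ρ ^ 2 = s) (ht : 0 ≤ t) (T : Set ℂ)
    (hT : MeasurableSet T) (hTt : volume T ≤ ENNReal.ofReal t) :
    ∫⁻ y in T \ Metric.ball x ρ, (‖y - x‖ₑ⁻¹) ^ 2 ≤
      ENNReal.ofReal (π * Real.log (1 + t / s) + π) := by
  have hpi := Real.pi_pos
  set R := √(ρ ^ 2 + t / π) with hRdef
  have hR2 : R ^ 2 = ρ ^ 2 + t / π := Real.sq_sqrt (by positivity)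
  have hRp : 0 < R := by apply Real.sqrt_pos.mpr; positivity
  have hR : ρ ≤ R := by
    apply Real.le_sqrt_of_sq_le
    have : 0 ≤ t / π := by positivity
    linarith
  have hspos : 0 < s := by rw [← hs]; positivity
  have hlog : 2 * π * Real.log (R / ρ) = π * Real.log (1 + t / s) := by
    have : 1 + t / s = (R / ρ) ^ 2 := by
      rw [div_pow, hR2, ← hs]; field_simp
    rw [this, Real.log_pow]; push_cast; ring
  have hlog0 : 0 ≤ π * Real.log (1 + t / s) := by
    apply mul_nonneg hpi.le
    apply Real.log_nonneg
    have : 0 ≤ t / s := by positivity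
    linarith
  calc _ ≤ ∫⁻ y in (Metric.ball x R \ Metric.ball x ρ) ∪ (T \ Metric.ball x R), (‖y - x‖ₑ⁻¹) ^ 2 := by
        apply lintegral_mono_set
        intro y hy
        by_cases h : y ∈ Metric.ball x R
        · exact Or.inl ⟨h, hy.2⟩
        · exact Or.inr ⟨hy.1, h⟩
    _ ≤ _ := lintegral_union_le _ _ _
    _ ≤ ENNReal.ofReal (π * Real.log (1 + t / s)) + ENNReal.ofReal π := by
      gcongr
      · rw [kernel_annulus x ρ R hρ hR, hlog]
      · calc _ ≤ ∫⁻ y in T \ Metric.ball x R, ENNReal.ofReal (1 / R ^ 2) := by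
              apply setLIntegral_mono' (hT.diff measurableSet_ball)
              intro y hy
              have h1 : R ≤ ‖y - x‖ := by
                have := hy.2
                rw [Metric.mem_ball, dist_eq_norm] at this
                linarith
              rw [← ofReal_norm, ← ENNReal.ofReal_inv_of_pos (by linarith),
                ← ENNReal.ofReal_pow (by positivity)]
              apply ENNReal.ofReal_le_ofReal
              rw [inv_pow, one_div]
              gcongr
          _ = ENNReal.ofReal (1 / R ^ 2) * volume (T \ Metric.ball x R) := setLIntegral_const _ _
          _ ≤ ENNReal.ofReal (1 / R ^ 2) * ENNReal.ofReal t := by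
            gcongr
            exact (measure_mono Set.diff_subset).trans hTt
          _ ≤ _ := by
            rw [← ENNReal.ofReal_mul (by positivity)]
            apply ENNReal.ofReal_le_ofReal
            rw [hR2, div_mul_eq_mul_div, one_mul, div_le_iff₀ (by positivity)]
            have : π * (ρ ^ 2 + t / π) = π * ρ ^ 2 + t := by field_simp
            rw [this]
            have : 0 < π * ρ ^ 2 := by positivity
            linarith
    _ = _ := by rw [← ENNReal.ofReal_add hlog0 hpi.le]

lemma kernel_main (s t : ℝ) (hs : 0 < s) (ht : 0 ≤ t) (S T : Set ℂ)
    (hS : MeasurableSet S) (hT : MeasurableSet T) (hSs : volume S = ENNReal.ofReal s)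
    (hTt : volume T ≤ ENNReal.ofReal t) :
    ∫⁻ y in T, (∫⁻ x in S, ‖y - x‖ₑ⁻¹) ^ 2 ≤
      ENNReal.ofReal (π * s ^ 2 * (Real.log (1 + t / s) + 9)) := by
  have hpi := Real.pi_pos
  set ρ := √(s / π) with hρdef
  have hρ2 : ρ ^ 2 = s / π := Real.sq_sqrt (by positivity)
  have hρ : 0 < ρ := by apply Real.sqrt_pos.mpr; positivity
  have hsρ : π * ρ ^ 2 = s := by rw [hρ2]; field_simp
  set k1 : ℂ → ℂ → ENNReal := fun y x => if dist y x < ρ then 0 else ‖y - x‖ₑ⁻¹ with hk1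
  set k2 : ℂ → ℂ → ENNReal := fun y x => if dist y x < ρ then ‖y - x‖ₑ⁻¹ else 0 with hk2
  have hm1 : Measurable (Function.uncurry k1) := by
    apply Measurable.ite
    · apply measurableSet_lt <;> fun_prop
    · fun_prop
    · fun_prop
  have hm2 : Measurable (Function.uncurry k2) := by
    apply Measurable.ite
    · apply measurableSet_lt <;> fun_prop
    · fun_prop
    · fun_prop
  have hm1l : ∀ y, Measurable (k1 y) := fun y => hm1.comp measurable_prodMk_left
  have hm2l : ∀ y, Measurable (k2 y) := fun y => hm2.comp measurable_prodMk_left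
  set I1 : ℂ → ENNReal := fun y => ∫⁻ x in S, k1 y x with hI1
  set I2 : ℂ → ENNReal := fun y => ∫⁻ x in S, k2 y x with hI2
  have hmI1 : Measurable I1 := hm1.lintegral_prod_right
  have hmI2 : Measurable I2 := hm2.lintegral_prod_right
  have hsum : ∀ y, ∫⁻ x in S, ‖y - x‖ₑ⁻¹ = I1 y + I2 y := by
    intro y
    simp only [hI1, hI2]
    rw [← lintegral_add_left (hm1l y)]
    apply lintegral_congr
    intro x
    simp only [hk1, hk2]
    split_ifs <;> simp
  have hb1 : ∀ y, I1 y ≤ ENNReal.ofReal (s / ρ) := by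
    intro y
    calc I1 y ≤ ∫⁻ x in S, ENNReal.ofReal (1 / ρ) := by
          apply lintegral_mono
          intro x
          simp only [hk1]
          split_ifs with h
          · exact zero_le
          · rw [dist_eq_norm, not_lt] at h
            rw [← ofReal_norm, ← ENNReal.ofReal_inv_of_pos (by linarith), one_div]
            apply ENNReal.ofReal_le_ofReal
            gcongr
      _ = _ := by
        rw [setLIntegral_const, hSs, ← ENNReal.ofReal_mul (by positivity)]
        congr 1; ring
  have hk2ball : ∀ y, ∫⁻ x, k2 y x = ENNReal.ofReal (2 * π * ρ) := by
    intro y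
    rw [← kernel_ball y ρ hρ, ← lintegral_indicator measurableSet_ball]
    apply lintegral_congr
    intro x
    simp only [hk2, Set.indicator, Metric.mem_ball, dist_comm y x, enorm_sub_rev y x]
  have hb2 : ∀ y, I2 y ≤ ENNReal.ofReal (2 * π * ρ) := by
    intro y
    exact (setLIntegral_le_lintegral _ _).trans (hk2ball y).le
  have hi2 : ∫⁻ y, I2 y ≤ ENNReal.ofReal (2 * π * ρ * s) := by
    simp only [hI2]
    rw [lintegral_lintegral_swap hm2.aemeasurable]
    have : ∀ x, ∫⁻ y, k2 y x = ENNReal.ofReal (2 * π * ρ) := by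
      intro x
      rw [← hk2ball x]
      apply lintegral_congr
      intro y
      simp only [hk2, dist_comm y x, enorm_sub_rev y x]
    simp_rw [this]
    rw [setLIntegral_const, hSs, ← ENNReal.ofReal_mul (by positivity)]
  have hi1 : ∫⁻ y in T, I1 y ^ 2 ≤ ENNReal.ofReal (s ^ 2 * (π * Real.log (1 + t / s) + π)) := by
    calc ∫⁻ y in T, I1 y ^ 2 ≤ ∫⁻ y in T, (∫⁻ x in S, k1 y x ^ 2) * ENNReal.ofReal s := by
          apply lintegral_mono
          intro y
          have := cauchy_schwarz (volume.restrict S) (k1 y) (fun _ => 1) (hm1l y).aemeasurable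
            (by fun_prop)
          simpa [hSs] using this
      _ = (∫⁻ x in S, ∫⁻ y in T, k1 y x ^ 2) * ENNReal.ofReal s := by
        rw [lintegral_mul_const' _ _ ENNReal.ofReal_ne_top, lintegral_lintegral_swap]
        exact (hm1.pow_const 2).aemeasurable
      _ ≤ (∫⁻ x in S, ENNReal.ofReal (π * Real.log (1 + t / s) + π)) * ENNReal.ofReal s := by
        gcongr with x
        refine le_trans (le_of_eq ?_) (kernel_far x ρ s t hρ hsρ ht T hT hTt)
        rw [← lintegral_indicator (hT.diff measurableSet_ball), ← lintegral_indicator hT]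
        apply lintegral_congr
        intro y
        by_cases hyT : y ∈ T
        · by_cases hyd : dist y x < ρ
          · simp [hk1, Set.indicator, hyT, hyd]
          · simp [hk1, Set.indicator, hyT, hyd]
        · simp [Set.indicator, hyT]
      _ = _ := by
        rw [setLIntegral_const, hSs, mul_assoc, ← ENNReal.ofReal_mul hs.le, mul_comm,
          ← ENNReal.ofReal_mul (by positivity)]
        congr 1; ring
  have hlog0 : 0 ≤ Real.log (1 + t / s) := by
    apply Real.log_nonneg
    have : 0 ≤ t / s := by positivity
    linarith
  calc ∫⁻ y in T, (∫⁻ x in S, ‖y - x‖ₑ⁻¹) ^ 2 =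
      ∫⁻ y in T, (I1 y ^ 2 + (2 * I1 y + I2 y) * I2 y) := by
        apply lintegral_congr
        intro y
        rw [hsum y]; ring
    _ = (∫⁻ y in T, I1 y ^ 2) + ∫⁻ y in T, (2 * I1 y + I2 y) * I2 y := by
        rw [lintegral_add_left (by fun_prop)]
    _ ≤ ENNReal.ofReal (s ^ 2 * (π * Real.log (1 + t / s) + π)) +
        ∫⁻ y, ENNReal.ofReal (2 * (s / ρ) + 2 * π * ρ) * I2 y := by
        refine add_le_add hi1 ?_
        refine (setLIntegral_le_lintegral _ _).trans ?_
        apply lintegral_mono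
        intro y
        dsimp only
        gcongr
        rw [ENNReal.ofReal_add (by positivity) (by positivity), ENNReal.ofReal_mul (by norm_num)]
        gcongr
        · simp
        · exact hb1 y
        · exact hb2 y
    _ ≤ ENNReal.ofReal (s ^ 2 * (π * Real.log (1 + t / s) + π)) +
        ENNReal.ofReal (2 * (s / ρ) + 2 * π * ρ) * ENNReal.ofReal (2 * π * ρ * s) := by
        rw [lintegral_const_mul' _ _ ENNReal.ofReal_ne_top]
        gcongr
    _ = _ := by
        rw [← ENNReal.ofReal_mul (by positivity), ← ENNReal.ofReal_add (by positivity) (by positivity)]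
        congr 1
        have h1 : (2 * (s / ρ) + 2 * π * ρ) * (2 * π * ρ * s) = 4 * π * s ^ 2 + 4 * π * (π * ρ ^ 2) * s := by
          field_simp; ring
        rw [h1, hsρ]; ring

lemma trunc_exists (u : ℂ → ℝ) (hu : ContDiff ℝ 1 u) (hc : HasCompactSupport u) (a b ε : ℝ)
    (ha : 0 ≤ a) (hε : 0 < ε) (hab : a + 2 * ε < b) :
    ∃ v : ℂ → ℝ, ContDiff ℝ 1 v ∧ HasCompactSupport v ∧ (∀ y, u y ≤ a → v y = 0) ∧
      (∀ y, b ≤ u y → b - a - 2 * ε ≤ v y) ∧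
      (∀ y, ‖fderiv ℝ v y‖ₑ ≤ (u ⁻¹' (Set.Ioc a b)).indicator (fun y => ‖fderiv ℝ u y‖ₑ) y) := by
  set η : ℝ → ℝ := fun t => max 0 (min 1 (min ((t - a) / ε) ((b - t) / ε))) with hη
  have hηc : Continuous η := by fun_prop
  have hη0 : ∀ t, 0 ≤ η t := fun t => le_max_left _ _
  have hη1 : ∀ t, η t ≤ 1 := fun t => max_le zero_le_one (min_le_left _ _)
  have hηa : ∀ t, t ≤ a → η t = 0 := by
    intro t ht
    apply max_eq_left
    refine (min_le_right _ _).trans ((min_le_left _ _).trans ?_)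
    apply div_nonpos_of_nonpos_of_nonneg <;> linarith
  have hηb : ∀ t, b ≤ t → η t = 0 := by
    intro t ht
    apply max_eq_left
    refine (min_le_right _ _).trans ((min_le_right _ _).trans ?_)
    apply div_nonpos_of_nonpos_of_nonneg <;> linarith
  have hηm : ∀ t, a + ε ≤ t → t ≤ b - ε → η t = 1 := by
    intro t h1 h2
    apply le_antisymm (hη1 t)
    refine le_trans ?_ (le_max_right _ _)
    refine le_min le_rfl (le_min ?_ ?_) <;> rw [le_div_iff₀ hε] <;> linarith
  set ψ : ℝ → ℝ := fun t => ∫ x in a..t, η x with hψ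
  have hψd : ∀ t, HasDerivAt ψ (η t) t := fun t =>
    intervalIntegral.integral_hasDerivAt_right (hηc.intervalIntegrable _ _)
      hηc.aestronglyMeasurable.stronglyMeasurableAtFilter hηc.continuousAt
  have hψ1 : ContDiff ℝ 1 ψ := by
    rw [contDiff_one_iff_deriv]
    refine ⟨fun t => (hψd t).differentiableAt, ?_⟩
    have : deriv ψ = η := funext fun t => (hψd t).deriv
    rwa [this]
  have hψa : ∀ t, t ≤ a → ψ t = 0 := by
    intro t ht
    simp only [hψ]
    rw [intervalIntegral.integral_congr (g := fun _ => 0)]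
    · simp
    · intro x hx
      rw [Set.uIcc_of_ge ht] at hx
      exact hηa x hx.2
  refine ⟨ψ ∘ u, hψ1.comp hu, ?_, ?_, ?_, ?_⟩
  · apply hc.comp_left (hψa 0 ha)
  · intro y hy
    exact hψa _ hy
  · intro y hy
    simp only [Function.comp_apply, hψ]
    calc b - a - 2 * ε = ∫ x in (a + ε)..(b - ε), η x := by
          rw [intervalIntegral.integral_congr (g := fun _ => 1)]
          · simp; ring
          · intro x hx
            rw [Set.uIcc_of_le (by linarith)] at hx
            exact hηm x hx.1 hx.2
      _ ≤ _ := by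
        apply intervalIntegral.integral_mono_interval (by linarith) (by linarith) (by linarith)
        · exact Filter.Eventually.of_forall hη0
        · exact hηc.intervalIntegrable _ _
  · intro y
    have h1 := ((hψd (u y)).comp_hasFDerivAt y (hu.differentiable one_ne_zero y).hasFDerivAt).fderiv
    rw [h1, enorm_smul]
    by_cases h : y ∈ u ⁻¹' (Set.Ioc a b)
    · rw [Set.indicator_of_mem h]
      calc _ ≤ 1 * ‖fderiv ℝ u y‖ₑ := by
            gcongr
            rw [← ofReal_norm, Real.norm_of_nonneg (hη0 _)]
            simpa using hη1 _
        _ = _ := one_mul _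
    · rw [Set.indicator_of_notMem h]
      have : η (u y) = 0 := by
        by_cases h' : u y ≤ a
        · exact hηa _ h'
        · apply hηb
          by_contra h''
          exact h ⟨by linarith, by linarith⟩
      simp [this]

lemma limit_aux (C d : ℝ) (hd : 0 < d) (X : ENNReal)
    (h : ∀ ε : ℝ, 0 < ε → 2 * ε < d → ENNReal.ofReal (C * (d - 2 * ε) ^ 2) ≤ X) :
    ENNReal.ofReal (C * d ^ 2) ≤ X := by
  have hcont : Continuous (fun ε : ℝ => ENNReal.ofReal (C * (d - 2 * ε) ^ 2)) :=
    ENNReal.continuous_ofReal.comp (by fun_prop)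
  have h0 := (hcont.tendsto 0).mono_left (nhdsWithin_le_nhds (s := Set.Ioi 0))
  simp only [mul_zero, sub_zero] at h0
  refine le_of_tendsto h0 ?_
  have : ∀ᶠ ε in nhdsWithin (0:ℝ) (Set.Ioi 0), ε < d / 2 :=
    nhdsWithin_le_nhds (eventually_lt_nhds (by positivity))
  filter_upwards [this, self_mem_nhdsWithin] with ε h1 h2
  exact h ε h2 (by linarith)

lemma capacity (u : ℂ → ℝ) (hu : ContDiff ℝ 1 u) (hc : HasCompactSupport u) (a b s t : ℝ)
    (ha : 0 ≤ a) (hab : a < b) (hs : 0 < s) (ht : 0 ≤ t)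
    (hSs : volume (u ⁻¹' Set.Ioi b) = ENNReal.ofReal s)
    (hTt : volume (u ⁻¹' Set.Ioi a) ≤ ENNReal.ofReal t) :
    ENNReal.ofReal (4 * π * (b - a) ^ 2) ≤
      (∫⁻ y in u ⁻¹' (Set.Ioc a b), ‖fderiv ℝ u y‖ₑ ^ 2) *
        ENNReal.ofReal (Real.log (1 + t / s) + 9) := by
  have hpi := Real.pi_pos
  have hcf : Continuous (fderiv ℝ u) := hu.continuous_fderiv one_ne_zero
  apply limit_aux _ _ (by linarith)
  intro ε hε hε2
  obtain ⟨v, hv, hvc, -, hvb, hvd⟩ := trunc_exists u hu hc a b ε ha hε (by linarith)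
  set c := b - a - 2 * ε with hcdef
  have hc0 : 0 < c := by linarith
  set S := u ⁻¹' Set.Ioi b
  set T := u ⁻¹' (Set.Ioc a b)
  have hS : MeasurableSet S := hu.continuous.measurable measurableSet_Ioi
  have hT : MeasurableSet T := hu.continuous.measurable measurableSet_Ioc
  have hTt' : volume T ≤ ENNReal.ofReal t :=
    (measure_mono (Set.preimage_mono Set.Ioc_subset_Ioi_self)).trans hTt
  have hlog0 : 0 ≤ Real.log (1 + t / s) := by
    apply Real.log_nonneg
    have : 0 ≤ t / s := by positivity
    linarith
  have h1 : ∀ x ∈ S, ENNReal.ofReal (2 * π * c) ≤ ∫⁻ y in T, ‖fderiv ℝ u y‖ₑ * ‖y - x‖ₑ⁻¹ := by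
    intro x hx
    calc ENNReal.ofReal (2 * π * c) = ENNReal.ofReal (2 * π) * ENNReal.ofReal c :=
          ENNReal.ofReal_mul (by positivity)
      _ ≤ ENNReal.ofReal (2 * π) * ‖v x‖ₑ := by
        gcongr
        rw [← ofReal_norm]
        apply ENNReal.ofReal_le_ofReal
        exact (hvb x (le_of_lt hx)).trans (le_abs_self _)
      _ ≤ _ := radial_rep v hv hvc x
      _ ≤ ∫⁻ y, T.indicator (fun y => ‖fderiv ℝ u y‖ₑ * ‖y - x‖ₑ⁻¹) y := by
        apply lintegral_mono
        intro y
        calc _ ≤ T.indicator (fun y => ‖fderiv ℝ u y‖ₑ) y * ‖y - x‖ₑ⁻¹ := by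
              exact mul_le_mul_left (hvd y) _
          _ = _ := by by_cases h : y ∈ T <;> simp [h]
      _ = _ := lintegral_indicator hT _
  have h2 : ENNReal.ofReal (2 * π * c * s) ≤
      ∫⁻ y in T, ‖fderiv ℝ u y‖ₑ * ∫⁻ x in S, ‖y - x‖ₑ⁻¹ := by
    calc ENNReal.ofReal (2 * π * c * s) = ∫⁻ x in S, ENNReal.ofReal (2 * π * c) := by
          rw [setLIntegral_const, hSs, ENNReal.ofReal_mul (by positivity)]
      _ ≤ _ := setLIntegral_mono' hS h1
      _ = ∫⁻ y in T, ∫⁻ x in S, ‖fderiv ℝ u y‖ₑ * ‖y - x‖ₑ⁻¹ := by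
        rw [lintegral_lintegral_swap]
        apply Measurable.aemeasurable
        fun_prop
      _ = _ := by
        apply lintegral_congr
        intro y
        rw [lintegral_const_mul' _ _ (by simp)]
  have h3 : ENNReal.ofReal ((2 * π * c * s) ^ 2) ≤ (∫⁻ y in T, ‖fderiv ℝ u y‖ₑ ^ 2) *
      ENNReal.ofReal (π * s ^ 2 * (Real.log (1 + t / s) + 9)) := by
    rw [ENNReal.ofReal_pow (by positivity)]
    refine (pow_le_pow_left₀ (by positivity) h2 2).trans ?_
    refine (cauchy_schwarz _ _ _ (by fun_prop) ?_).trans ?_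
    · apply Measurable.aemeasurable
      apply Measurable.lintegral_prod_right (f := fun y x : ℂ => ‖y - x‖ₑ⁻¹)
      fun_prop
    · gcongr
      exact kernel_main s t hs ht S T hS hT hSs hTt'
  have h4 : (2 * π * c * s) ^ 2 = (π * s ^ 2) * (4 * π * c ^ 2) := by ring
  rw [h4, ENNReal.ofReal_mul (by positivity), ENNReal.ofReal_mul (p := π * s ^ 2) (by positivity),
    mul_left_comm] at h3
  rwa [ENNReal.mul_le_mul_iff_right (by simp; positivity) ENNReal.ofReal_ne_top] at h3

lemma gap_ineq (p1 p2 l1 l2 τ1 τ2 N1 N2 κ : ℝ) (hl1 : 0 ≤ l1) (hp1 : p1 = l1 ^ 2)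
    (hp2 : p2 = l2 ^ 2) (hl : l1 < l2) (hN1 : 0 ≤ N1) (hN2 : 0 ≤ N2)
    (hc1 : p1 ≤ (1 - N1) * (τ1 + 10)) (hc2 : (l2 - l1) ^ 2 ≤ (N1 - N2) * (τ2 - τ1 + 10))
    (hlow : -10 ≤ τ1 - p1) (h1 : τ1 - p1 ≤ κ) (h2 : τ2 - p2 ≤ κ) (hτ : τ1 ≤ τ2)
    (hbig : 8 * (κ + 20) ≤ p1) : p2 - p1 ≤ 10 * (κ + 20) := by
  set K := κ + 20 with hK
  have hKpos : 0 < K := by linarith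
  have hp1pos : 0 < p1 := by linarith
  set d := p2 - p1 with hd
  have hdpos : 0 ≤ d := by rw [hd, hp1, hp2]; nlinarith
  have a1 : N1 * (τ1 + 10) ≤ K := by nlinarith
  have a2 : N1 * p1 ≤ K := le_trans (by nlinarith) a1
  have a3 : (l2 - l1) ^ 2 ≤ N1 * (d + K) := by
    refine hc2.trans ?_
    calc (N1 - N2) * (τ2 - τ1 + 10) ≤ N1 * (τ2 - τ1 + 10) := by
          apply mul_le_mul_of_nonneg_right <;> linarith
      _ ≤ _ := by apply mul_le_mul_of_nonneg_left _ hN1; linarith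
  have a4 : d ^ 2 = (l2 - l1) ^ 2 * (l1 + l2) ^ 2 := by rw [hd, hp1, hp2]; ring
  have a5 : (l1 + l2) ^ 2 ≤ 4 * (p1 + d) := by
    have : p1 + d = l2 ^ 2 := by rw [hd, hp2]; ring
    rw [this]; nlinarith
  have a6 : d ^ 2 ≤ 4 * (p1 * N1 + d * N1) * (d + K) := by
    rw [a4]
    calc _ ≤ (N1 * (d + K)) * (4 * (p1 + d)) := by
          apply mul_le_mul a3 a5 (by positivity) (by positivity)
      _ = _ := by ring
  have a7 : N1 ≤ 1 / 8 := by
    have : N1 * (8 * K) ≤ K := le_trans (mul_le_mul_of_nonneg_left hbig hN1) a2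
    nlinarith
  have a8 : d ^ 2 ≤ 4 * (K + d / 8) * (d + K) := by
    refine a6.trans ?_
    apply mul_le_mul_of_nonneg_right _ (by linarith)
    nlinarith
  by_contra hcon
  push Not at hcon
  nlinarith

/-- The constant in the one-dimensional lemma. -/
noncomputable def moserC : ENNReal :=
  ∑' n : ℕ, ENNReal.ofReal (Real.exp (10 - n) * (18 * (n + 11)))

lemma moserC_ne_top : moserC ≠ ⊤ := by
  have h : Summable (fun n : ℕ => Real.exp (10 - n) * (18 * ((n:ℝ) + 11))) := by
    have h1 := Real.summable_pow_mul_exp_neg_nat_mul 1 (r := 1) one_pos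
    have h0 := Real.summable_pow_mul_exp_neg_nat_mul 0 (r := 1) one_pos
    have := ((h1.mul_left (Real.exp 10 * 18)).add (h0.mul_left (Real.exp 10 * 18 * 11)))
    refine this.congr ?_
    intro n
    rw [sub_eq_add_neg, Real.exp_add]
    simp only [pow_one, pow_zero, neg_mul, one_mul]
    ring
  exact h.tsum_ofReal_ne_top

lemma core {X : Type*} [MeasurableSpace X] (μ : Measure X) (w : X → ℝ) (hw : Measurable w)
    (hμ : μ {x | 0 < w x} ≤ 1) (N : ℝ → ℝ) (hN : ∀ a, 0 ≤ a → 0 ≤ N a) (hN0 : N 0 ≤ 1)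
    (hcap : ∀ a b, 0 ≤ a → a < b → 0 < (μ {x | b < w x}).toReal →
      (b - a) ^ 2 ≤ (N a - N b) *
        (Real.log (1 + (μ {x | a < w x}).toReal / (μ {x | b < w x}).toReal) + 9)) :
    ∫⁻ x in {x | 0 < w x}, ENNReal.ofReal (Real.exp (w x ^ 2)) ∂μ ≤ moserC + 1 := by
  set s : ℝ → ℝ := fun a => (μ {x | a < w x}).toReal with hs
  have hfin : ∀ a, 0 ≤ a → μ {x | a < w x} ≤ 1 := fun a ha =>
    (measure_mono (fun x hx => lt_of_le_of_lt ha hx)).trans hμ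
  have hfin' : ∀ a, 0 ≤ a → μ {x | a < w x} ≠ ⊤ := fun a ha =>
    ((hfin a ha).trans_lt ENNReal.one_lt_top).ne
  have hs1 : ∀ a, 0 ≤ a → s a ≤ 1 := fun a ha => by
    simpa using ENNReal.toReal_mono ENNReal.one_ne_top (hfin a ha)
  have hsanti : ∀ a b, 0 ≤ a → a ≤ b → s b ≤ s a := fun a b ha hab =>
    ENNReal.toReal_mono (hfin' a ha) (measure_mono (fun x hx => lt_of_le_of_lt hab hx))
  have hcap' : ∀ a b, 0 ≤ a → a < b → 0 < s b →
      (b - a) ^ 2 ≤ (N a - N b) * (-Real.log (s b) - (-Real.log (s a)) + 10) := by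
    intro a b ha hab hsb
    have h1 := hcap a b ha hab hsb
    have hsa : 0 < s a := hsb.trans_le (hsanti a b ha hab.le)
    have hl : Real.log (1 + s a / s b) ≤ -Real.log (s b) - (-Real.log (s a)) + 1 := by
      have : 1 + s a / s b ≤ 2 * (s a / s b) := by
        have : 1 ≤ s a / s b := by rw [le_div_iff₀ hsb]; linarith [hsanti a b ha hab.le]
        linarith
      calc _ ≤ Real.log (2 * (s a / s b)) := Real.log_le_log (by positivity) this
        _ = Real.log 2 + (Real.log (s a) - Real.log (s b)) := by
          rw [Real.log_mul (by norm_num) (by positivity), Real.log_div hsa.ne' hsb.ne']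
        _ ≤ _ := by linarith [Real.log_two_lt_d9]
    have hl0 : 0 ≤ Real.log (1 + s a / s b) := by
      apply Real.log_nonneg
      have : 0 ≤ s a / s b := by positivity
      linarith
    have hpos : 0 ≤ N a - N b := by
      by_contra hneg
      push Not at hneg
      have : (N a - N b) * (Real.log (1 + s a / s b) + 9) < 0 :=
        mul_neg_of_neg_of_pos hneg (by linarith)
      have := sq_nonneg (b - a)
      linarith
    refine h1.trans ?_
    apply mul_le_mul_of_nonneg_left _ hpos
    linarith
  have hτ0 : ∀ a, 0 ≤ a → 0 ≤ -Real.log (s a) := fun a ha => by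
    have := Real.log_nonpos (x := s a) ENNReal.toReal_nonneg (hs1 a ha)
    linarith
  have hcap0 : ∀ b, 0 < b → 0 < s b → b ^ 2 ≤ (1 - N b) * (-Real.log (s b) + 10) := by
    intro b hb hsb
    have h1 := hcap' 0 b le_rfl hb hsb
    have h2 := hτ0 0 le_rfl
    have h3 : -Real.log (s 0) ≤ -Real.log (s b) := by
      have := Real.log_le_log hsb (hsanti 0 b le_rfl hb.le)
      linarith
    have hpos : 0 ≤ N 0 - N b := by
      by_contra hneg
      push Not at hneg
      have h5 : (N 0 - N b) * (-Real.log (s b) - (-Real.log (s 0)) + 10) < 0 :=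
        mul_neg_of_neg_of_pos hneg (by linarith)
      have := sq_nonneg (b - 0)
      linarith
    rw [sub_zero] at h1
    refine h1.trans ?_
    apply mul_le_mul <;> linarith
  have hlow : ∀ b, 0 < b → 0 < s b → -10 ≤ -Real.log (s b) - b ^ 2 := by
    intro b hb hsb
    have h1 := hcap0 b hb hsb
    have h2 := hτ0 b hb.le
    have h3 := hN b hb.le
    nlinarith
  -- the exceptional sets
  have hF : ∀ n : ℕ, ∃ F : Set ℝ, MeasurableSet F ∧ volume F ≤ ENNReal.ofReal (18 * (n + 11)) ∧
      ∀ p, 0 < p → 0 < s (√p) → -Real.log (s (√p)) - p ≤ n - 9 → p ∈ F := by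
    intro n
    set K : ℝ := n + 11 with hK
    have hKpos : 0 < K := by positivity
    set E : Set ℝ := {p | 8 * K ≤ p ∧ 0 < s (√p) ∧ -Real.log (s (√p)) - p ≤ n - 9} with hE
    refine ⟨Set.Icc 0 (8 * K) ∪ Set.Icc (sInf E) (sInf E + 10 * K),
      measurableSet_Icc.union measurableSet_Icc, ?_, ?_⟩
    · refine (measure_union_le _ _).trans ?_
      rw [Real.volume_Icc, Real.volume_Icc, ← ENNReal.ofReal_add (by linarith) (by linarith)]
      apply ENNReal.ofReal_le_ofReal
      linarith
    · intro p hp hsp hG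
      by_cases h8 : p < 8 * K
      · exact Or.inl ⟨hp.le, h8.le⟩
      push Not at h8
      right
      have hpE : p ∈ E := ⟨h8, hsp, hG⟩
      have hbdd : BddBelow E := ⟨8 * K, fun q hq => hq.1⟩
      refine ⟨csInf_le hbdd hpE, ?_⟩
      have : p - 10 * K ≤ sInf E := by
        apply le_csInf ⟨p, hpE⟩
        intro q hq
        by_cases hqp : p ≤ q
        · linarith
        push Not at hqp
        have hq0 : 0 < q := by linarith [hq.1]
        have hsq : √q < √p := Real.sqrt_lt_sqrt hq0.le hqp
        have hq' : 0 < √q := Real.sqrt_pos.mpr hq0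
        have e1 := Real.sq_sqrt hq0.le
        have e2 := Real.sq_sqrt hp.le
        have hc0 := hcap0 (√q) hq' hq.2.1
        have hl0 := hlow (√q) hq' hq.2.1
        rw [e1] at hc0 hl0
        have hKe : K = ((n:ℝ) - 9) + 20 := by rw [hK]; ring
        have := gap_ineq q p (√q) (√p) (-Real.log (s (√q))) (-Real.log (s (√p))) (N (√q)) (N (√p))
          (n - 9) hq'.le e1.symm e2.symm hsq (hN _ hq'.le) (hN _ (Real.sqrt_nonneg _)) hc0
          (hcap' _ _ hq'.le hsq hsp) hl0 hq.2.2 hG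
          (by
            have := Real.log_le_log hsp (hsanti (√q) (√p) hq'.le hsq.le)
            linarith) (by rw [← hKe]; exact hq.1)
        rw [← hKe] at this
        linarith
      linarith
  choose F hFm hFv hFp using hF
  have hpt : ∀ p ∈ Set.Ioi (0:ℝ), μ {x | √p < w x} * ENNReal.ofReal (Real.exp p) ≤
      ∑' n : ℕ, (F n).indicator (fun _ => ENNReal.ofReal (Real.exp (10 - n))) p := by
    intro p hp
    have hp : 0 < p := hp
    have hsq : 0 < √p := Real.sqrt_pos.mpr hp
    have hsμ : μ {x | √p < w x} = ENNReal.ofReal (s (√p)) :=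
      (ENNReal.ofReal_toReal (hfin' _ hsq.le)).symm
    by_cases hsp : 0 < s (√p)
    swap
    · rw [hsμ, ENNReal.ofReal_of_nonpos (not_lt.mp hsp)]
      simp
    have hl := hlow _ hsq hsp
    rw [Real.sq_sqrt hp.le] at hl
    set G := -Real.log (s (√p)) - p with hG
    set n := ⌊G + 10⌋₊ with hn
    have hn1 : (n:ℝ) ≤ G + 10 := Nat.floor_le (by linarith)
    have hn2 : G + 10 < n + 1 := Nat.lt_floor_add_one _
    have hmem : p ∈ F n := hFp n p hp hsp (by linarith)
    refine le_trans ?_ (ENNReal.le_tsum n)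
    rw [Set.indicator_of_mem hmem, hsμ, ← ENNReal.ofReal_mul hsp.le]
    apply ENNReal.ofReal_le_ofReal
    calc s (√p) * Real.exp p = Real.exp (-G) := by
          rw [hG, ← Real.exp_log hsp, ← Real.exp_add, Real.log_exp]; congr 1; ring
      _ ≤ _ := by apply Real.exp_le_exp.mpr; linarith
  have hmain : ∫⁻ p in Set.Ioi (0:ℝ), μ {x | √p < w x} * ENNReal.ofReal (Real.exp p) ≤ moserC := by
    calc _ ≤ _ := setLIntegral_mono' measurableSet_Ioi hpt
      _ ≤ _ := setLIntegral_le_lintegral _ _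
      _ = ∑' n : ℕ, ∫⁻ p, (F n).indicator (fun _ => ENNReal.ofReal (Real.exp (10 - n))) p := by
        rw [lintegral_tsum]
        intro n
        exact (measurable_const.indicator (hFm n)).aemeasurable
      _ ≤ _ := by
        apply ENNReal.tsum_le_tsum
        intro n
        rw [lintegral_indicator (hFm n), setLIntegral_const, ENNReal.ofReal_mul (by positivity)]
        gcongr
        exact hFv n
  have hlayer := lintegral_comp_eq_lintegral_meas_lt_mul μ (f := fun x => (max (w x) 0) ^ 2)
    (g := Real.exp) (Filter.Eventually.of_forall fun x => by positivity)
    (by fun_prop) (fun t _ => Real.continuous_exp.intervalIntegrable _ _)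
    (Filter.Eventually.of_forall fun x => (Real.exp_pos x).le)
  have hset : ∫⁻ p in Set.Ioi (0:ℝ), μ {x | p < (max (w x) 0) ^ 2} * ENNReal.ofReal (Real.exp p) =
      ∫⁻ p in Set.Ioi (0:ℝ), μ {x | √p < w x} * ENNReal.ofReal (Real.exp p) := by
    apply setLIntegral_congr_fun measurableSet_Ioi
    intro p hp
    have hp : 0 < p := hp
    have : {x | p < (max (w x) 0) ^ 2} = {x | √p < w x} := by
      ext x
      simp only [Set.mem_setOf_eq]
      rw [← Real.sqrt_lt_sqrt_iff hp.le, Real.sqrt_sq (le_max_right _ _), lt_max_iff]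
      have : ¬ √p < 0 := not_lt.mpr (Real.sqrt_nonneg _)
      simp [this]
    simp only [this]
  rw [hset] at hlayer
  have hmS : MeasurableSet {x | 0 < w x} := measurableSet_lt measurable_const hw
  calc ∫⁻ x in {x | 0 < w x}, ENNReal.ofReal (Real.exp (w x ^ 2)) ∂μ
      ≤ ∫⁻ x in {x | 0 < w x}, (ENNReal.ofReal (∫ t in (0:ℝ)..(max (w x) 0) ^ 2, Real.exp t) + 1) ∂μ := by
        apply setLIntegral_mono' hmS
        intro x hx
        have hx : 0 < w x := hx
        rw [max_eq_left hx.le, integral_exp, Real.exp_zero, ← ENNReal.ofReal_one,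
          ← ENNReal.ofReal_add _ zero_le_one]
        · apply ENNReal.ofReal_le_ofReal; linarith
        · have := Real.one_le_exp (sq_nonneg (w x)); linarith
    _ = (∫⁻ x in {x | 0 < w x}, ENNReal.ofReal (∫ t in (0:ℝ)..(max (w x) 0) ^ 2, Real.exp t) ∂μ)
        + μ {x | 0 < w x} := by
        rw [lintegral_add_right _ measurable_const]; simp
    _ ≤ moserC + 1 := by
        refine add_le_add ?_ hμ
        refine (setLIntegral_le_lintegral _ _).trans ?_
        rw [hlayer]
        exact hmain

lemma energy_lt_top (u : ℂ → ℝ) (hu : ContDiff ℝ 1 u) (hc : HasCompactSupport u) :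
    ∫⁻ y, ‖fderiv ℝ u y‖ₑ ^ 2 < ⊤ := by
  have h1 : Continuous (fun y => ‖fderiv ℝ u y‖ ^ 2) :=
    ((hu.continuous_fderiv one_ne_zero).norm).pow 2
  have h2 : HasCompactSupport (fun y => ‖fderiv ℝ u y‖ ^ 2) :=
    (hc.fderiv (𝕜 := ℝ)).comp_left (g := fun L => ‖L‖ ^ 2) (by simp)
  have := (h1.integrable_of_hasCompactSupport (μ := volume) h2).2
  simpa [HasFiniteIntegral, enorm_pow] using this

lemma moser (u : ℂ → ℝ) (hu : ContDiff ℝ 1 u) (hc : HasCompactSupport u) (A θ : ℝ)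
    (hA : 0 ≤ A) (hθ : 0 < θ) (hvol : volume (u ⁻¹' Set.Ioi A) ≤ 1)
    (hE : ∫⁻ y in u ⁻¹' Set.Ioi A, ‖fderiv ℝ u y‖ₑ ^ 2 ≤ ENNReal.ofReal θ) :
    ∫⁻ y in u ⁻¹' Set.Ioi A, ENNReal.ofReal (Real.exp (4 * π * ((u y - A) ^ 2 / θ))) ≤ moserC + 1 := by
  have hpi := Real.pi_pos
  have hcu := hu.continuous
  set k := √(4 * π / θ) with hk
  have hk2 : k ^ 2 = 4 * π / θ := Real.sq_sqrt (by positivity)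
  have hkpos : 0 < k := Real.sqrt_pos.mpr (by positivity)
  have hset : ∀ l : ℝ, {y | l < k * (u y - A)} = u ⁻¹' Set.Ioi (A + l / k) := by
    intro l
    ext y
    simp only [Set.mem_setOf_eq, Set.mem_preimage, Set.mem_Ioi]
    rw [← sub_pos, ← sub_pos (b := A + l / k), ← mul_pos_iff_of_pos_left hkpos (b := u y - (A + l / k))]
    have : k * (u y - (A + l / k)) = k * (u y - A) - l := by field_simp; ring
    rw [this]
  set En : ℝ → ENNReal := fun a => ∫⁻ y in u ⁻¹' Set.Ioi a, ‖fderiv ℝ u y‖ₑ ^ 2 with hEn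
  have hEnfin : ∀ a, En a ≠ ⊤ := fun a =>
    ((setLIntegral_le_lintegral _ _).trans_lt (energy_lt_top u hu hc)).ne
  have hvolfin : ∀ a, A ≤ a → volume (u ⁻¹' Set.Ioi a) ≠ ⊤ := fun a ha =>
    ((measure_mono (Set.preimage_mono (Set.Ioi_subset_Ioi ha))).trans_lt
      (hvol.trans_lt ENNReal.one_lt_top)).ne
  have := core volume (fun y => k * (u y - A)) (by fun_prop) (by
      rw [hset 0]; simpa using hvol) (fun l => (En (A + l / k)).toReal / θ)
      (fun a _ => by positivity) (by
        simp only [zero_div, add_zero]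
        rw [div_le_one hθ]
        exact ENNReal.toReal_le_of_le_ofReal hθ.le hE) (by
        intro a b ha hab hb
        rw [hset a, hset b] at *
        set a' := A + a / k with ha'
        set b' := A + b / k with hb'
        have haa : A ≤ a' := by have : 0 ≤ a / k := by positivity
                                linarith
        have hab' : a' < b' := by
          have : a / k < b / k := by gcongr
          linarith
        have hcap := capacity u hu hc a' b' (volume (u ⁻¹' Set.Ioi b')).toReal
          (volume (u ⁻¹' Set.Ioi a')).toReal (hA.trans haa) hab' hb ENNReal.toReal_nonneg
          (ENNReal.ofReal_toReal (hvolfin b' (haa.trans hab'.le))).symm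
          (ENNReal.ofReal_toReal (hvolfin a' haa)).ge
        have hlog0 : 0 ≤ Real.log (1 + (volume (u ⁻¹' Set.Ioi a')).toReal /
            (volume (u ⁻¹' Set.Ioi b')).toReal) := by
          apply Real.log_nonneg
          have : 0 ≤ (volume (u ⁻¹' Set.Ioi a')).toReal / (volume (u ⁻¹' Set.Ioi b')).toReal := by
            positivity
          linarith
        set L := Real.log (1 + (volume (u ⁻¹' Set.Ioi a')).toReal /
            (volume (u ⁻¹' Set.Ioi b')).toReal) + 9
        have hsplit : En a' = (∫⁻ y in u ⁻¹' (Set.Ioc a' b'), ‖fderiv ℝ u y‖ₑ ^ 2) + En b' := by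
          simp only [hEn]
          rw [← lintegral_union (hcu.measurable measurableSet_Ioi), ← Set.preimage_union,
            Set.Ioc_union_Ioi_eq_Ioi hab'.le]
          rw [Set.disjoint_left]
          intro y hy hy'
          exact absurd hy.2 (not_le.mpr hy')
        set M := ∫⁻ y in u ⁻¹' (Set.Ioc a' b'), ‖fderiv ℝ u y‖ₑ ^ 2
        have hMfin : M ≠ ⊤ := fun h => hEnfin a' (by rw [hsplit, h]; simp)
        have hsplit' : (En a').toReal = M.toReal + (En b').toReal := by
          rw [hsplit, ENNReal.toReal_add hMfin (hEnfin b')]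
        have h4 : 4 * π * (b' - a') ^ 2 ≤ M.toReal * L := by
          rw [← ENNReal.ofReal_toReal hMfin, ← ENNReal.ofReal_mul ENNReal.toReal_nonneg] at hcap
          exact (ENNReal.ofReal_le_ofReal_iff (by positivity)).mp hcap
        have h5 : (b - a) ^ 2 = 4 * π * (b' - a') ^ 2 / θ := by
          have : b - a = k * (b' - a') := by rw [ha', hb']; field_simp; ring
          rw [this, mul_pow, hk2]; ring
        rw [h5]
        rw [hsplit', div_sub_div_same, add_sub_cancel_right, div_mul_eq_mul_div]
        gcongr)
  rw [hset 0] at this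
  simp only [zero_div, add_zero] at this
  convert this using 5
  rw [mul_pow, hk2]; ring

lemma mt_half (u : ℂ → ℝ) (hu : ContDiff ℝ 1 u) (hc : HasCompactSupport u) (P : ℝ) (hP : 0 < P)
    (hpo : ∀ v : ℂ → ℝ, ContDiff ℝ 1 v → (∀ y, u y = 0 → v y = 0) →
      ∫⁻ y, ‖v y‖ₑ ^ 2 ≤ ENNReal.ofReal P * ∫⁻ y, ‖fderiv ℝ v y‖ₑ ^ 2)
    (hE : ∫⁻ y, ‖fderiv ℝ u y‖ₑ ^ 2 ≤ 1) :
    ∫⁻ y in u ⁻¹' Set.Ioi 0, ENNReal.ofReal (Real.exp (4 * π * u y ^ 2) - 1) ≤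
      ENNReal.ofReal (4 * π * Real.exp (4 * π * P) * P) +
        ENNReal.ofReal (Real.exp (8 * π * P)) * (moserC + 1) := by
  have hpi := Real.pi_pos
  have hcu := hu.continuous
  set Λ : Set ℝ := {l | 0 ≤ l ∧ volume (u ⁻¹' Set.Ioi l) ≤ 1} with hΛ
  have hne : Λ.Nonempty := by
    obtain ⟨C, hC⟩ := hc.exists_bound_of_continuous hcu
    refine ⟨C, (norm_nonneg _).trans (hC 0), ?_⟩
    have : u ⁻¹' Set.Ioi C = ∅ := by
      ext y
      simp only [Set.mem_preimage, Set.mem_Ioi, Set.mem_empty_iff_false, iff_false, not_lt]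
      exact (le_abs_self _).trans (hC y)
    simp [this]
  have hbdd : BddBelow Λ := ⟨0, fun l hl => hl.1⟩
  set A := sInf Λ with hA
  have hA0 : 0 ≤ A := le_csInf hne (fun l hl => hl.1)
  have hvol : volume (u ⁻¹' Set.Ioi A) ≤ 1 := by
    have hU : u ⁻¹' Set.Ioi A = ⋃ n : ℕ, u ⁻¹' Set.Ioi (A + 1 / ((n:ℝ) + 1)) := by
      rw [← Set.preimage_iUnion]
      congr 1
      ext t
      simp only [Set.mem_Ioi, Set.mem_iUnion]
      constructor
      · intro ht
        obtain ⟨n, hn⟩ := exists_nat_one_div_lt (sub_pos.mpr ht)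
        exact ⟨n, by linarith⟩
      · rintro ⟨n, hn⟩
        have : 0 < 1 / ((n:ℝ) + 1) := by positivity
        linarith
    rw [hU, Monotone.measure_iUnion]
    · apply iSup_le
      intro n
      have hpos : 0 < 1 / ((n:ℝ) + 1) := by positivity
      obtain ⟨l, hl, hlt⟩ := exists_lt_of_csInf_lt hne (show sInf Λ < A + 1 / ((n:ℝ) + 1) by linarith)
      exact (measure_mono (Set.preimage_mono (Set.Ioi_subset_Ioi hlt.le))).trans hl.2
    · intro m n hmn
      apply Set.preimage_mono
      apply Set.Ioi_subset_Ioi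
      have : 1 / ((n:ℝ) + 1) ≤ 1 / ((m:ℝ) + 1) := by
        apply one_div_le_one_div_of_le (by positivity)
        have : (m:ℝ) ≤ n := by exact_mod_cast hmn
        linarith
      linarith
  set E1 := ∫⁻ y in u ⁻¹' Set.Ioc 0 A, ‖fderiv ℝ u y‖ₑ ^ 2 with hE1
  set E2 := ∫⁻ y in u ⁻¹' Set.Ioi A, ‖fderiv ℝ u y‖ₑ ^ 2 with hE2
  have hEE : E1 + E2 ≤ 1 := by
    rw [hE1, hE2, ← lintegral_union (hcu.measurable measurableSet_Ioi)]
    · exact (setLIntegral_le_lintegral _ _).trans hE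
    · rw [Set.disjoint_left]
      intro y hy hy'
      exact absurd hy.2 (not_le.mpr hy')
  have hlowE : ENNReal.ofReal (1 * A ^ 2) ≤ ENNReal.ofReal P * E1 := by
    rcases hA0.eq_or_lt with h0 | hApos
    · rw [← h0]; simp
    apply limit_aux 1 A hApos
    intro ε' hε' hε'2
    set ε := 2 * ε' / 3 with hε
    have hεpos : 0 < ε := by positivity
    obtain ⟨v, hv, hvc, hv0, hvb, hvd⟩ := trunc_exists u hu hc 0 (A - ε) ε le_rfl hεpos (by linarith)
    have hnot : ¬ volume (u ⁻¹' Set.Ioi (A - ε)) ≤ 1 := by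
      intro h
      have : A ≤ A - ε := csInf_le hbdd ⟨by linarith, h⟩
      linarith
    push Not at hnot
    have hmS : MeasurableSet (u ⁻¹' Set.Ioi (A - ε)) := hcu.measurable measurableSet_Ioi
    calc ENNReal.ofReal (1 * (A - 2 * ε') ^ 2)
        ≤ ENNReal.ofReal (1 * (A - 2 * ε') ^ 2) * volume (u ⁻¹' Set.Ioi (A - ε)) :=
          le_mul_of_one_le_right (by positivity) hnot.le
      _ = ∫⁻ y in u ⁻¹' Set.Ioi (A - ε), ENNReal.ofReal (1 * (A - 2 * ε') ^ 2) :=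
          (setLIntegral_const _ _).symm
      _ ≤ ∫⁻ y in u ⁻¹' Set.Ioi (A - ε), ‖v y‖ₑ ^ 2 := by
        apply setLIntegral_mono' hmS
        intro y hy
        have h1 := hvb y (le_of_lt hy)
        rw [← ofReal_norm, ← ENNReal.ofReal_pow (norm_nonneg _), Real.norm_eq_abs, sq_abs]
        apply ENNReal.ofReal_le_ofReal
        have h2 : 0 ≤ A - 2 * ε' := by linarith
        have h3 : A - 2 * ε' ≤ v y := by linarith
        rw [one_mul]
        gcongr
      _ ≤ ∫⁻ y, ‖v y‖ₑ ^ 2 := setLIntegral_le_lintegral _ _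
      _ ≤ ENNReal.ofReal P * ∫⁻ y, ‖fderiv ℝ v y‖ₑ ^ 2 := hpo v hv (fun y hy => hv0 y hy.le)
      _ ≤ ENNReal.ofReal P * E1 := by
        refine mul_le_mul_right ?_ _
        rw [hE1, ← lintegral_indicator (hcu.measurable measurableSet_Ioc)]
        apply lintegral_mono
        intro y
        refine (pow_le_pow_left₀ (by positivity) (hvd y) 2).trans ?_
        by_cases h : y ∈ u ⁻¹' Set.Ioc 0 (A - ε)
        · have h' : y ∈ u ⁻¹' Set.Ioc 0 A := ⟨h.1, by have := h.2; linarith⟩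
          rw [Set.indicator_of_mem h, Set.indicator_of_mem h']
        · rw [Set.indicator_of_notMem h]; simp
  have hE1fin : E1 ≠ ⊤ := ((le_self_add.trans hEE).trans_lt ENNReal.one_lt_top).ne
  have hE2fin : E2 ≠ ⊤ := ((le_add_self.trans hEE).trans_lt ENNReal.one_lt_top).ne
  have hEEr : E1.toReal + E2.toReal ≤ 1 := by
    rw [← ENNReal.toReal_add hE1fin hE2fin]
    simpa using ENNReal.toReal_mono ENNReal.one_ne_top hEE
  have hlowr : A ^ 2 ≤ P * E1.toReal := by
    rw [one_mul, ← ENNReal.ofReal_toReal hE1fin, ← ENNReal.ofReal_mul hP.le] at hlowE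
    exact (ENNReal.ofReal_le_ofReal_iff (by positivity)).mp hlowE
  have hAP : A ^ 2 ≤ P := by
    have : E1.toReal ≤ 1 := by linarith [ENNReal.toReal_nonneg (a := E2)]
    nlinarith
  set θ := 1 - A ^ 2 / (2 * P) with hθ
  have hq : A ^ 2 / (2 * P) ≤ 1 / 2 := by
    rw [div_le_iff₀ (by positivity)]; linarith
  have hθpos : 0 < θ := by linarith
  have hE2θ : E2 ≤ ENNReal.ofReal θ := by
    rw [← ENNReal.ofReal_toReal hE2fin]
    apply ENNReal.ofReal_le_ofReal
    have h1 : A ^ 2 / (2 * P) ≤ E1.toReal := by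
      rw [div_le_iff₀ (by positivity)]
      nlinarith [ENNReal.toReal_nonneg (a := E1)]
    linarith
  have hmoser := moser u hu hc A θ hA0 hθpos hvol hE2θ
  have hAθ : A ^ 2 = 2 * P * (1 - θ) := by
    rw [hθ]; field_simp; ring
  have hpw : ∀ x : ℝ, (x + A) ^ 2 ≤ x ^ 2 / θ + 2 * P := by
    intro x
    have h1 : 0 ≤ (x ^ 2 / θ + 2 * P - (x + A) ^ 2) * (2 * P * θ) := by
      have : (x ^ 2 / θ + 2 * P - (x + A) ^ 2) * (2 * P * θ) = (A * x - 2 * P * θ) ^ 2 := by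
        have h2 : x ^ 2 / θ * θ = x ^ 2 := by field_simp
        calc _ = 2 * P * (x ^ 2 / θ * θ) + 4 * P ^ 2 * θ - 2 * P * θ * (x ^ 2 + 2 * x * A + A ^ 2) := by ring
          _ = 2 * P * x ^ 2 + 4 * P ^ 2 * θ - 2 * P * θ * (x ^ 2 + 2 * x * A + A ^ 2) := by rw [h2]
          _ = _ := by linear_combination (-(2 * P * θ) - x ^ 2) * hAθ
      rw [this]; positivity
    have := nonneg_of_mul_nonneg_left h1 (by positivity)
    linarith
  have hhigh : ∫⁻ y in u ⁻¹' Set.Ioi A, ENNReal.ofReal (Real.exp (4 * π * u y ^ 2) - 1) ≤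
      ENNReal.ofReal (Real.exp (8 * π * P)) * (moserC + 1) := by
    refine le_trans ?_ (mul_le_mul_right hmoser _)
    rw [← lintegral_const_mul' _ _ ENNReal.ofReal_ne_top]
    apply lintegral_mono
    intro y
    dsimp only
    rw [← ENNReal.ofReal_mul (by positivity), ← Real.exp_add]
    apply ENNReal.ofReal_le_ofReal
    have h1 := hpw (u y - A)
    rw [sub_add_cancel] at h1
    have : Real.exp (4 * π * u y ^ 2) ≤ Real.exp (8 * π * P + 4 * π * ((u y - A) ^ 2 / θ)) := by
      apply Real.exp_le_exp.mpr
      have := mul_le_mul_of_nonneg_left h1 (show 0 ≤ 4 * π by positivity)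
      linarith
    linarith
  have hlow : ∫⁻ y in u ⁻¹' Set.Ioc 0 A, ENNReal.ofReal (Real.exp (4 * π * u y ^ 2) - 1) ≤
      ENNReal.ofReal (4 * π * Real.exp (4 * π * P) * P) := by
    calc _ ≤ ∫⁻ y in u ⁻¹' Set.Ioc 0 A, ENNReal.ofReal (4 * π * Real.exp (4 * π * P)) * ‖u y‖ₑ ^ 2 := by
          apply setLIntegral_mono' (hcu.measurable measurableSet_Ioc)
          intro y hy
          rw [← ofReal_norm, ← ENNReal.ofReal_pow (norm_nonneg _), Real.norm_eq_abs, sq_abs,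
            ← ENNReal.ofReal_mul (by positivity)]
          apply ENNReal.ofReal_le_ofReal
          set X := 4 * π * u y ^ 2 with hX
          have hX0 : 0 ≤ X := by positivity
          have hu2 : u y ^ 2 ≤ P := by
            have h1 : 0 < u y := hy.1
            have h2 : u y ≤ A := hy.2
            nlinarith
          have hXP : X ≤ 4 * π * P := by rw [hX]; gcongr
          have h1 : Real.exp X - 1 ≤ X * Real.exp X := by
            have h2 := Real.add_one_le_exp (-X)
            have h3 : Real.exp (-X) * Real.exp X = 1 := by rw [← Real.exp_add]; simp
            have h4 := Real.exp_pos X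
            nlinarith
          calc Real.exp X - 1 ≤ X * Real.exp X := h1
            _ ≤ X * Real.exp (4 * π * P) := by gcongr
            _ = _ := by rw [hX]; ring
      _ ≤ ENNReal.ofReal (4 * π * Real.exp (4 * π * P)) * ∫⁻ y, ‖u y‖ₑ ^ 2 := by
        rw [lintegral_const_mul' _ _ ENNReal.ofReal_ne_top]
        exact mul_le_mul_right (setLIntegral_le_lintegral _ _) _
      _ ≤ ENNReal.ofReal (4 * π * Real.exp (4 * π * P)) * (ENNReal.ofReal P * 1) := by
        refine mul_le_mul_right ?_ _
        exact (hpo u hu (fun y h => h)).trans (mul_le_mul_right hE _)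
      _ = _ := by
        rw [mul_one, ← ENNReal.ofReal_mul (by positivity)]
  have hsp : u ⁻¹' Set.Ioi 0 = u ⁻¹' Set.Ioc 0 A ∪ u ⁻¹' Set.Ioi A := by
    rw [← Set.preimage_union, Set.Ioc_union_Ioi_eq_Ioi hA0]
  rw [hsp]
  exact (lintegral_union_le _ _ _).trans (add_le_add hlow hhigh)

lemma mt_full (u : ℂ → ℝ) (hu : ContDiff ℝ 1 u) (hc : HasCompactSupport u) (P : ℝ) (hP : 0 < P)
    (hpo : ∀ v : ℂ → ℝ, ContDiff ℝ 1 v → (∀ y, u y = 0 → v y = 0) →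
      ∫⁻ y, ‖v y‖ₑ ^ 2 ≤ ENNReal.ofReal P * ∫⁻ y, ‖fderiv ℝ v y‖ₑ ^ 2)
    (hE : ∫⁻ y, ‖fderiv ℝ u y‖ₑ ^ 2 ≤ 1) :
    ∫⁻ y, ENNReal.ofReal (Real.exp (4 * π * u y ^ 2) - 1) ≤
      2 * (ENNReal.ofReal (4 * π * Real.exp (4 * π * P) * P) +
        ENNReal.ofReal (Real.exp (8 * π * P)) * (moserC + 1)) := by
  have hcu := hu.continuous
  have h1 := mt_half u hu hc P hP hpo hE
  have h2 := mt_half (-u) hu.neg hc.neg P hP (fun v hv h => hpo v hv (fun y hy => h y (by simp [hy])))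
    (by
      refine le_trans (le_of_eq ?_) hE
      apply lintegral_congr
      intro y
      rw [fderiv_neg, enorm_neg])
  simp only [Pi.neg_apply, even_two, Even.neg_pow] at h2
  rw [two_mul]
  refine le_trans ?_ (add_le_add h1 h2)
  refine le_trans (le_of_eq ?_) (lintegral_union_le _ _ _)
  rw [← lintegral_indicator]
  · apply lintegral_congr
    intro y
    by_cases h : y ∈ u ⁻¹' Set.Ioi 0 ∪ (-u) ⁻¹' Set.Ioi 0
    · rw [Set.indicator_of_mem h]
    · rw [Set.indicator_of_notMem h]
      have : u y = 0 := by
        simp only [Set.mem_union, Set.mem_preimage, Set.mem_Ioi, Pi.neg_apply, not_or, not_lt] at h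
        linarith [h.1, h.2]
      simp [this]
  · exact (hcu.measurable measurableSet_Ioi).union (hcu.neg.measurable measurableSet_Ioi)

lemma test_zero {Ω : Set (EuclideanSpace ℝ (Fin 2))} {u : EuclideanSpace ℝ (Fin 2) → ℝ}
    (hu : IsTest Ω u) {x : EuclideanSpace ℝ (Fin 2)} (hx : x ∉ Ω) : u x = 0 :=
  image_eq_zero_of_notMem_tsupport fun h => hx (hu.2.2 h)

lemma test_fderiv_zero {Ω : Set (EuclideanSpace ℝ (Fin 2))} {u : EuclideanSpace ℝ (Fin 2) → ℝ}
    (hu : IsTest Ω u) {x : EuclideanSpace ℝ (Fin 2)} (hx : x ∉ Ω) : fderiv ℝ u x = 0 := by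
  have h : x ∉ tsupport (fderiv ℝ u) := fun h => hx (hu.2.2 (tsupport_fderiv_subset ℝ h))
  exact image_eq_zero_of_notMem_tsupport h

lemma test_grad_eq {Ω : Set (EuclideanSpace ℝ (Fin 2))} {u : EuclideanSpace ℝ (Fin 2) → ℝ}
    (hu : IsTest Ω u) : ∫ x in Ω, ‖fderiv ℝ u x‖ ^ 2 = ∫ x, ‖fderiv ℝ u x‖ ^ 2 :=
  setIntegral_eq_integral_of_forall_compl_eq_zero fun x hx => by
    rw [test_fderiv_zero hu hx]; simp

lemma test_sq_eq {Ω : Set (EuclideanSpace ℝ (Fin 2))} {u : EuclideanSpace ℝ (Fin 2) → ℝ}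
    (hu : IsTest Ω u) : ∫ x in Ω, u x ^ 2 = ∫ x, u x ^ 2 :=
  setIntegral_eq_integral_of_forall_compl_eq_zero fun x hx => by
    rw [test_zero hu hx]; simp

lemma test_exp_eq {Ω : Set (EuclideanSpace ℝ (Fin 2))} {u : EuclideanSpace ℝ (Fin 2) → ℝ}
    (hu : IsTest Ω u) :
    ∫ x in Ω, (exp (4 * π * u x ^ 2) - 1) = ∫ x, (exp (4 * π * u x ^ 2) - 1) :=
  setIntegral_eq_integral_of_forall_compl_eq_zero fun x hx => by
    rw [test_zero hu hx]; simp

lemma test_grad_int {Ω : Set (EuclideanSpace ℝ (Fin 2))} {u : EuclideanSpace ℝ (Fin 2) → ℝ}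
    (hu : IsTest Ω u) : Integrable fun x => ‖fderiv ℝ u x‖ ^ 2 := by
  apply Continuous.integrable_of_hasCompactSupport
  · exact (hu.1.continuous_fderiv (by simp)).norm.pow 2
  · exact (hu.2.1.fderiv ℝ).comp_left (g := fun L => ‖L‖ ^ 2) (by simp)

lemma test_sq_int {Ω : Set (EuclideanSpace ℝ (Fin 2))} {u : EuclideanSpace ℝ (Fin 2) → ℝ}
    (hu : IsTest Ω u) : Integrable fun x => u x ^ 2 := by
  apply Continuous.integrable_of_hasCompactSupport
  · exact hu.1.continuous.pow 2
  · exact hu.2.1.comp_left (g := fun t => t ^ 2) (by simp)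

lemma test_exp_int {Ω : Set (EuclideanSpace ℝ (Fin 2))} {u : EuclideanSpace ℝ (Fin 2) → ℝ}
    (hu : IsTest Ω u) : Integrable fun x => exp (4 * π * u x ^ 2) - 1 := by
  apply Continuous.integrable_of_hasCompactSupport
  · have := hu.1.continuous
    fun_prop
  · exact hu.2.1.comp_left (g := fun t => exp (4 * π * t ^ 2) - 1) (by simp)

lemma test_smul {Ω : Set (EuclideanSpace ℝ (Fin 2))} {u : EuclideanSpace ℝ (Fin 2) → ℝ}
    (hu : IsTest Ω u) (t : ℝ) : IsTest Ω (fun x => t * u x) := by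
  refine ⟨contDiff_const.mul hu.1, hu.2.1.mul_left, ?_⟩
  exact (tsupport_mul_subset_right (f := fun _ => t) (g := u)).trans hu.2.2

lemma mt_to_poincare (Ω : Set (EuclideanSpace ℝ (Fin 2))) (h : MoserTrudinger Ω) :
    Poincare Ω := by
  obtain ⟨C₀, hC₀⟩ := h
  set C := max C₀ 1 with hC
  have hCpos : 0 < C := lt_of_lt_of_le one_pos (le_max_right _ _)
  refine ⟨4 * π / C, by positivity, fun u hu => ?_⟩
  rw [test_sq_eq hu, test_grad_eq hu]
  set D := ∫ x, ‖fderiv ℝ u x‖ ^ 2 with hD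
  set S := ∫ x, u x ^ 2 with hS
  have hD0 : 0 ≤ D := integral_nonneg fun x => by positivity
  have hS0 : 0 ≤ S := integral_nonneg fun x => by positivity
  have key : ∀ t : ℝ, t ^ 2 * D ≤ 1 → 4 * π * t ^ 2 * S ≤ C := by
    intro t ht
    have hv := test_smul hu t
    have hg : ∀ x, ‖fderiv ℝ (fun x => t * u x) x‖ ^ 2 = t ^ 2 * ‖fderiv ℝ u x‖ ^ 2 := by
      intro x
      rw [fderiv_const_mul ((hu.1.differentiable (by simp)) x), norm_smul, mul_pow]
      simp
    have h1 : ∫ x in Ω, (exp (4 * π * (t * u x) ^ 2) - 1) ≤ C₀ := by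
      apply hC₀
      refine ⟨fun x => t * u x, hv, ?_, rfl⟩
      rw [test_grad_eq hv]
      simp only [hg]
      rw [integral_const_mul]; exact ht
    rw [test_exp_eq hv] at h1
    have h2 : ∫ x, 4 * π * t ^ 2 * u x ^ 2 ≤ ∫ x, (exp (4 * π * (t * u x) ^ 2) - 1) := by
      apply integral_mono ((test_sq_int hu).const_mul _) (test_exp_int hv)
      intro x
      have := Real.add_one_le_exp (4 * π * (t * u x) ^ 2)
      dsimp only
      nlinarith
    rw [integral_const_mul] at h2
    exact h2.trans (h1.trans (le_max_left _ _))
  rw [div_mul_eq_mul_div, div_le_iff₀ hCpos]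
  rcases hD0.eq_or_lt with h0 | h0
  · rw [← h0, zero_mul]
    by_contra hcon
    push Not at hcon
    have hSpos : 0 < 4 * π * S := hcon
    have := key (√((C + 1) / (4 * π * S))) (by rw [← h0]; simp)
    rw [sq_sqrt (by positivity)] at this
    have h3 : 4 * π * ((C + 1) / (4 * π * S)) * S = C + 1 := by
      have : S ≠ 0 := by rintro h; rw [h] at hSpos; simp at hSpos
      field_simp
    linarith
  · have := key (√(1 / D)) (by rw [sq_sqrt (by positivity)]; field_simp; rfl)
    rw [sq_sqrt (by positivity)] at this
    have h3 : 4 * π * (1 / D) * S = 4 * π * S / D := by ring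
    rw [h3, div_le_iff₀ h0] at this
    linarith

lemma poincare_to_fi (Ω : Set (EuclideanSpace ℝ (Fin 2))) (h : Poincare Ω) :
    FiniteInradius Ω := by
  obtain ⟨lam, hlam, hP⟩ := h
  let f : ContDiffBump (0 : EuclideanSpace ℝ (Fin 2)) := ⟨1 / 4, 1 / 2, by norm_num, by norm_num⟩
  set A := ∫ x, f x ^ 2 with hA
  set B := ∫ x, ‖fderiv ℝ f x‖ ^ 2 with hB
  have hApos : 0 < A := by
    apply Continuous.integral_pos_of_hasCompactSupport_nonneg_nonzero (x := 0)
    · exact f.continuous.pow 2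
    · exact f.hasCompactSupport.comp_left (g := fun t => t ^ 2) (by simp)
    · intro x; positivity
    · have : f 0 = 1 := f.one_of_mem_closedBall (by simp; norm_num [f])
      simp [this]
  refine ⟨√(B / (lam * A)), ?_⟩
  rintro R ⟨hR, x, hx, hball⟩
  apply Real.le_sqrt_of_sq_le
  rw [le_div_iff₀ (by positivity)]
  set u : EuclideanSpace ℝ (Fin 2) → ℝ := fun y => f (R⁻¹ • (y - x)) with hu
  have hsupp : tsupport u ⊆ Metric.closedBall x (R / 2) := by
    apply closure_minimal _ Metric.isClosed_closedBall
    intro y hy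
    have h1 : R⁻¹ • (y - x) ∈ Function.support f := hy
    rw [f.support_eq] at h1
    rw [mem_ball_zero_iff, norm_smul, norm_inv, Real.norm_of_nonneg hR.le] at h1
    have h2 : f.rOut = 1 / 2 := rfl
    rw [h2, inv_mul_lt_iff₀ hR] at h1
    rw [mem_closedBall_iff_norm]
    linarith
  have hut : IsTest Ω u := by
    refine ⟨?_, ?_, ?_⟩
    · have hsm : ContDiff ℝ (⊤ : ℕ∞) (fun y : EuclideanSpace ℝ (Fin 2) => R⁻¹ • (y - x)) := by
        fun_prop
      exact f.contDiff.comp hsm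
    · exact (isCompact_closedBall x (R / 2)).of_isClosed_subset (isClosed_tsupport u) hsupp
    · exact hsupp.trans ((Metric.closedBall_subset_ball (by linarith)).trans hball)
  have h1 := hP u hut
  rw [test_sq_eq hut, test_grad_eq hut] at h1
  have hscale : ∀ g : EuclideanSpace ℝ (Fin 2) → ℝ,
      ∫ y, g (R⁻¹ • (y - x)) = R ^ 2 * ∫ y, g y := by
    intro g
    rw [integral_sub_right_eq_self (fun y => g (R⁻¹ • y)) x]
    rw [Measure.integral_comp_inv_smul]
    simp
  have e1 : ∫ y, u y ^ 2 = R ^ 2 * A := hscale fun y => f y ^ 2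
  have hfd : ∀ y, ‖fderiv ℝ u y‖ ^ 2 = (R ^ 2)⁻¹ * ‖fderiv ℝ f (R⁻¹ • (y - x))‖ ^ 2 := by
    intro y
    have ha : HasFDerivAt f (fderiv ℝ f (R⁻¹ • (y - x))) (R⁻¹ • (y - x)) :=
      ((f.contDiff (n := 1)).differentiable (by simp) _).hasFDerivAt
    have hb : HasFDerivAt (fun y : EuclideanSpace ℝ (Fin 2) => R⁻¹ • (y - x))
        (R⁻¹ • ContinuousLinearMap.id ℝ _) y :=
      ((hasFDerivAt_id y).sub_const x).const_smul R⁻¹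
    have hc := (ha.comp y hb).fderiv
    have hc' : fderiv ℝ u y = R⁻¹ • fderiv ℝ f (R⁻¹ • (y - x)) := by
      refine Eq.trans hc ?_
      ext v; simp
    rw [hc', norm_smul, mul_pow, norm_inv, Real.norm_of_nonneg hR.le, inv_pow]
  have e2 : ∫ y, ‖fderiv ℝ u y‖ ^ 2 = B := by
    simp only [hfd]
    rw [integral_const_mul, hscale fun y => ‖fderiv ℝ f y‖ ^ 2, ← mul_assoc,
      inv_mul_cancel₀ (by positivity), one_mul]
  rw [e1, e2] at h1
  linarith

lemma fi_to_mt (Ω : Set (EuclideanSpace ℝ (Fin 2))) (hΩ : IsOpen Ω)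
    (hsc : SimplyConnectedSpace Ω) (h : FiniteInradius Ω) : MoserTrudinger Ω := by
  obtain ⟨M, hM⟩ := h
  set R := |M| + 1 with hRdef
  have hR : 0 < R := by positivity
  let φ : ℂ ≃ₗᵢ[ℝ] EuclideanSpace ℝ (Fin 2) := Complex.orthonormalBasisOneI.repr
  have hφm : MeasurePreserving φ volume volume := φ.measurePreserving
  have hφe : MeasurableEmbedding φ := φ.toHomeomorph.measurableEmbedding
  let Z : Set ℂ := {z | φ z ∉ Ω}
  have hZ : ∀ x : ℂ, ∃ z ∈ Z, dist z x < R := by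
    intro x
    by_cases hx : φ x ∈ Ω
    · have hb : ¬ Metric.ball (φ x) R ⊆ Ω := by
        intro hb
        have h1 : R ≤ M := hM ⟨hR, φ x, hx, hb⟩
        have := le_abs_self M
        linarith
      rw [Set.not_subset] at hb
      obtain ⟨w, hw, hwΩ⟩ := hb
      refine ⟨φ.symm w, ?_, ?_⟩
      · change φ (φ.symm w) ∉ Ω
        simpa using hwΩ
      · rw [← φ.dist_map]
        simpa using hw
    · exact ⟨x, hx, by simpa using hR⟩
  set P := 144 * π ^ 2 * R ^ 2 with hPdef
  have hP : 0 < P := by positivity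
  set K : ENNReal := 2 * (ENNReal.ofReal (4 * π * exp (4 * π * P) * P) +
    ENNReal.ofReal (exp (8 * π * P)) * (moserC + 1)) with hK
  have hKtop : K ≠ ⊤ := by
    have := moserC_ne_top
    rw [hK]
    refine ENNReal.mul_ne_top (by simp) (ENNReal.add_ne_top.2 ⟨by simp, ?_⟩)
    exact ENNReal.mul_ne_top (by simp) (ENNReal.add_ne_top.2 ⟨this, by simp⟩)
  refine ⟨K.toReal, ?_⟩
  rintro r ⟨u, hu, hE, rfl⟩
  rw [test_grad_eq hu] at hE
  rw [test_exp_eq hu]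
  set v : ℂ → ℝ := fun z => u (φ z) with hv
  have hvc : ContDiff ℝ 1 v := (hu.1.of_le (by simp)).comp φ.contDiff
  have hvs : HasCompactSupport v := hu.2.1.comp_homeomorph φ.toHomeomorph
  have hfd : ∀ y, ‖fderiv ℝ v y‖ ≤ ‖fderiv ℝ u (φ y)‖ := by
    intro y
    have ha : HasFDerivAt u (fderiv ℝ u (φ y)) (φ y) :=
      (hu.1.differentiable (by simp) _).hasFDerivAt
    have hb : HasFDerivAt φ (φ.toContinuousLinearEquiv : ℂ →L[ℝ] _) y :=
      φ.toContinuousLinearEquiv.hasFDerivAt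
    have hc : fderiv ℝ v y = (fderiv ℝ u (φ y)).comp (φ.toContinuousLinearEquiv : ℂ →L[ℝ] _) :=
      (ha.comp y hb).fderiv
    rw [hc]
    refine ContinuousLinearMap.opNorm_le_bound _ (norm_nonneg _) fun w => ?_
    have := (fderiv ℝ u (φ y)).le_opNorm (φ w)
    rw [φ.norm_map] at this
    exact this
  have hEv : ∫⁻ y, ‖fderiv ℝ v y‖ₑ ^ 2 ≤ 1 := by
    calc ∫⁻ y, ‖fderiv ℝ v y‖ₑ ^ 2 ≤ ∫⁻ y, ENNReal.ofReal (‖fderiv ℝ u (φ y)‖ ^ 2) := by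
          apply lintegral_mono
          intro y
          dsimp only
          rw [← ofReal_norm, ← ENNReal.ofReal_pow (norm_nonneg _)]
          apply ENNReal.ofReal_le_ofReal
          gcongr
          exact hfd y
      _ = ∫⁻ x, ENNReal.ofReal (‖fderiv ℝ u x‖ ^ 2) :=
          hφm.lintegral_comp_emb hφe (fun x => ENNReal.ofReal (‖fderiv ℝ u x‖ ^ 2))
      _ = ENNReal.ofReal (∫ x, ‖fderiv ℝ u x‖ ^ 2) :=
          (ofReal_integral_eq_lintegral_ofReal (test_grad_int hu)
            (Filter.Eventually.of_forall fun x => by positivity)).symm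
      _ ≤ 1 := by
          rw [← ENNReal.ofReal_one]
          exact ENNReal.ofReal_le_ofReal hE
  have hmain := mt_full v hvc hvs P hP (by
    intro w hw hvw
    refine poincare_global w hw Z ?_ R hR hZ
    intro z hz ρ hρ
    obtain ⟨θ, hθ, h1⟩ := winding φ.toHomeomorph Ω hΩ hsc z hz ρ hρ
    exact ⟨θ, hθ, hvw _ (test_zero hu h1)⟩) hEv
  have h2 : ENNReal.ofReal (∫ x, (exp (4 * π * u x ^ 2) - 1)) ≤ K := by
    rw [ofReal_integral_eq_lintegral_ofReal (test_exp_int hu)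
      (Filter.Eventually.of_forall fun x => by
        have : 0 ≤ 4 * π * u x ^ 2 := by positivity
        have := Real.one_le_exp this
        simp only [Pi.zero_apply]; linarith),
      ← hφm.lintegral_comp_emb hφe (fun x => ENNReal.ofReal (exp (4 * π * u x ^ 2) - 1))]
    exact hmain
  exact (ENNReal.ofReal_le_iff_le_toReal hKtop).1 h2

/-- For a nonempty open, connected, simply connected set `Ω ⊂ ℝ²`, the Moser–Trudinger
inequality, the Poincaré inequality, and the finiteness of the inradius are equivalent. -/
theorem mansand_equivalences (Ω : Set (EuclideanSpace ℝ (Fin 2)))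
    (hne : Ω.Nonempty) (hΩ : IsOpen Ω) (hconn : IsConnected Ω)
    (hsc : SimplyConnectedSpace Ω) :
    (MoserTrudinger Ω ↔ Poincare Ω) ∧ (Poincare Ω ↔ FiniteInradius Ω) := by
  exact ⟨⟨mt_to_poincare Ω, fun h => fi_to_mt Ω hΩ hsc (poincare_to_fi Ω h)⟩,
    ⟨poincare_to_fi Ω, fun h => mt_to_poincare Ω (fi_to_mt Ω hΩ hsc h)⟩⟩
end

section
/- Let Ω := ℝ × (−1,1) ⊂ ℝ². Then sup { ∫_Ω (e^{4π u(x)²} − 1) dx : u ∈ C_c^∞(Ω), ∫_Ω |∇u(x)|² dx ≤ 1 } > 16/π. (The value 16/π equals 4π/λ₁(Ω), the level attained in the limit by normalized first eigenfunctions of growing rectangles (−k,k)×(−1,1); the strict excess follows since 4k(e^{(4/π)·k/(k²+1)} − 1) > 16/π for all sufficiently large k.) -/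
open MeasureTheory Real

/-- The infinite planar strip `Ω = ℝ × (-1,1) ⊂ ℝ²`. -/
def strip : Set (EuclideanSpace ℝ (Fin 2)) := {x | x 1 ∈ Set.Ioo (-1 : ℝ) 1}

abbrev E2 := EuclideanSpace ℝ (Fin 2)

lemma polar_lintegral (f : E2 → ENNReal) (hf : Measurable f) :
    ∫⁻ x, f x = ∫⁻ θ, ∫⁻ r in Set.Ioi (0:ℝ), ENNReal.ofReal r * f (r • (θ : E2))
      ∂volume ∂((volume : Measure E2).toSphere) := by
  have h1 : ∫⁻ x, f x = ∫⁻ x : ({(0 : E2)}ᶜ : Set E2), f x ∂((volume : Measure E2).comap (↑)) := by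
    rw [lintegral_subtype_comap (measurableSet_singleton _).compl, restrict_compl_singleton]
  have h2 := (Measure.measurePreserving_homeomorphUnitSphereProd (volume : Measure E2)).symm
    (homeomorphUnitSphereProd E2).toMeasurableEquiv
  have h3 := h2.lintegral_comp (f := fun x : ({(0 : E2)}ᶜ : Set E2) => f x) (by fun_prop)
  rw [h1, ← h3, lintegral_prod _ (by fun_prop)]
  congr 1
  ext θ
  have hd : Module.finrank ℝ E2 - 1 = 1 := by simp
  rw [hd, Measure.volumeIoiPow, lintegral_withDensity_eq_lintegral_mul _ (by fun_prop) (by fun_prop)]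
  simp only [Pi.mul_apply, pow_one]
  exact lintegral_subtype_comap measurableSet_Ioi (fun r : ℝ => ENNReal.ofReal r * f (r • (θ : E2)))

lemma sphere_mass : (volume : Measure E2).toSphere Set.univ = ENNReal.ofReal (2 * π) := by
  rw [Measure.toSphere_apply_univ, EuclideanSpace.volume_ball]
  have : Gamma ((Fintype.card (Fin 2) : ℝ) / 2 + 1) = 1 := by
    norm_num
  rw [this]
  simp [Real.sq_sqrt pi_pos.le]

lemma polar_radial (f : ℝ → ENNReal) (hf : Measurable f) :
    ∫⁻ x : E2, f ‖x‖ = ENNReal.ofReal (2 * π) * ∫⁻ r in Set.Ioi (0:ℝ), ENNReal.ofReal r * f r := by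
  rw [polar_lintegral _ (by fun_prop)]
  have : ∀ θ : Metric.sphere (0:E2) 1, ∫⁻ r in Set.Ioi (0:ℝ), ENNReal.ofReal r * f ‖r • (θ : E2)‖ =
     ∫⁻ r in Set.Ioi (0:ℝ), ENNReal.ofReal r * f r := by
    intro θ
    refine setLIntegral_congr_fun measurableSet_Ioi fun r hr => ?_
    have : ‖(θ : E2)‖ = 1 := by simp
    simp only [norm_smul, this, mul_one, Real.norm_of_nonneg (le_of_lt hr)]
  simp_rw [this]
  rw [lintegral_const, sphere_mass, mul_comm]

/-- near kernel -/
noncomputable def kn (r : ℝ) (z : E2) : ENNReal := (Set.Iio r).indicator (fun s => ENNReal.ofReal s⁻¹) ‖z‖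
noncomputable def kf (r : ℝ) (z : E2) : ENNReal := (Set.Ici r).indicator (fun s => ENNReal.ofReal s⁻¹) ‖z‖

lemma measurable_kn (r : ℝ) : Measurable (kn r) :=
  ((Measurable.indicator (by fun_prop) measurableSet_Iio).comp measurable_norm)
lemma measurable_kf (r : ℝ) : Measurable (kf r) :=
  ((Measurable.indicator (by fun_prop) measurableSet_Ici).comp measurable_norm)

lemma kn_add_kf (r : ℝ) (z : E2) : kn r z + kf r z = ENNReal.ofReal ‖z‖⁻¹ := by
  unfold kn kf
  by_cases h : ‖z‖ < r
  · have h' : ¬ r ≤ ‖z‖ := not_le.2 h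
    simp [Set.indicator, h]
  · simp [Set.indicator, h, not_lt.1 h]

lemma lintegral_kn (r : ℝ) : ∫⁻ z, kn r z = ENNReal.ofReal (2 * π * r) := by
  unfold kn
  rw [polar_radial _ (Measurable.indicator (by fun_prop) measurableSet_Iio)]
  have : ∫⁻ s in Set.Ioi (0:ℝ), ENNReal.ofReal s * (Set.Iio r).indicator (fun s => ENNReal.ofReal s⁻¹) s
      = ∫⁻ s in Set.Ioi (0:ℝ), (Set.Iio r).indicator (fun s => 1) s := by
    refine setLIntegral_congr_fun measurableSet_Ioi fun s hs => ?_
    have hs' : (0:ℝ) < s := hs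
    by_cases h : s < r
    · simp only [Set.mem_Iio, h, Set.indicator_of_mem]
      rw [← ENNReal.ofReal_mul hs'.le, mul_inv_cancel₀ hs'.ne']; simp
    · simp [Set.indicator, h]
  rw [this, lintegral_indicator measurableSet_Iio, Measure.restrict_restrict measurableSet_Iio]
  simp only [lintegral_one, Measure.restrict_apply MeasurableSet.univ, Set.univ_inter]
  rw [Set.Iio_inter_Ioi, Real.volume_Ioo, ENNReal.ofReal_mul (p := 2 * π) (by positivity), sub_zero]

lemma kf_le (r : ℝ) (hr : 0 < r) (z : E2) : kf r z ≤ ENNReal.ofReal r⁻¹ := by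
  unfold kf
  refine Set.indicator_le' (g := fun _ => ENNReal.ofReal r⁻¹) (fun s hs => ?_) (fun _ _ => zero_le) ‖z‖
  exact ENNReal.ofReal_le_ofReal (inv_anti₀ hr hs)

lemma annulus (r R : ℝ) (hr : 0 < r) (hR : r ≤ R) :
    ∫⁻ z : E2, (Set.Ico r R).indicator (fun s => ENNReal.ofReal (s⁻¹ ^ 2)) ‖z‖ =
      ENNReal.ofReal (2 * π * log (R / r)) := by
  rw [polar_radial _ (Measurable.indicator (by fun_prop) measurableSet_Ico)]
  have : ∫⁻ s in Set.Ioi (0:ℝ), ENNReal.ofReal s * (Set.Ico r R).indicator (fun s => ENNReal.ofReal (s⁻¹^2)) s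
      = ∫⁻ s in Set.Ioi (0:ℝ), (Set.Ico r R).indicator (fun s => ENNReal.ofReal s⁻¹) s := by
    refine setLIntegral_congr_fun measurableSet_Ioi fun s hs => ?_
    have hs' : (0:ℝ) < s := hs
    by_cases h : s ∈ Set.Ico r R
    · simp only [h, Set.indicator_of_mem]
      rw [← ENNReal.ofReal_mul hs'.le]; congr 1; field_simp
    · simp [Set.indicator_of_notMem h]
  rw [this, lintegral_indicator measurableSet_Ico, Measure.restrict_restrict measurableSet_Ico]
  have h2 : Set.Ico r R ∩ Set.Ioi 0 = Set.Ico r R := by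
    ext s; simp; intro h _; linarith
  rw [h2, ENNReal.ofReal_mul (p := 2 * π) (by positivity), restrict_Ico_eq_restrict_Ioc,
    ← integral_inv_of_pos hr (by linarith), intervalIntegral.integral_of_le hR,
    ofReal_integral_eq_lintegral_ofReal]
  · have := (intervalIntegral.intervalIntegrable_inv (μ := volume) (a := r) (b := R) (f := fun x => x) (by
      intro x hx; rw [Set.uIcc_of_le hR] at hx; exact (hr.trans_le hx.1).ne') (by fun_prop))
    exact this.1
  · filter_upwards [ae_restrict_mem measurableSet_Ioc] with s hs
    have := hs.1
    simp; linarith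

lemma ray1 (g : ℝ → ℝ) (hg : ContDiff ℝ 1 g) (a b r0 : ℝ) (hab : a < b) (h0 : b ≤ g 0)
    (hr0 : 0 < r0) (hgr : g r0 ≤ a) :
    ENNReal.ofReal (b - a) ≤ ∫⁻ r in Set.Ioi (0:ℝ),
      {r | a < g r ∧ g r < b}.indicator (fun r => ENNReal.ofReal |deriv g r|) r := by
  have hc : Continuous g := hg.continuous
  have hd : Continuous (deriv g) := hg.continuous_deriv le_rfl
  have hA : IsCompact (Set.Icc 0 r0 ∩ {r | g r ≤ a}) :=
    isCompact_Icc.inter_right (isClosed_le hc continuous_const)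
  obtain ⟨p, ⟨⟨hp0, hpr⟩, hpa⟩, hpl⟩ := hA.exists_isLeast ⟨r0, ⟨hr0.le, le_rfl⟩, hgr⟩
  have hB : IsCompact (Set.Icc 0 p ∩ {r | b ≤ g r}) :=
    isCompact_Icc.inter_right (isClosed_le continuous_const hc)
  obtain ⟨q, ⟨⟨hq0, hqp⟩, hqb⟩, hql⟩ := hB.exists_isGreatest ⟨0, ⟨le_rfl, hp0⟩, h0⟩
  simp only [Set.mem_setOf_eq] at hpa hqb
  have hsub : Set.Ioo q p ⊆ {r | a < g r ∧ g r < b} := by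
    intro r hr
    constructor
    · by_contra h
      exact absurd (hpl ⟨⟨hq0.trans hr.1.le, hr.2.le.trans hpr⟩, not_lt.1 h⟩) (not_le.2 hr.2)
    · by_contra h
      exact absurd (hql ⟨⟨hq0.trans hr.1.le, hr.2.le⟩, not_lt.1 h⟩) (not_le.2 hr.1)
  have hftc : ∫ r in q..p, deriv g r = g p - g q :=
    intervalIntegral.integral_deriv_eq_sub (fun x _ => (hg.differentiable (by simp)).differentiableAt)
      (hd.intervalIntegrable _ _)
  have h1 : b - a ≤ ∫ r in Set.Ioo q p, |deriv g r| := by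
    have : |∫ r in q..p, deriv g r| ≤ ∫ r in q..p, |deriv g r| :=
      intervalIntegral.abs_integral_le_integral_abs hqp
    rw [← integral_Ioc_eq_integral_Ioo, ← intervalIntegral.integral_of_le hqp]
    have h3 := neg_abs_le (∫ r in q..p, deriv g r)
    linarith
  calc ENNReal.ofReal (b - a) ≤ ENNReal.ofReal (∫ r in Set.Ioo q p, |deriv g r|) :=
        ENNReal.ofReal_le_ofReal h1
    _ = ∫⁻ r in Set.Ioo q p, ENNReal.ofReal |deriv g r| := by
        rw [ofReal_integral_eq_lintegral_ofReal]
        · exact (hd.abs.integrableOn_Icc).mono_set Set.Ioo_subset_Icc_self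
        · exact Filter.Eventually.of_forall fun _ => abs_nonneg _
    _ = ∫⁻ r in Set.Ioo q p,
          {r | a < g r ∧ g r < b}.indicator (fun r => ENNReal.ofReal |deriv g r|) r := by
        refine setLIntegral_congr_fun measurableSet_Ioo fun r hr => ?_
        simp only [Set.indicator_of_mem (hsub hr)]
    _ ≤ _ := lintegral_mono_set fun r hr => hq0.trans_lt hr.1

/-- gradient restricted to the layer -/
noncomputable def lay (u : E2 → ℝ) (a b : ℝ) : E2 → ENNReal :=
  {y | a < u y ∧ u y < b}.indicator (fun y => ENNReal.ofReal ‖fderiv ℝ u y‖)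

lemma measurableSet_lay (u : E2 → ℝ) (hu : ContDiff ℝ 1 u) (a b : ℝ) :
    MeasurableSet {y | a < u y ∧ u y < b} := by
  have hc := hu.continuous
  exact ((isOpen_lt continuous_const hc).inter (isOpen_lt hc continuous_const)).measurableSet

lemma measurable_lay (u : E2 → ℝ) (hu : ContDiff ℝ 1 u) (a b : ℝ) : Measurable (lay u a b) := by
  refine Measurable.indicator ?_ (measurableSet_lay u hu a b)
  have : Continuous (fderiv ℝ u) := hu.continuous_fderiv (by simp)
  exact (ENNReal.continuous_ofReal.comp this.norm).measurable

lemma ray2 (u : E2 → ℝ) (hu : ContDiff ℝ 1 u) (hs : HasCompactSupport u) (a b : ℝ) (ha : 0 ≤ a)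
    (hab : a < b) (x θ : E2) (hx : b ≤ u x) (hθ : ‖θ‖ = 1) :
    ENNReal.ofReal (b - a) ≤ ∫⁻ r in Set.Ioi (0:ℝ), lay u a b (x + r • θ) := by
  obtain ⟨R, hR⟩ := hs.isBounded.subset_closedBall (0 : E2)
  have hg : ContDiff ℝ 1 (fun r : ℝ => u (x + r • θ)) := by fun_prop
  have hpos : 0 < |R| + ‖x‖ + 1 := by positivity
  have h1 := ray1 (fun r : ℝ => u (x + r • θ)) hg a b (|R| + ‖x‖ + 1) hab (by simpa using hx)
    hpos (by
      have : u (x + (|R| + ‖x‖ + 1) • θ) = 0 := by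
        apply image_eq_zero_of_notMem_tsupport
        intro h
        have h2 := hR h
        rw [mem_closedBall_zero_iff] at h2
        have h3 : ‖(|R| + ‖x‖ + 1) • θ‖ ≤ ‖x + (|R| + ‖x‖ + 1) • θ‖ + ‖x‖ := by
          have := norm_sub_le (x + (|R| + ‖x‖ + 1) • θ) x
          simpa using this
        rw [norm_smul, hθ, Real.norm_of_nonneg hpos.le] at h3
        have := le_abs_self R
        linarith
      rw [this]; exact ha)
  refine h1.trans (lintegral_mono fun r => ?_)
  unfold lay
  by_cases h : a < u (x + r • θ) ∧ u (x + r • θ) < b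
  · rw [Set.indicator_of_mem (by exact h), Set.indicator_of_mem (by exact h)]
    apply ENNReal.ofReal_le_ofReal
    have hd : HasDerivAt (fun r : ℝ => u (x + r • θ)) (fderiv ℝ u (x + r • θ) θ) r := by
      have h4 : HasDerivAt (fun r : ℝ => x + r • θ) θ r := by
        simpa using ((hasDerivAt_id r).smul_const θ).const_add x
      exact ((hu.differentiable (by simp)).differentiableAt.hasFDerivAt).comp_hasDerivAt r h4
    rw [hd.deriv]
    have := (fderiv ℝ u (x + r • θ)).le_opNorm θ
    rwa [hθ, mul_one] at this
  · rw [Set.indicator_of_notMem (by exact h)]; exact zero_le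

lemma point_bound (u : E2 → ℝ) (hu : ContDiff ℝ 1 u) (hs : HasCompactSupport u) (a b : ℝ)
    (ha : 0 ≤ a) (hab : a < b) (x : E2) (hx : b ≤ u x) :
    ENNReal.ofReal (2 * π * (b - a)) ≤ ∫⁻ y, lay u a b y * ENNReal.ofReal ‖y - x‖⁻¹ := by
  have hm := measurable_lay u hu a b
  have h1 : ∫⁻ y, lay u a b y * ENNReal.ofReal ‖y - x‖⁻¹ =
      ∫⁻ z, lay u a b (x + z) * ENNReal.ofReal ‖z‖⁻¹ := by
    rw [← lintegral_add_left_eq_self _ x]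
    simp
  rw [h1, polar_lintegral _ (by fun_prop)]
  calc ENNReal.ofReal (2 * π * (b - a))
      = ∫⁻ _ : Metric.sphere (0:E2) 1, ENNReal.ofReal (b - a) ∂((volume : Measure E2).toSphere) := by
        rw [lintegral_const, sphere_mass, ← ENNReal.ofReal_mul (by linarith), mul_comm]
    _ ≤ _ := by
        refine lintegral_mono fun θ => ?_
        have hθ : ‖(θ : E2)‖ = 1 := by simp
        refine (ray2 u hu hs a b ha hab x θ hx hθ).trans_eq ?_
        refine setLIntegral_congr_fun measurableSet_Ioi fun r hr => ?_
        have hr' : (0:ℝ) < r := hr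
        simp only [norm_smul, hθ, mul_one, Real.norm_of_nonneg hr'.le]
        rw [mul_left_comm, ← ENNReal.ofReal_mul hr'.le, mul_inv_cancel₀ hr'.ne']
        simp

lemma cs_lintegral {α : Type*} [MeasurableSpace α] (μ : Measure α) (f g : α → ENNReal)
    (hf : AEMeasurable f μ) (hg : AEMeasurable g μ) :
    (∫⁻ x, f x * g x ∂μ) ^ 2 ≤ (∫⁻ x, f x ^ 2 ∂μ) * ∫⁻ x, g x ^ 2 ∂μ := by
  have h := ENNReal.lintegral_mul_le_Lp_mul_Lq μ Real.HolderConjugate.two_two hf hg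
  simp only [Pi.mul_apply, ENNReal.rpow_two] at h
  have h2 := pow_le_pow_left₀ zero_le h 2
  refine h2.trans_eq ?_
  rw [mul_pow, ← ENNReal.rpow_natCast, ← ENNReal.rpow_natCast, ← ENNReal.rpow_mul,
    ← ENNReal.rpow_mul]
  norm_num

lemma kf_sq_split (r R : ℝ) (z : E2) :
    kf r z ^ 2 ≤ (Set.Ico r R).indicator (fun s => ENNReal.ofReal (s⁻¹ ^ 2)) ‖z‖ + kf R z ^ 2 := by
  unfold kf
  have : (ENNReal.ofReal ‖z‖⁻¹)^2 = ENNReal.ofReal (‖z‖⁻¹ ^ 2) :=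
    (ENNReal.ofReal_pow (by positivity) 2).symm
  by_cases h1 : r ≤ ‖z‖
  · by_cases h2 : R ≤ ‖z‖
    · simp only [Set.mem_Ici, h1, h2, Set.indicator_of_mem]
      exact le_add_self
    · rw [Set.indicator_of_mem (by exact h1), Set.indicator_of_mem (by exact ⟨h1, not_le.1 h2⟩), this]
      exact le_self_add
  · rw [Set.indicator_of_notMem (by exact h1)]; simp

lemma iso_cap (u : E2 → ℝ) (hu : ContDiff ℝ 1 u) (hs : HasCompactSupport u) (a b : ℝ)
    (ha : 0 ≤ a) (hab : a < b) (r R : ℝ) (hr : 0 < r) (hrR : r ≤ R)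
    (hm : volume {x | b ≤ u x} = ENNReal.ofReal (π * r ^ 2))
    (htail : ∀ x, b ≤ u x → ∫⁻ y in {y | a < u y ∧ u y < b}, kf R (y - x) ^ 2 ≤ ENNReal.ofReal (2 * π)) :
    ENNReal.ofReal (4 * π * (b - a) ^ 2) ≤
      (∫⁻ y, lay u a b y ^ 2) * ENNReal.ofReal (2 * log (R / r) + 10) := by
  set B := {x | b ≤ u x} with hB
  set D := {y | a < u y ∧ u y < b} with hD
  have hBm : MeasurableSet B := (isClosed_le continuous_const hu.continuous).measurableSet
  have hDm : MeasurableSet D := measurableSet_lay u hu a b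
  have hlm := measurable_lay u hu a b
  have hkn := measurable_kn r
  have hkf := measurable_kf r
  set m := ENNReal.ofReal (π * r ^ 2) with hmdef
  have hm0 : m ≠ 0 := by
    have : 0 < π * r^2 := by positivity
    simpa [hmdef] using this
  have hmt : m ≠ ⊤ := ENNReal.ofReal_ne_top
  set Pn : E2 → ENNReal := fun y => ∫⁻ x in B, kn r (y - x) with hPn
  set Pf : E2 → ENNReal := fun y => ∫⁻ x in B, kf r (y - x) with hPf
  have hPnm : Measurable Pn := by
    apply Measurable.lintegral_prod_right'  (f := fun p : E2 × E2 => kn r (p.1 - p.2))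
    fun_prop
  have hPfm : Measurable Pf := by
    apply Measurable.lintegral_prod_right'  (f := fun p : E2 × E2 => kf r (p.1 - p.2))
    fun_prop
  -- lower bound
  have h1 : ENNReal.ofReal (2 * π * (b - a)) * m ≤ ∫⁻ y in D, lay u a b y * (Pn y + Pf y) := by
    calc ENNReal.ofReal (2 * π * (b - a)) * m
        = ∫⁻ x in B, ENNReal.ofReal (2 * π * (b - a)) := by
          rw [setLIntegral_const, hm]
      _ ≤ ∫⁻ x in B, ∫⁻ y, lay u a b y * ENNReal.ofReal ‖y - x‖⁻¹ :=
          setLIntegral_mono' hBm fun x hx => point_bound u hu hs a b ha hab x hx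
      _ = ∫⁻ y, ∫⁻ x in B, lay u a b y * ENNReal.ofReal ‖y - x‖⁻¹ := by
          rw [lintegral_lintegral_swap]
          fun_prop
      _ = ∫⁻ y, lay u a b y * (Pn y + Pf y) := by
          congr 1; ext y
          rw [lintegral_const_mul _ (by fun_prop), hPn, hPf]
          simp only
          rw [← lintegral_add_left (by fun_prop)]
          simp_rw [kn_add_kf]
      _ = ∫⁻ y in D, lay u a b y * (Pn y + Pf y) := by
          rw [← lintegral_indicator hDm]
          congr 1; ext y
          by_cases hy : y ∈ D
          · simp [hy]
          · rw [Set.indicator_of_notMem hy, lay, Set.indicator_of_notMem hy, zero_mul]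
  have h2 : (ENNReal.ofReal (2 * π * (b - a)) * m) ^ 2 ≤
      (∫⁻ y, lay u a b y ^ 2) * ∫⁻ y in D, (Pn y + Pf y) ^ 2 := by
    refine (pow_le_pow_left₀ zero_le h1 2).trans ?_
    refine (cs_lintegral _ _ _ hlm.aemeasurable (by fun_prop)).trans ?_
    gcongr
    exact Measure.restrict_le_self
  have hPn_le : ∀ y, Pn y ≤ ENNReal.ofReal (2 * π * r) := by
    intro y
    calc Pn y ≤ ∫⁻ x, kn r (y - x) := setLIntegral_le_lintegral _ _
      _ = ∫⁻ x, kn r x := lintegral_sub_left_eq_self _ y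
      _ = _ := lintegral_kn r
  have hPf_le : ∀ y, Pf y ≤ ENNReal.ofReal (π * r) := by
    intro y
    calc Pf y ≤ ∫⁻ x in B, ENNReal.ofReal r⁻¹ := lintegral_mono fun x => kf_le r hr _
      _ = ENNReal.ofReal (π * r) := by
        rw [setLIntegral_const, hm, hmdef, ← ENNReal.ofReal_mul (by positivity)]
        congr 1; field_simp
  have hPn_int : ∫⁻ y, Pn y = m * ENNReal.ofReal (2 * π * r) := by
    rw [hPn, lintegral_lintegral_swap (by fun_prop)]
    have : ∀ x, ∫⁻ y, kn r (y - x) = ENNReal.ofReal (2 * π * r) := by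
      intro x
      rw [lintegral_sub_right_eq_self (kn r) x, lintegral_kn r]
    simp_rw [this]
    rw [setLIntegral_const, hm, mul_comm]
  have hPf_sq : ∀ y, Pf y ^ 2 ≤ m * ∫⁻ x in B, kf r (y - x) ^ 2 := by
    intro y
    have := cs_lintegral (volume.restrict B) (fun _ => 1) (fun x => kf r (y - x))
      (by fun_prop) (by fun_prop)
    simpa [hm] using this
  have hfar : ∀ x ∈ B, ∫⁻ y in D, kf r (y - x) ^ 2 ≤ ENNReal.ofReal (2 * π * log (R / r) + 2 * π) := by
    intro x hx
    have hlog : 0 ≤ log (R / r) := Real.log_nonneg (by rw [le_div_iff₀ hr]; linarith)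
    rw [ENNReal.ofReal_add (by positivity) (by positivity)]
    calc ∫⁻ y in D, kf r (y - x) ^ 2
        ≤ ∫⁻ y in D, ((Set.Ico r R).indicator (fun s => ENNReal.ofReal (s⁻¹ ^ 2)) ‖y - x‖
            + kf R (y - x) ^ 2) := lintegral_mono fun y => kf_sq_split r R _
      _ = (∫⁻ y in D, (Set.Ico r R).indicator (fun s => ENNReal.ofReal (s⁻¹ ^ 2)) ‖y - x‖)
            + ∫⁻ y in D, kf R (y - x) ^ 2 := by
          refine lintegral_add_right _ ?_
          have := measurable_kf R
          fun_prop
      _ ≤ _ := by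
          refine add_le_add ?_ (htail x hx)
          refine (setLIntegral_le_lintegral _ _).trans ?_
          rw [lintegral_sub_right_eq_self
            (fun z : E2 => (Set.Ico r R).indicator (fun s => ENNReal.ofReal (s⁻¹ ^ 2)) ‖z‖) x,
            annulus r R hr hrR]
  have h3 : ∫⁻ y in D, (Pn y + Pf y) ^ 2 ≤
      m ^ 2 * ENNReal.ofReal (π * (2 * log (R / r) + 10)) := by
    have hlog : 0 ≤ log (R / r) := Real.log_nonneg (by rw [le_div_iff₀ hr]; linarith)
    calc ∫⁻ y in D, (Pn y + Pf y) ^ 2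
        ≤ ∫⁻ y in D, (m * (∫⁻ x in B, kf r (y - x) ^ 2) + ENNReal.ofReal (4 * π * r) * Pn y) := by
          refine lintegral_mono fun y => ?_
          calc (Pn y + Pf y) ^ 2 = Pf y ^ 2 + (Pn y + 2 * Pf y) * Pn y := by ring
            _ ≤ _ := by
              gcongr
              · exact hPf_sq y
              · calc Pn y + 2 * Pf y ≤ ENNReal.ofReal (2 * π * r) + 2 * ENNReal.ofReal (π * r) := by
                      gcongr
                      · exact hPn_le y
                      · exact hPf_le y
                  _ = ENNReal.ofReal (4 * π * r) := by
                      rw [← ENNReal.ofReal_ofNat 2, ← ENNReal.ofReal_mul (by norm_num),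
                        ← ENNReal.ofReal_add (by positivity) (by positivity)]
                      congr 1; ring
      _ = m * (∫⁻ y in D, ∫⁻ x in B, kf r (y - x) ^ 2) + ENNReal.ofReal (4 * π * r) * ∫⁻ y in D, Pn y := by
          rw [lintegral_add_right _ (by fun_prop), lintegral_const_mul _ hPnm,
            lintegral_const_mul]
          apply Measurable.lintegral_prod_right'  (f := fun p : E2 × E2 => kf r (p.1 - p.2) ^ 2)
          fun_prop
      _ ≤ m * (m * ENNReal.ofReal (2 * π * log (R / r) + 2 * π)) +
          ENNReal.ofReal (4 * π * r) * (m * ENNReal.ofReal (2 * π * r)) := by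
          gcongr
          · rw [lintegral_lintegral_swap (by fun_prop)]
            refine (setLIntegral_mono' hBm hfar).trans_eq ?_
            rw [setLIntegral_const, hm, mul_comm]
          · exact (setLIntegral_le_lintegral _ _).trans_eq hPn_int
      _ = m ^ 2 * ENNReal.ofReal (π * (2 * log (R / r) + 10)) := by
          rw [hmdef, ← ENNReal.ofReal_pow (by positivity)]
          rw [← ENNReal.ofReal_mul (by positivity), ← ENNReal.ofReal_mul (by positivity),
            ← ENNReal.ofReal_mul (by positivity), ← ENNReal.ofReal_mul (by positivity),
            ← ENNReal.ofReal_mul (by positivity), 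
            ← ENNReal.ofReal_add (by positivity) (by positivity)]
          congr 1; ring
  have h4 := h2.trans (mul_le_mul_right h3 _)
  have h5 : m ^ 2 * (ENNReal.ofReal π * ENNReal.ofReal (4 * π * (b - a) ^ 2)) ≤
      m ^ 2 * (ENNReal.ofReal π * ((∫⁻ y, lay u a b y ^ 2) * ENNReal.ofReal (2 * log (R / r) + 10))) := by
    rw [ENNReal.ofReal_mul pi_pos.le] at h4
    calc _ = (ENNReal.ofReal (2 * π * (b - a)) * m) ^ 2 := by
            rw [mul_pow, ← ENNReal.ofReal_pow (p := 2 * π * (b - a)) (by nlinarith [pi_pos]), ← ENNReal.ofReal_mul pi_pos.le,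
              mul_comm]
            congr 2; ring
      _ ≤ _ := h4
      _ = _ := by ring
  rw [ENNReal.mul_le_mul_iff_right (by simpa using hm0) (by simp [hmt]),
    ENNReal.mul_le_mul_iff_right (by simpa using pi_pos) (by simp)] at h5
  exact h5

lemma fub2 (F : E2 → ENNReal) (hF : Measurable F) :
    ∫⁻ y, F y = ∫⁻ s : ℝ, ∫⁻ t : ℝ, F !₂[s, t] := by
  have h1 := (EuclideanSpace.volume_preserving_symm_measurableEquiv_toLp (Fin 2)).symm
  have h2 := (volume_preserving_finTwoArrow ℝ).symm
  rw [← h1.lintegral_comp hF, ← h2.lintegral_comp (by fun_prop), Measure.volume_eq_prod,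
    lintegral_prod _ (by fun_prop)]
  rfl

lemma meas_strip : MeasurableSet strip := by
  have : strip = (fun x : E2 => x 1) ⁻¹' Set.Ioo (-1:ℝ) 1 := rfl
  rw [this]
  exact measurableSet_Ioo.preimage (by fun_prop)

lemma tail_strip (x : E2) (hx : x ∈ strip) :
    ∫⁻ y in strip, kf 4 (y - x) ^ 2 ≤ ENNReal.ofReal (2 * π) := by
  have hm : MeasurableSet strip := meas_strip
  have hpt : ∀ y ∈ strip, kf 4 (y - x) ^ 2 ≤ ENNReal.ofReal ((1 + ((y 0 - x 0) / 2) ^ 2)⁻¹ / 3) := by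
    intro y hy
    unfold kf
    by_cases h : 4 ≤ ‖y - x‖
    · rw [Set.indicator_of_mem (by exact h), ← ENNReal.ofReal_pow (by positivity)]
      apply ENNReal.ofReal_le_ofReal
      have h2 : ‖y - x‖ ^ 2 = (y 0 - x 0)^2 + (y 1 - x 1)^2 := by
        rw [EuclideanSpace.real_norm_sq_eq]; simp
      have hy1 : -1 < y 1 ∧ y 1 < 1 := hy
      have hx1 : -1 < x 1 ∧ x 1 < 1 := hx
      have h16 : 16 ≤ ‖y - x‖ ^ 2 := by nlinarith
      have h4 : (y 1 - x 1) ^ 2 ≤ 4 := by nlinarith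
      rw [inv_pow, div_eq_mul_inv, ← mul_inv]
      apply inv_anti₀ (by positivity)
      nlinarith [sq_nonneg (y 1 - x 1)]
    · rw [Set.indicator_of_notMem (by exact h)]; simp
  refine (setLIntegral_mono' hm hpt).trans ?_
  rw [← lintegral_indicator hm, fub2 _ (Measurable.indicator (by fun_prop) hm)]
  have : ∀ s t : ℝ, strip.indicator (fun y : E2 => ENNReal.ofReal ((1 + ((y 0 - x 0) / 2) ^ 2)⁻¹ / 3)) !₂[s, t]
      = ENNReal.ofReal ((1 + ((s - x 0) / 2) ^ 2)⁻¹ / 3) * (Set.Ioo (-1:ℝ) 1).indicator 1 t := by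
    intro s t
    by_cases ht : t ∈ Set.Ioo (-1:ℝ) 1
    · rw [Set.indicator_of_mem (by exact ht), Set.indicator_of_mem ht]; simp
    · rw [Set.indicator_of_notMem (by exact ht), Set.indicator_of_notMem ht]; simp
  simp_rw [this]
  have h3 : ∀ s : ℝ, ∫⁻ t : ℝ, ENNReal.ofReal ((1 + ((s - x 0) / 2) ^ 2)⁻¹ / 3) * (Set.Ioo (-1:ℝ) 1).indicator 1 t
      = ENNReal.ofReal ((1 + ((s - x 0) / 2) ^ 2)⁻¹ / 3) * 2 := by
    intro s
    rw [lintegral_const_mul _ (Measurable.indicator (by fun_prop) measurableSet_Ioo),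
      lintegral_indicator_one measurableSet_Ioo, Real.volume_Ioo]
    norm_num
  simp_rw [h3]
  have hintg : Integrable (fun s : ℝ => (1 + (s / 2) ^ 2)⁻¹ / 3) :=
    (integrable_inv_one_add_sq.comp_div (two_ne_zero)).div_const 3
  have hval : ∫ s : ℝ, (1 + (s / 2) ^ 2)⁻¹ / 3 = 2 * π / 3 := by
    rw [integral_div, Measure.integral_comp_div (fun s : ℝ => (1 + s ^ 2)⁻¹) 2,
      integral_univ_inv_one_add_sq]
    simp
  rw [lintegral_mul_const _ (by fun_prop), lintegral_sub_right_eq_self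
    (fun s : ℝ => ENNReal.ofReal ((1 + (s / 2) ^ 2)⁻¹ / 3)) (x 0),
    ← ofReal_integral_eq_lintegral_ofReal hintg
      (Filter.Eventually.of_forall fun s => by positivity), hval,
    ← ENNReal.ofReal_ofNat 2, ← ENNReal.ofReal_mul (by positivity)]
  apply ENNReal.ofReal_le_ofReal
  linarith [pi_pos]

lemma tail_fin (D : Set E2) (R : ℝ) (hR : 0 < R) (hD : volume D ≤ ENNReal.ofReal (π * R ^ 2)) (x : E2) :
    ∫⁻ y in D, kf R (y - x) ^ 2 ≤ ENNReal.ofReal (2 * π) := by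
  calc ∫⁻ y in D, kf R (y - x) ^ 2 ≤ ∫⁻ y in D, ENNReal.ofReal R⁻¹ ^ 2 :=
        lintegral_mono fun y => by gcongr; exact kf_le R hR _
    _ = ENNReal.ofReal R⁻¹ ^ 2 * volume D := setLIntegral_const _ _
    _ ≤ ENNReal.ofReal R⁻¹ ^ 2 * ENNReal.ofReal (π * R ^ 2) := by gcongr
    _ ≤ _ := by
      rw [← ENNReal.ofReal_pow (by positivity), ← ENNReal.ofReal_mul (by positivity)]
      apply ENNReal.ofReal_le_ofReal
      have : R⁻¹ ^ 2 * (π * R ^ 2) = π := by field_simp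
      rw [this]; linarith [pi_pos]

lemma poincare (u : E2 → ℝ) (hu : ContDiff ℝ 1 u) (hsub : tsupport u ⊆ strip) :
    ∫⁻ x, ENNReal.ofReal (u x ^ 2) ≤ 4 * ∫⁻ x, ENNReal.ofReal ‖fderiv ℝ u x‖ ^ 2 := by
  have hc := hu.continuous
  have hfc : Continuous (fderiv ℝ u) := hu.continuous_fderiv (by simp)
  have hnot : ∀ s t : ℝ, t ∉ Set.Ioo (-1:ℝ) 1 → u !₂[s,t] = 0 := by
    intro s t ht
    apply image_eq_zero_of_notMem_tsupport
    intro h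
    exact ht (hsub h)
  have hcurve : ∀ s : ℝ, Continuous (fun t : ℝ => (!₂[s, t] : E2)) := by
    intro s
    fun_prop
  rw [fub2 _ (by fun_prop), fub2 _ (by fun_prop), ← lintegral_const_mul _ (by
    apply Measurable.lintegral_prod_right' (f := fun p : ℝ × ℝ => ENNReal.ofReal ‖fderiv ℝ u !₂[p.1, p.2]‖ ^ 2)
    have : Continuous (fun p : ℝ × ℝ => (!₂[p.1, p.2] : E2)) := by fun_prop
    have := (hfc.comp this).norm.measurable
    simp only [Function.comp_def] at this
    fun_prop)]
  refine lintegral_mono fun s => ?_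
  have hfm : Measurable fun t : ℝ => ENNReal.ofReal ‖fderiv ℝ u !₂[s,t]‖ := by
    have := (hfc.comp (hcurve s)).norm.measurable
    simp only [Function.comp_def] at this
    fun_prop
  have key : ∀ t ∈ Set.Ioo (-1:ℝ) 1, ENNReal.ofReal (u !₂[s,t] ^ 2) ≤
      2 * ∫⁻ t, ENNReal.ofReal ‖fderiv ℝ u !₂[s,t]‖ ^ 2 := by
    intro t ht
    have hderiv : ∀ τ : ℝ, HasDerivAt (fun τ : ℝ => u !₂[s,τ]) (fderiv ℝ u !₂[s,τ] !₂[0,1]) τ := by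
      intro τ
      have h4 : HasDerivAt (fun τ : ℝ => (!₂[s,τ] : E2)) !₂[0,1] τ := by
        have e : (fun τ : ℝ => (!₂[s,τ] : E2)) = fun τ => !₂[s,0] + τ • !₂[0,1] := by
          ext τ i; fin_cases i <;> simp
        rw [e]
        simpa using ((hasDerivAt_id τ).smul_const (!₂[0,1] : E2)).const_add !₂[s,0]
      exact ((hu.differentiable (by simp)).differentiableAt.hasFDerivAt).comp_hasDerivAt τ h4
    have hdc : Continuous fun τ : ℝ => fderiv ℝ u !₂[s,τ] !₂[0,1] :=
      (hfc.comp (hcurve s)).clm_apply continuous_const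
    have hftc := intervalIntegral.integral_eq_sub_of_hasDerivAt (a := -1) (b := t)
      (fun τ _ => hderiv τ) (hdc.intervalIntegrable _ _)
    rw [hnot s (-1) (by simp), sub_zero] at hftc
    have hn1 : ‖(!₂[0,1] : E2)‖ = 1 := by
      rw [EuclideanSpace.norm_eq]; simp
    have hle : ENNReal.ofReal |u !₂[s,t]| ≤ ∫⁻ τ in Set.Ioc (-1:ℝ) 1, 1 * ENNReal.ofReal ‖fderiv ℝ u !₂[s,τ]‖ := by
      calc ENNReal.ofReal |u !₂[s,t]| ≤ ENNReal.ofReal (∫ τ in Set.Ioc (-1) t, |fderiv ℝ u !₂[s,τ] !₂[0,1]|) := by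
            apply ENNReal.ofReal_le_ofReal
            rw [← hftc, ← intervalIntegral.integral_of_le ht.1.le]
            exact intervalIntegral.abs_integral_le_integral_abs ht.1.le
        _ = ∫⁻ τ in Set.Ioc (-1) t, ENNReal.ofReal |fderiv ℝ u !₂[s,τ] !₂[0,1]| := by
            rw [ofReal_integral_eq_lintegral_ofReal]
            · exact (hdc.abs.integrableOn_Icc).mono_set Set.Ioc_subset_Icc_self
            · exact Filter.Eventually.of_forall fun _ => abs_nonneg _
        _ ≤ ∫⁻ τ in Set.Ioc (-1) t, 1 * ENNReal.ofReal ‖fderiv ℝ u !₂[s,τ]‖ := by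
            refine lintegral_mono fun τ => ?_
            rw [one_mul]
            apply ENNReal.ofReal_le_ofReal
            have := (fderiv ℝ u !₂[s,τ]).le_opNorm !₂[0,1]
            rwa [hn1, mul_one] at this
        _ ≤ _ := lintegral_mono_set (Set.Ioc_subset_Ioc_right ht.2.le)
    calc ENNReal.ofReal (u !₂[s,t] ^ 2) = ENNReal.ofReal |u !₂[s,t]| ^ 2 := by
          rw [← ENNReal.ofReal_pow (abs_nonneg _), sq_abs]
      _ ≤ _ := pow_le_pow_left₀ zero_le hle 2
      _ ≤ _ := cs_lintegral _ _ _ (by fun_prop) (by fun_prop)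
      _ ≤ _ := by
          gcongr
          · simp; norm_num
          · exact Measure.restrict_le_self
  calc ∫⁻ t, ENNReal.ofReal (u !₂[s,t] ^ 2)
      = ∫⁻ t in Set.Ioo (-1:ℝ) 1, ENNReal.ofReal (u !₂[s,t] ^ 2) := by
        rw [← lintegral_indicator measurableSet_Ioo]
        congr 1; ext t
        by_cases ht : t ∈ Set.Ioo (-1:ℝ) 1
        · rw [Set.indicator_of_mem ht]
        · rw [Set.indicator_of_notMem ht, hnot s t ht]; simp
    _ ≤ ∫⁻ t in Set.Ioo (-1:ℝ) 1, 2 * ∫⁻ t, ENNReal.ofReal ‖fderiv ℝ u !₂[s,t]‖ ^ 2 :=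
        setLIntegral_mono' measurableSet_Ioo key
    _ = _ := by
        rw [setLIntegral_const, Real.volume_Ioo]
        norm_num
        ring

lemma alg_pair (a b e1 e2 L1 L2 lam : ℝ) (he1 : 0 ≤ e1)
    (he : e1 + e2 ≤ 1) (hL1 : 0 ≤ L1) (hL : L1 ≤ L2) (hlam : 0 ≤ lam)
    (h1 : a ^ 2 ≤ e1 * (L1 + 10)) (h2 : b ^ 2 ≤ e2 * (L2 - L1 + 10))
    (h3 : L1 - lam ≤ a ^ 2) (h4 : L2 - lam ≤ (a + b) ^ 2) :
    a ^ 2 ≤ 2 * (lam + 10) ∨ (a + b) ^ 2 - a ^ 2 ≤ 21 * (lam + 20) := by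
  obtain ⟨X, hX⟩ : ∃ X, X = L1 + 10 := ⟨_, rfl⟩
  obtain ⟨Y, hY⟩ : ∃ Y, Y = L2 - L1 + 10 := ⟨_, rfl⟩
  obtain ⟨h, hh⟩ : ∃ h, h = 1 - e1 := ⟨_, rfl⟩
  obtain ⟨K, hK⟩ : ∃ K, K = lam + 20 := ⟨_, rfl⟩
  have hX0 : 0 < X := by linarith
  have hY0 : 0 < Y := by linarith
  have h1' : a ^ 2 ≤ (1 - h) * X := by rw [hX, hh]; linarith
  have h2' : b ^ 2 ≤ h * Y := by
    rw [← hY] at h2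
    exact h2.trans (mul_le_mul_of_nonneg_right (by linarith) hY0.le)
  have hhX : h * X ≤ lam + 10 := by nlinarith
  have hh0 : 0 ≤ h := by
    by_contra hneg
    have : h * Y < 0 := mul_neg_of_neg_of_pos (not_le.1 hneg) hY0
    nlinarith
  by_cases hc : h ≤ 1 / 2
  · right
    have hab : a * b ≤ Y / 8 + 2 * K := by
      apply abs_le_of_sq_le_sq' _ (by linarith) |>.2
      have q1 : a ^ 2 ≤ X := by nlinarith
      have q2 : a ^ 2 * b ^ 2 ≤ X * (h * Y) :=
        mul_le_mul q1 h2' (sq_nonneg b) hX0.le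
      have q3 : X * (h * Y) ≤ K * Y := by
        have : h * X ≤ K := by linarith
        nlinarith
      nlinarith [sq_nonneg (Y / 8 - 2 * K)]
    have hb2 : b ^ 2 ≤ Y / 2 := by nlinarith
    have ha2 : a ^ 2 ≤ X := by nlinarith
    nlinarith
  · left
    push Not at hc
    nlinarith

lemma count_bound (S : Finset ℕ) (L : ℕ → ℝ) (hG : ∀ j ∈ S, (0:ℝ) ≤ L j + 10 - j)
    (hp : ∀ i ∈ S, ∀ j ∈ S, i < j → ∀ lam : ℝ, 0 ≤ lam → L i - lam ≤ i → L j - lam ≤ j →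
      (i:ℝ) ≤ 2 * (lam + 10) ∨ (j:ℝ) - i ≤ 21 * (lam + 20)) (k : ℕ) :
    (S.filter (fun j => ⌊L j + 10 - j⌋₊ = k)).card ≤ 500 * (k + 1) := by
  set T := S.filter (fun j => ⌊L j + 10 - j⌋₊ = k) with hT
  have hTl : ∀ j ∈ T, L j - ((k : ℝ) + 1) ≤ j := by
    intro j hj
    rw [hT, Finset.mem_filter] at hj
    have := Nat.lt_floor_add_one (L j + 10 - j)
    rw [hj.2] at this
    linarith
  have hTS : ∀ j ∈ T, j ∈ S := fun j hj => (Finset.mem_filter.1 hj).1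
  set T2 := T.filter (fun j => 2 * (k + 11) < j) with hT2
  have hsplit : T ⊆ Finset.range (2 * (k + 11) + 1) ∪ T2 := by
    intro j hj
    rw [Finset.mem_union, Finset.mem_range, hT2, Finset.mem_filter]
    by_cases h : 2 * (k + 11) < j
    · exact Or.inr ⟨hj, h⟩
    · left; omega
  have hT2c : T2.card ≤ 21 * (k + 21) + 1 := by
    rcases T2.eq_empty_or_nonempty with h | h
    · rw [h]; simp
    · set i := T2.min' h with hi
      have hiT : i ∈ T2 := Finset.min'_mem _ _
      have hsub : T2 ⊆ Finset.Icc i (i + 21 * (k + 21)) := by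
        intro j hj
        have hij : i ≤ j := Finset.min'_le _ _ hj
        rw [Finset.mem_Icc]
        refine ⟨hij, ?_⟩
        rcases hij.eq_or_lt with h0 | h0
        · omega
        have hiT' := Finset.mem_filter.1 hiT
        have hjT' := Finset.mem_filter.1 hj
        rcases hp i (hTS i hiT'.1) j (hTS j hjT'.1) h0 (k + 1) (by positivity)
          (hTl i hiT'.1) (hTl j hjT'.1) with h1 | h1
        · exfalso
          have : (2 * (k + 11) : ℝ) < i := by exact_mod_cast hiT'.2
          linarith
        · have : (j : ℝ) ≤ i + 21 * (k + 21) := by linarith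
          exact_mod_cast this
      refine (Finset.card_le_card hsub).trans ?_
      simp; omega
  have h3 := (Finset.card_le_card hsplit).trans (Finset.card_union_le _ _)
  rw [Finset.card_range] at h3
  omega

lemma sum_bound : ∃ K : ℝ, 0 ≤ K ∧ ∀ (S : Finset ℕ) (L : ℕ → ℝ), (∀ j ∈ S, (0:ℝ) ≤ L j + 10 - j) →
    (∀ i ∈ S, ∀ j ∈ S, i < j → ∀ lam : ℝ, 0 ≤ lam → L i - lam ≤ i → L j - lam ≤ j →
      (i:ℝ) ≤ 2 * (lam + 10) ∨ (j:ℝ) - i ≤ 21 * (lam + 20)) →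
    ∑ j ∈ S, exp (-(L j + 10 - j)) ≤ K := by
  have hsum : Summable (fun k : ℕ => (500 * ((k:ℝ) + 1)) * exp (-(k:ℝ))) := by
    have h1 := Real.summable_pow_mul_exp_neg_nat_mul 1 (r := 1) one_pos
    have h2 := Real.summable_pow_mul_exp_neg_nat_mul 0 (r := 1) one_pos
    refine ((h1.add h2).mul_left 500).congr fun k => ?_
    simp; ring
  refine ⟨∑' k : ℕ, (500 * ((k:ℝ) + 1)) * exp (-(k:ℝ)), tsum_nonneg fun k => by positivity, ?_⟩
  intro S L hG hp
  have hmaps : ∀ j ∈ S, ⌊L j + 10 - j⌋₊ ∈ S.image (fun j => ⌊L j + 10 - j⌋₊) :=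
    fun j hj => Finset.mem_image_of_mem _ hj
  rw [← Finset.sum_fiberwise_of_maps_to hmaps]
  refine le_trans (Finset.sum_le_sum fun k _ => ?_) (hsum.sum_le_tsum _ fun k _ => by positivity)
  calc ∑ j ∈ S with ⌊L j + 10 - j⌋₊ = k, exp (-(L j + 10 - j))
      ≤ ∑ j ∈ S with ⌊L j + 10 - j⌋₊ = k, exp (-(k:ℝ)) := by
        refine Finset.sum_le_sum fun j hj => ?_
        rw [Finset.mem_filter] at hj
        have := Nat.floor_le (hG j hj.1)
        rw [hj.2] at this
        apply Real.exp_le_exp.2; linarith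
    _ = ((S.filter (fun j => ⌊L j + 10 - j⌋₊ = k)).card : ℝ) * exp (-(k:ℝ)) := by
        rw [Finset.sum_const, nsmul_eq_mul]
    _ ≤ _ := by
        gcongr
        exact_mod_cast count_bound S L hG hp k

lemma energy_split (u : E2 → ℝ) (hu : ContDiff ℝ 1 u) (t1 t2 : ℝ) :
    (∫⁻ y, lay u 0 t1 y ^ 2) + (∫⁻ y, lay u t1 t2 y ^ 2) ≤ ∫⁻ x, ENNReal.ofReal ‖fderiv ℝ u x‖ ^ 2 := by
  have h1 := measurable_lay u hu 0 t1
  rw [← lintegral_add_left (by fun_prop)]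
  refine lintegral_mono fun y => ?_
  unfold lay
  by_cases h : u y < t1
  · have : ¬ (t1 < u y ∧ u y < t2) := fun h' => absurd h'.1 (not_lt.2 h.le)
    rw [Set.indicator_of_notMem (s := {y | t1 < u y ∧ u y < t2}) (by exact this)]
    simp only [ne_eq, OfNat.ofNat_ne_zero, not_false_eq_true, zero_pow, add_zero]
    gcongr
    exact Set.indicator_le_self _ _ _
  · have : ¬ (0 < u y ∧ u y < t1) := fun h' => absurd h'.2 h
    rw [Set.indicator_of_notMem (s := {y | 0 < u y ∧ u y < t1}) (by exact this)]
    simp only [ne_eq, OfNat.ofNat_ne_zero, not_false_eq_true, zero_pow, zero_add]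
    gcongr
    exact Set.indicator_le_self _ _ _

lemma level_meas (u : E2 → ℝ) (hu : ContDiff ℝ 1 u) (hsub : tsupport u ⊆ strip)
    (hE : ∫⁻ x, ENNReal.ofReal ‖fderiv ℝ u x‖ ^ 2 ≤ 1) (t : ℝ) (ht : 0 < t) (ht1 : 1 ≤ 4 * π * t ^ 2) :
    volume {x | t ≤ u x} ≤ ENNReal.ofReal (16 * π) := by
  have hc := hu.continuous
  have hp := poincare u hu hsub
  have hch := mul_meas_ge_le_lintegral (μ := (volume : Measure E2)) (f := fun x => ENNReal.ofReal (u x ^ 2))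
    (by fun_prop) (ENNReal.ofReal (1 / (4 * π)))
  have hss : {x | t ≤ u x} ⊆ {x | ENNReal.ofReal (1 / (4 * π)) ≤ ENNReal.ofReal (u x ^ 2)} := by
    intro x hx
    have hx' : t ≤ u x := hx
    apply ENNReal.ofReal_le_ofReal
    rw [div_le_iff₀ (by positivity)]
    nlinarith [mul_le_mul hx' hx' ht.le (ht.le.trans hx'), pi_pos]
  have h1 : ENNReal.ofReal (1 / (4 * π)) * volume {x | t ≤ u x} ≤ 4 :=
    calc _ ≤ _ := by gcongr
      _ ≤ _ := hch
      _ ≤ _ := hp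
      _ ≤ 4 * 1 := by gcongr
      _ = 4 := mul_one _
  have h2 : volume {x | t ≤ u x} = ENNReal.ofReal (4 * π) * (ENNReal.ofReal (1 / (4 * π)) * volume {x | t ≤ u x}) := by
    rw [← mul_assoc, ← ENNReal.ofReal_mul (by positivity)]
    have : 4 * π * (1 / (4 * π)) = 1 := by field_simp
    rw [this]; simp
  rw [h2]
  calc _ ≤ ENNReal.ofReal (4 * π) * 4 := by gcongr
    _ = _ := by
      rw [← ENNReal.ofReal_ofNat 4, ← ENNReal.ofReal_mul (by positivity)]
      congr 1; ring

lemma cap_real (e : ENNReal) (A B : ℝ) (he : e ≤ 1) (hB : 0 ≤ B)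
    (h : ENNReal.ofReal A ≤ e * ENNReal.ofReal B) : A ≤ e.toReal * B := by
  have het : e ≠ ⊤ := ne_top_of_le_ne_top ENNReal.one_ne_top he
  rw [← ENNReal.ofReal_toReal het, ← ENNReal.ofReal_mul ENNReal.toReal_nonneg] at h
  exact (ENNReal.ofReal_le_ofReal_iff (by positivity)).1 h

noncomputable def tj (j : ℕ) : ℝ := √(j / (4 * π))

lemma tj_sq (j : ℕ) : 4 * π * tj j ^ 2 = j := by
  unfold tj
  rw [Real.sq_sqrt (by positivity)]
  field_simp

lemma tj_pos (j : ℕ) (hj : 1 ≤ j) : 0 < tj j := by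
  unfold tj
  apply Real.sqrt_pos.2
  have : (0:ℝ) < j := by exact_mod_cast hj
  positivity

lemma tj_lt (i j : ℕ) (h : i < j) : tj i < tj j := by
  unfold tj
  apply Real.sqrt_lt_sqrt (by positivity)
  have : (i:ℝ) < j := by exact_mod_cast h
  gcongr

noncomputable def rad (u : E2 → ℝ) (j : ℕ) : ℝ := √((volume {x | tj j ≤ u x}).toReal / π)

lemma strip_of_pos (u : E2 → ℝ) (hsub : tsupport u ⊆ strip) (x : E2) (hx : 0 < u x) : x ∈ strip :=
  hsub (subset_tsupport u (by simpa using hx.ne'))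

lemma upper_sum : ∃ K : ℝ, 0 ≤ K ∧ ∀ (u : E2 → ℝ), ContDiff ℝ 1 u → HasCompactSupport u → tsupport u ⊆ strip →
    ∫⁻ x, ENNReal.ofReal ‖fderiv ℝ u x‖ ^ 2 ≤ 1 → ∀ N : ℕ,
    ∑ j ∈ Finset.Icc 1 N, ENNReal.ofReal (exp (j + 1)) * volume {x | tj j ≤ u x} ≤ ENNReal.ofReal K := by
  obtain ⟨K, hK0, hK⟩ := sum_bound
  refine ⟨16 * π * exp 11 * K, by positivity, ?_⟩
  intro u hu hs hsub hE N
  set S := (Finset.Icc 1 N).filter (fun j => volume {x | tj j ≤ u x} ≠ 0) with hS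
  set L : ℕ → ℝ := fun j => 2 * log (4 / rad u j) with hL
  have hS1 : ∀ j ∈ S, 1 ≤ j := fun j hj => (Finset.mem_Icc.1 (Finset.mem_filter.1 hj).1).1
  have hle : ∀ j, 1 ≤ j → volume {x | tj j ≤ u x} ≤ ENNReal.ofReal (16 * π) := fun j hj =>
    level_meas u hu hsub hE (tj j) (tj_pos j hj) (by rw [tj_sq]; exact_mod_cast hj)
  have hfin : ∀ j, 1 ≤ j → volume {x | tj j ≤ u x} ≠ ⊤ := fun j hj =>
    ne_top_of_le_ne_top ENNReal.ofReal_ne_top (hle j hj)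
  have hrsq : ∀ j, π * rad u j ^ 2 = (volume {x | tj j ≤ u x}).toReal := by
    intro j
    unfold rad
    rw [Real.sq_sqrt (by positivity)]
    field_simp
  have hvol : ∀ j, 1 ≤ j → volume {x | tj j ≤ u x} = ENNReal.ofReal (π * rad u j ^ 2) := by
    intro j hj
    rw [hrsq, ENNReal.ofReal_toReal (hfin j hj)]
  have hrpos : ∀ j ∈ S, 0 < rad u j := by
    intro j hj
    apply Real.sqrt_pos.2
    have := ENNReal.toReal_pos (Finset.mem_filter.1 hj).2 (hfin j (hS1 j hj))
    positivity
  have hr4 : ∀ j, 1 ≤ j → rad u j ≤ 4 := by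
    intro j hj
    have h1 := ENNReal.toReal_mono ENNReal.ofReal_ne_top (hle j hj)
    rw [ENNReal.toReal_ofReal (by positivity), ← hrsq] at h1
    have h2 : rad u j ^ 2 ≤ 16 := by nlinarith [pi_pos]
    have h3 : 0 ≤ rad u j := Real.sqrt_nonneg _
    nlinarith
  have hmono : ∀ i j, i < j → 1 ≤ i → rad u j ≤ rad u i := by
    intro i j hij hi
    apply Real.sqrt_le_sqrt
    have : (volume {x | tj j ≤ u x}).toReal ≤ (volume {x | tj i ≤ u x}).toReal :=
      ENNReal.toReal_mono (hfin i hi) (measure_mono fun x hx => (tj_lt i j hij).le.trans hx)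
    gcongr
  have hL0 : ∀ j ∈ S, 0 ≤ L j := by
    intro j hj
    have h1 : 1 ≤ 4 / rad u j := by
      rw [le_div_iff₀ (hrpos j hj)]; linarith [hr4 j (hS1 j hj)]
    have := Real.log_nonneg h1
    simp only [hL]; linarith
  -- capacity from the whole strip
  have hcap0 : ∀ j ∈ S, ENNReal.ofReal j ≤ (∫⁻ y, lay u 0 (tj j) y ^ 2) * ENNReal.ofReal (L j + 10) := by
    intro j hj
    have hj1 := hS1 j hj
    have := iso_cap u hu hs 0 (tj j) le_rfl (tj_pos j hj1) (rad u j) 4 (hrpos j hj) (hr4 j hj1)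
      (hvol j hj1) (by
        intro x hx
        refine le_trans (lintegral_mono_set ?_) (tail_strip x
          (strip_of_pos u hsub x ((tj_pos j hj1).trans_le hx)))
        intro y hy
        exact strip_of_pos u hsub y hy.1)
    rw [sub_zero, tj_sq] at this
    exact this
  have hcap1 : ∀ i ∈ S, ∀ j ∈ S, i < j → ENNReal.ofReal (4 * π * (tj j - tj i) ^ 2) ≤
      (∫⁻ y, lay u (tj i) (tj j) y ^ 2) * ENNReal.ofReal (L j - L i + 10) := by
    intro i hi j hj hij
    have := iso_cap u hu hs (tj i) (tj j) (tj_pos i (hS1 i hi)).le (tj_lt i j hij) (rad u j) (rad u i)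
      (hrpos j hj) (hmono i j hij (hS1 i hi)) (hvol j (hS1 j hj)) (by
        intro x _
        refine tail_fin _ _ (hrpos i hi) ?_ x
        rw [← hvol i (hS1 i hi)]
        exact measure_mono fun y hy => hy.1.le)
    have hLd : L j - L i = 2 * log (rad u i / rad u j) := by
      simp only [hL]
      rw [Real.log_div (by norm_num) (hrpos j hj).ne', Real.log_div (by norm_num) (hrpos i hi).ne',
        Real.log_div (hrpos i hi).ne' (hrpos j hj).ne']
      ring
    rw [hLd]
    exact this
  have hlay : ∀ t1 t2, (∫⁻ y, lay u 0 t1 y ^ 2) + (∫⁻ y, lay u t1 t2 y ^ 2) ≤ 1 :=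
    fun t1 t2 => (energy_split u hu t1 t2).trans hE
  have hG : ∀ j ∈ S, (0:ℝ) ≤ L j + 10 - j := by
    intro j hj
    have he := (self_le_add_right _ _).trans (hlay (tj j) (tj j))
    have h1 := cap_real _ _ _ he (by linarith [hL0 j hj]) (hcap0 j hj)
    have h2 : (∫⁻ y, lay u 0 (tj j) y ^ 2).toReal ≤ 1 := by
      simpa using ENNReal.toReal_mono ENNReal.one_ne_top he
    nlinarith [hL0 j hj]
  have hpair : ∀ i ∈ S, ∀ j ∈ S, i < j → ∀ lam : ℝ, 0 ≤ lam → L i - lam ≤ i → L j - lam ≤ j →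
      (i:ℝ) ≤ 2 * (lam + 10) ∨ (j:ℝ) - i ≤ 21 * (lam + 20) := by
    intro i hi j hj hij lam hlam h3 h4
    have he := hlay (tj i) (tj j)
    have he1 := (self_le_add_right _ _).trans he
    have he2 := (self_le_add_left _ _).trans he
    have hLij : L i ≤ L j := by
      simp only [hL]
      have := hrpos i hi
      have := hrpos j hj
      have := hmono i j hij (hS1 i hi)
      gcongr
    have q1 := cap_real _ _ _ he1 (by linarith [hL0 i hi]) (hcap0 i hi)
    have q2 := cap_real _ _ _ he2 (by linarith) (hcap1 i hi j hj hij)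
    have hesum : (∫⁻ y, lay u 0 (tj i) y ^ 2).toReal + (∫⁻ y, lay u (tj i) (tj j) y ^ 2).toReal ≤ 1 := by
      rw [← ENNReal.toReal_add (ne_top_of_le_ne_top ENNReal.one_ne_top he1)
        (ne_top_of_le_ne_top ENNReal.one_ne_top he2)]
      simpa using ENNReal.toReal_mono ENNReal.one_ne_top he
    have hsq : (√(4 * π)) ^ 2 = 4 * π := Real.sq_sqrt (by positivity)
    have ea : (√(4 * π) * tj i) ^ 2 = i := by rw [mul_pow, hsq, tj_sq]
    have eb : (√(4 * π) * (tj j - tj i)) ^ 2 = 4 * π * (tj j - tj i) ^ 2 := by rw [mul_pow, hsq]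
    have eab : (√(4 * π) * tj i + √(4 * π) * (tj j - tj i)) ^ 2 = j := by
      have : √(4 * π) * tj i + √(4 * π) * (tj j - tj i) = √(4 * π) * tj j := by ring
      rw [this, mul_pow, hsq, tj_sq]
    have := alg_pair (√(4 * π) * tj i) (√(4 * π) * (tj j - tj i)) _ _ (L i) (L j) lam
      ENNReal.toReal_nonneg hesum (hL0 i hi) hLij hlam (by rw [ea]; exact q1) (by rw [eb]; exact q2)
      (by rw [ea]; exact h3) (by rw [eab]; exact h4)
    rwa [ea, eab] at this
  have hfinal := hK S L hG hpair
  have hterm : ∀ j ∈ S, ENNReal.ofReal (exp (j + 1)) * volume {x | tj j ≤ u x} =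
      ENNReal.ofReal (16 * π * exp 11 * exp (-(L j + 10 - j))) := by
    intro j hj
    rw [hvol j (hS1 j hj), ← ENNReal.ofReal_mul (by positivity)]
    congr 1
    have hr := hrpos j hj
    have hexpL : rad u j ^ 2 = 16 * exp (-(L j)) := by
      have : exp (-(L j)) = (rad u j / 4) ^ 2 := by
        have : -(L j) = ((2:ℕ):ℝ) * log (rad u j / 4) := by
          simp only [hL]
          rw [Real.log_div (by norm_num) hr.ne', Real.log_div hr.ne' (by norm_num)]
          push_cast; ring
        rw [this, Real.exp_nat_mul, Real.exp_log (by positivity)]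
      rw [this]; ring
    have h2 : exp (j + 1) * exp (-(L j)) = exp 11 * exp (-(L j + 10 - j)) := by
      rw [← Real.exp_add, ← Real.exp_add]; congr 1; ring
    rw [hexpL]
    linear_combination 16 * π * h2
  calc ∑ j ∈ Finset.Icc 1 N, ENNReal.ofReal (exp (j + 1)) * volume {x | tj j ≤ u x}
      = ∑ j ∈ S, ENNReal.ofReal (exp (j + 1)) * volume {x | tj j ≤ u x} := by
        symm
        apply Finset.sum_subset (Finset.filter_subset _ _)
        intro j hj hjS
        have : volume {x | tj j ≤ u x} = 0 := by
          by_contra h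
          exact hjS (Finset.mem_filter.2 ⟨hj, h⟩)
        rw [this, mul_zero]
    _ = ∑ j ∈ S, ENNReal.ofReal (16 * π * exp 11 * exp (-(L j + 10 - j))) :=
        Finset.sum_congr rfl hterm
    _ = ENNReal.ofReal (∑ j ∈ S, 16 * π * exp 11 * exp (-(L j + 10 - j))) :=
        (ENNReal.ofReal_sum_of_nonneg fun j _ => by positivity).symm
    _ ≤ _ := by
        apply ENNReal.ofReal_le_ofReal
        rw [← Finset.mul_sum]
        gcongr

lemma upper_lintegral : ∃ K : ℝ, 0 ≤ K ∧ ∀ (u : E2 → ℝ), ContDiff ℝ 1 u → HasCompactSupport u → tsupport u ⊆ strip →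
    ∫⁻ x, ENNReal.ofReal ‖fderiv ℝ u x‖ ^ 2 ≤ 1 →
    ∫⁻ x, ENNReal.ofReal (exp (4 * π * u x ^ 2) - 1) ≤ ENNReal.ofReal K := by
  obtain ⟨K, hK0, hK⟩ := upper_sum
  refine ⟨32 * π + (K + K), by positivity, ?_⟩
  intro u hu hs hsub hE
  have hc := hu.continuous
  obtain ⟨M, hM⟩ := hs.exists_bound_of_continuous hc
  obtain ⟨N, hN⟩ := exists_nat_gt (4 * π * M ^ 2)
  have h1 := hK u hu hs hsub hE N
  have hneg : (fun x => -u x) = -u := rfl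
  have h2 := hK (fun x => - u x) hu.neg (by rw [hneg]; exact hs.neg)
    (by rw [hneg]; rwa [tsupport, Function.support_neg]) (by
      simpa [fderiv_fun_neg] using hE) N
  have hmeas : ∀ (v : E2 → ℝ) (j : ℕ), Continuous v → MeasurableSet {x | tj j ≤ v x} := fun v j hv =>
    (isClosed_le continuous_const hv).measurableSet
  have hW : ∀ v : E2 → ℝ, Continuous v → ∫⁻ x, ∑ j ∈ Finset.Icc 1 N,
      {x | tj j ≤ v x}.indicator (fun _ => ENNReal.ofReal (exp (j + 1))) x =
      ∑ j ∈ Finset.Icc 1 N, ENNReal.ofReal (exp (j + 1)) * volume {x | tj j ≤ v x} := by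
    intro v hv
    rw [lintegral_finsetSum _ fun j _ => measurable_const.indicator (hmeas v j hv)]
    refine Finset.sum_congr rfl fun j _ => ?_
    rw [lintegral_indicator (hmeas v j hv), setLIntegral_const]
  have hWm : ∀ v : E2 → ℝ, Continuous v → Measurable fun x => ∑ j ∈ Finset.Icc 1 N,
      {x | tj j ≤ v x}.indicator (fun _ => ENNReal.ofReal (exp (j + 1))) x := by
    intro v hv
    exact Finset.measurable_sum _ fun j _ => measurable_const.indicator (hmeas v j hv)
  have hbig : ∀ (v : E2 → ℝ) (x : E2), v x ^ 2 = u x ^ 2 → 0 ≤ v x → 1 ≤ 4 * π * u x ^ 2 →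
      ENNReal.ofReal (exp (4 * π * u x ^ 2) - 1) ≤ ∑ j ∈ Finset.Icc 1 N,
      {x | tj j ≤ v x}.indicator (fun _ => ENNReal.ofReal (exp (j + 1))) x := by
    intro v x hv hv0 hx
    set j := ⌊4 * π * u x ^ 2⌋₊ with hj
    have hj1 : 1 ≤ j := Nat.le_floor (by exact_mod_cast hx)
    have hjle : (j:ℝ) ≤ 4 * π * u x ^ 2 := Nat.floor_le (by positivity)
    have hjlt : 4 * π * u x ^ 2 < j + 1 := Nat.lt_floor_add_one _
    have hjN : j ≤ N := by
      have : u x ^ 2 ≤ M ^ 2 := by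
        have := hM x
        rw [← sq_abs (u x)]
        exact pow_le_pow_left₀ (abs_nonneg _) this 2
      have : (j:ℝ) ≤ N := by nlinarith [pi_pos]
      exact_mod_cast this
    have hmem : x ∈ {x | tj j ≤ v x} := by
      have h3 : tj j ^ 2 ≤ v x ^ 2 := by
        rw [hv]
        have := tj_sq j
        have hp := pi_pos
        by_contra hcon
        push Not at hcon
        nlinarith
      exact abs_le_of_sq_le_sq' h3 hv0 |>.2
    calc ENNReal.ofReal (exp (4 * π * u x ^ 2) - 1) ≤ ENNReal.ofReal (exp (j + 1)) := by
          apply ENNReal.ofReal_le_ofReal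
          have := Real.exp_le_exp.2 hjlt.le
          linarith
      _ = {x | tj j ≤ v x}.indicator (fun _ => ENNReal.ofReal (exp (j + 1))) x := by
          rw [Set.indicator_of_mem hmem]
      _ ≤ _ := Finset.single_le_sum
          (f := fun j : ℕ => {x | tj j ≤ v x}.indicator (fun _ => ENNReal.ofReal (exp ((j:ℝ) + 1))) x)
          (fun _ _ => zero_le) (Finset.mem_Icc.2 ⟨hj1, hjN⟩)
  have hpt : ∀ x, ENNReal.ofReal (exp (4 * π * u x ^ 2) - 1) ≤
      ENNReal.ofReal (8 * π) * ENNReal.ofReal (u x ^ 2) + ((∑ j ∈ Finset.Icc 1 N,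
      {x | tj j ≤ u x}.indicator (fun _ => ENNReal.ofReal (exp (j + 1))) x) + ∑ j ∈ Finset.Icc 1 N,
      {x | tj j ≤ - u x}.indicator (fun _ => ENNReal.ofReal (exp (j + 1))) x) := by
    intro x
    by_cases hx : 1 ≤ 4 * π * u x ^ 2
    · rcases le_total 0 (u x) with h0 | h0
      · exact (hbig u x rfl h0 hx).trans (le_self_add.trans le_add_self)
      · exact (hbig (fun x => - u x) x (by ring) (by linarith) hx).trans (le_add_self.trans le_add_self)
    · refine le_trans ?_ le_self_add
      rw [← ENNReal.ofReal_mul (by positivity)]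
      apply ENNReal.ofReal_le_ofReal
      have hz0 : 0 ≤ 4 * π * u x ^ 2 := by positivity
      have := Real.abs_exp_sub_one_le (x := 4 * π * u x ^ 2) (by rw [abs_of_nonneg hz0]; linarith)
      rw [abs_of_nonneg hz0] at this
      have := le_abs_self (exp (4 * π * u x ^ 2) - 1)
      linarith
  calc ∫⁻ x, ENNReal.ofReal (exp (4 * π * u x ^ 2) - 1) ≤ _ := lintegral_mono hpt
    _ = ENNReal.ofReal (8 * π) * (∫⁻ x, ENNReal.ofReal (u x ^ 2)) + ((∑ j ∈ Finset.Icc 1 N, ENNReal.ofReal (exp (j + 1)) * volume {x | tj j ≤ u x}) +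
        ∑ j ∈ Finset.Icc 1 N, ENNReal.ofReal (exp (j + 1)) * volume {x | tj j ≤ - u x}) := by
        rw [lintegral_add_left (by fun_prop), lintegral_const_mul _ (by fun_prop),
          lintegral_add_left (hWm u hc), hW u hc, hW (fun x => - u x) hc.neg]
    _ ≤ ENNReal.ofReal (8 * π) * 4 + (ENNReal.ofReal K + ENNReal.ofReal K) := by
        gcongr
        calc _ ≤ _ := poincare u hu hsub
          _ ≤ 4 * 1 := by gcongr
          _ = 4 := mul_one _
    _ = _ := by
        rw [← ENNReal.ofReal_ofNat 4, ← ENNReal.ofReal_mul (by positivity), 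
          ← ENNReal.ofReal_add hK0 hK0, ← ENNReal.ofReal_add (by positivity) (by positivity)]
        congr 1; ring

lemma energy_conv (u : E2 → ℝ) (hu : ContDiff ℝ 1 u) (hs : HasCompactSupport u) (hsub : tsupport u ⊆ strip) :
    ENNReal.ofReal (∫ x in strip, ‖fderiv ℝ u x‖ ^ 2) = ∫⁻ x, ENNReal.ofReal ‖fderiv ℝ u x‖ ^ 2 := by
  have hfc : Continuous (fderiv ℝ u) := hu.continuous_fderiv (by simp)
  have hcs := hs.fderiv (𝕜 := ℝ)
  have hcs2 : HasCompactSupport (fun x => ‖fderiv ℝ u x‖ ^ 2) :=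
    hcs.comp_left (g := fun y => ‖y‖ ^ 2) (by simp)
  have hintg : Integrable (fun x => ‖fderiv ℝ u x‖ ^ 2) :=
    (hfc.norm.pow 2).integrable_of_hasCompactSupport hcs2
  rw [setIntegral_eq_integral_of_forall_compl_eq_zero, ofReal_integral_eq_lintegral_ofReal hintg
    (Filter.Eventually.of_forall fun _ => by positivity)]
  · simp_rw [ENNReal.ofReal_pow (norm_nonneg _)]
  · intro x hx
    have : fderiv ℝ u x = 0 := by
      by_contra h
      exact hx (hsub (support_fderiv_subset ℝ h))
    rw [this]; simp

theorem strip_bddAbove : BddAbove {r : ℝ | ∃ u : EuclideanSpace ℝ (Fin 2) → ℝ, IsTest strip u ∧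
        (∫ x in strip, ‖fderiv ℝ u x‖ ^ 2) ≤ 1 ∧
        r = ∫ x in strip, (Real.exp (4 * Real.pi * u x ^ 2) - 1)} := by
  obtain ⟨K, hK0, hK⟩ := upper_lintegral
  refine ⟨K, ?_⟩
  rintro r ⟨u, ⟨hu, hs, hsub⟩, hE, rfl⟩
  have hu1 : ContDiff ℝ 1 u := hu.of_le (by exact_mod_cast le_top)
  have hE' : ∫⁻ x, ENNReal.ofReal ‖fderiv ℝ u x‖ ^ 2 ≤ 1 := by
    rw [← energy_conv u hu1 hs hsub]
    simpa using ENNReal.ofReal_le_ofReal hE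
  have h := hK u hu1 hs hsub hE'
  have hc := hu1.continuous
  have hnn : ∀ x, 0 ≤ exp (4 * π * u x ^ 2) - 1 := fun x => by
    have := Real.one_le_exp (x := 4 * π * u x ^ 2) (by positivity)
    linarith
  rw [integral_eq_lintegral_of_nonneg_ae (Filter.Eventually.of_forall hnn) (by fun_prop)]
  refine ENNReal.toReal_le_of_le_ofReal hK0 ?_
  exact (setLIntegral_le_lintegral _ _).trans h

lemma S_deriv_zero (w : ℝ) (hw : w ≤ 0 ∨ 1 ≤ w) : deriv smoothTransition w = 0 := by
  rcases hw with h | h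
  · apply IsLocalMin.deriv_eq_zero
    refine Filter.Eventually.of_forall fun x => ?_
    rw [smoothTransition.zero_of_nonpos h]; exact smoothTransition.nonneg x
  · apply IsLocalMax.deriv_eq_zero
    refine Filter.Eventually.of_forall fun x => ?_
    rw [smoothTransition.one_of_one_le h]; exact smoothTransition.le_one x

lemma S_deriv_cont : Continuous (deriv smoothTransition) :=
  (smoothTransition.contDiff (n := 1)).continuous_deriv le_rfl

lemma S_deriv_bound : ∃ M : ℝ, 0 ≤ M ∧ ∀ w, |deriv smoothTransition w| ≤ M := by
  obtain ⟨M, hM⟩ := isCompact_Icc.exists_bound_of_continuousOn (s := Set.Icc (0:ℝ) 1)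
    S_deriv_cont.continuousOn
  refine ⟨M, (norm_nonneg _).trans (hM 0 (by simp)), fun w => ?_⟩
  by_cases h : w ∈ Set.Icc (0:ℝ) 1
  · exact hM w h
  · rw [S_deriv_zero w, abs_zero]
    · exact (norm_nonneg _).trans (hM 0 (by simp))
    · by_contra hc
      push Not at hc
      exact h ⟨hc.1.le, hc.2.le⟩

lemma cos_bd (y : ℝ) (hy : |y| ≤ 1) : |cos (π * y / 2)| ≤ π / 2 * (1 - y ^ 2) := by
  have hp := pi_pos
  have h1 : cos (π * y / 2) = sin (π / 2 * (1 - |y|)) := by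
    have : π / 2 * (1 - |y|) = π / 2 - |π * y / 2| := by
      rw [abs_div, abs_mul, abs_of_pos hp]; norm_num; ring
    rw [this, sin_pi_div_two_sub, cos_abs]
  have h0 : 0 ≤ π / 2 * (1 - |y|) := mul_nonneg (by positivity) (by linarith)
  rw [h1, abs_of_nonneg (sin_nonneg_of_nonneg_of_le_pi h0 (by nlinarith [abs_nonneg y]))]
  refine (sin_le h0).trans ?_
  have : y ^ 2 ≤ |y| := by rw [← sq_abs]; nlinarith [abs_nonneg y]
  gcongr

lemma psi_exists (ε : ℝ) (hε : 0 < ε) : ∃ (ψ : ℝ → ℝ) (δ : ℝ), 0 < δ ∧ ContDiff ℝ (⊤ : ℕ∞) ψ ∧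
    (∀ y, ψ y ≠ 0 → δ ≤ 1 - y ^ 2) ∧
    (∫ y, deriv ψ y ^ 2) ≤ π ^ 2 / 4 * (∫ y, ψ y ^ 2) + ε ∧ 1 / 2 ≤ (∫ y, ψ y ^ 2) ∧ (∫ y, ψ y ^ 2) ≤ 2 ∧
    1 / 4 ≤ ∫ y, ψ y ^ 4 := by
  obtain ⟨M, hM0, hM⟩ := S_deriv_bound
  obtain ⟨δ, hδ, hδ4, hδε⟩ : ∃ δ : ℝ, 0 < δ ∧ δ ≤ 1 / 4 ∧ 16 * π ^ 2 * M ^ 2 * δ ≤ ε := by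
    refine ⟨min (1 / 4) (ε / (16 * π ^ 2 * M ^ 2 + 1)), by positivity, min_le_left _ _, ?_⟩
    calc 16 * π ^ 2 * M ^ 2 * min (1 / 4) (ε / (16 * π ^ 2 * M ^ 2 + 1))
        ≤ (16 * π ^ 2 * M ^ 2 + 1) * (ε / (16 * π ^ 2 * M ^ 2 + 1)) := by
          gcongr
          · linarith
          · exact min_le_right _ _
      _ = ε := by field_simp
  set w : ℝ → ℝ := fun y => (1 - y ^ 2) / δ - 1 with hw
  set η : ℝ → ℝ := fun y => smoothTransition (w y) with hη
  set c : ℝ → ℝ := fun y => cos (π * y / 2) with hc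
  set ψ : ℝ → ℝ := fun y => c y * η y with hψ
  have hwd : ContDiff ℝ (⊤ : ℕ∞) w := by fun_prop
  have hηd : ContDiff ℝ (⊤ : ℕ∞) η := smoothTransition.contDiff.comp hwd
  have hcd : ContDiff ℝ (⊤ : ℕ∞) c := by
    have : ContDiff ℝ (⊤ : ℕ∞) (fun y : ℝ => π * y / 2) := by fun_prop
    exact contDiff_cos.comp this
  have hψd : ContDiff ℝ (⊤ : ℕ∞) ψ := hcd.mul hηd
  have hψc : Continuous ψ := hψd.continuous
  have hsupp : ∀ y, ψ y ≠ 0 → δ ≤ 1 - y ^ 2 := by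
    intro y hy
    by_contra h
    push Not at h
    apply hy
    have : w y ≤ 0 := by
      simp only [hw]; rw [sub_nonpos, div_le_one hδ]; exact h.le
    simp only [hψ, hη]
    rw [smoothTransition.zero_of_nonpos this, mul_zero]
  have htsupp : tsupport ψ ⊆ {y | δ ≤ 1 - y ^ 2} :=
    closure_minimal (fun y hy => hsupp y hy) (isClosed_le continuous_const (by fun_prop))
  have hIoc : {y : ℝ | δ ≤ 1 - y ^ 2} ⊆ Set.Ioc (-1) 1 := by
    intro y hy
    have hy' : δ ≤ 1 - y ^ 2 := hy
    constructor <;> nlinarith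
  -- derivatives
  have hwD : ∀ y, HasDerivAt w (-2 * y / δ) y := by
    intro y
    have := (((hasDerivAt_pow 2 y).const_sub 1).div_const δ).sub_const 1
    have h2 : HasDerivAt w (-(((2:ℕ):ℝ) * y ^ (2 - 1)) / δ) y := this
    exact h2.congr_deriv (by norm_num)
  have hηD : ∀ y, HasDerivAt η (deriv smoothTransition (w y) * (-2 * y / δ)) y := by
    intro y
    have hS : HasDerivAt smoothTransition (deriv smoothTransition (w y)) (w y) :=
      ((smoothTransition.contDiff (n := 1)).differentiable (by simp)).differentiableAt.hasDerivAt
    exact hS.comp y (hwD y)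
  have hcD : ∀ y, HasDerivAt c (-sin (π * y / 2) * (π / 2)) y := by
    intro y
    have h1 : HasDerivAt (fun y : ℝ => π * y / 2) (π / 2) y := by
      simpa using ((hasDerivAt_id y).const_mul π).div_const 2
    exact (hasDerivAt_cos (π * y / 2)).comp y h1
  set c' : ℝ → ℝ := fun y => -sin (π * y / 2) * (π / 2) with hc'
  set η' : ℝ → ℝ := fun y => deriv smoothTransition (w y) * (-2 * y / δ) with hη'
  have hc'D : ∀ y, HasDerivAt c' (-(π ^ 2 / 4) * c y) y := by
    intro y
    have h1 : HasDerivAt (fun y : ℝ => π * y / 2) (π / 2) y := by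
      simpa using ((hasDerivAt_id y).const_mul π).div_const 2
    have := (((hasDerivAt_sin (π * y / 2)).comp y h1).neg).mul_const (π / 2)
    have h2 : HasDerivAt c' (-(cos (π * y / 2) * (π / 2)) * (π / 2)) y := this
    refine h2.congr_deriv ?_
    have h3 : c y = cos (π * y / 2) := rfl
    rw [h3]; ring
  have hc'c : Continuous c' := continuous_iff_continuousAt.2 fun y => (hc'D y).continuousAt
  have hcc : Continuous c := hcd.continuous
  have hηc : Continuous η := hηd.continuous
  have hη'c : Continuous η' := by
    have := S_deriv_cont.comp hwd.continuous
    exact this.mul (by fun_prop)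
  have hψD : ∀ y, HasDerivAt ψ (c' y * η y + c y * η' y) y := fun y => (hcD y).mul (hηD y)
  have hψ' : deriv ψ = fun y => c' y * η y + c y * η' y := funext fun y => (hψD y).deriv
  -- integrals as interval integrals
  have hI2 : ∫ y in (-1:ℝ)..1, ψ y ^ 2 = ∫ y, ψ y ^ 2 := by
    apply intervalIntegral.integral_eq_integral_of_support_subset
    intro y hy
    exact hIoc (hsupp y (by intro h; apply hy; simp [h]))
  have hI4 : ∫ y in (-1:ℝ)..1, ψ y ^ 4 = ∫ y, ψ y ^ 4 := by
    apply intervalIntegral.integral_eq_integral_of_support_subset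
    intro y hy
    exact hIoc (hsupp y (by intro h; apply hy; simp [h]))
  have hID : ∫ y in (-1:ℝ)..1, deriv ψ y ^ 2 = ∫ y, deriv ψ y ^ 2 := by
    apply intervalIntegral.integral_eq_integral_of_support_subset
    intro y hy
    have : deriv ψ y ≠ 0 := by intro h; apply hy; simp [h]
    exact hIoc (htsupp (support_deriv_subset this))
  have hη1 : η 1 = 0 := by
    simp only [hη]; apply smoothTransition.zero_of_nonpos; simp [hw]
  have hηm1 : η (-1) = 0 := by
    simp only [hη]; apply smoothTransition.zero_of_nonpos; simp [hw]
  have hP : ∀ y, HasDerivAt (fun y => c y * c' y * η y ^ 2)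
      (deriv ψ y ^ 2 - π ^ 2 / 4 * ψ y ^ 2 - c y ^ 2 * η' y ^ 2) y := by
    intro y
    have h1 := ((hcD y).mul (hc'D y)).mul ((hηD y).pow 2)
    refine (h1.congr_deriv ?_)
    rw [hψ']
    simp only [hψ, Pi.mul_apply, Pi.pow_apply]
    simp only [hc', hη']
    push_cast
    ring
  have hψ'c : Continuous (deriv ψ) := by rw [hψ']; fun_prop
  have hftc := intervalIntegral.integral_eq_sub_of_hasDerivAt (a := -1) (b := 1) (fun y _ => hP y)
    (Continuous.intervalIntegrable (by fun_prop) _ _)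
  rw [intervalIntegral.integral_sub, intervalIntegral.integral_sub, intervalIntegral.integral_const_mul,
    hη1, hηm1, hI2, hID] at hftc
  rotate_left
  · exact Continuous.intervalIntegrable (by fun_prop) _ _
  · exact Continuous.intervalIntegrable (by fun_prop) _ _
  · exact Continuous.intervalIntegrable (by fun_prop) _ _
  · exact Continuous.intervalIntegrable (by fun_prop) _ _
  have hbound : ∀ y, |y| ≤ 1 → ‖c y ^ 2 * η' y ^ 2‖ ≤ 4 * π ^ 2 * M ^ 2 := by
    intro y hy
    rw [Real.norm_of_nonneg (by positivity)]
    by_cases hwy : w y ≤ 1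
    · have h1 : 1 - y ^ 2 ≤ 2 * δ := by
        simp only [hw] at hwy
        have : (1 - y ^ 2) / δ ≤ 2 := by linarith
        rwa [div_le_iff₀ hδ] at this
      have h2 : |c y| ≤ π * δ := by
        refine (cos_bd y hy).trans ?_
        nlinarith [pi_pos]
      have h3 : |η' y| ≤ M * (2 / δ) := by
        simp only [hη']
        rw [abs_mul]
        gcongr
        · exact hM _
        · rw [abs_div, abs_mul, abs_of_pos hδ]
          gcongr
          norm_num; linarith
      rw [← sq_abs (c y), ← sq_abs (η' y)]
      calc |c y| ^ 2 * |η' y| ^ 2 ≤ (π * δ) ^ 2 * (M * (2 / δ)) ^ 2 := by gcongr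
        _ = 4 * π ^ 2 * M ^ 2 := by field_simp; ring
    · have : η' y = 0 := by
        simp only [hη']; rw [S_deriv_zero _ (Or.inr (not_le.1 hwy).le), zero_mul]
      rw [this]; simp; positivity
  have hgc : Continuous fun y => c y ^ 2 * η' y ^ 2 := by fun_prop
  have hsplit : ∫ y in (-1:ℝ)..1, c y ^ 2 * η' y ^ 2 ≤ 16 * π ^ 2 * M ^ 2 * δ := by
    have i1 := hgc.intervalIntegrable (μ := volume) (-1) (-1 + 2 * δ)
    have i2 := hgc.intervalIntegrable (μ := volume) (-1 + 2 * δ) (1 - 2 * δ)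
    have i3 := hgc.intervalIntegrable (μ := volume) (1 - 2 * δ) 1
    rw [← intervalIntegral.integral_add_adjacent_intervals (i1.trans i2) i3,
      ← intervalIntegral.integral_add_adjacent_intervals i1 i2]
    have b1 : ‖∫ y in (-1)..(-1 + 2 * δ), c y ^ 2 * η' y ^ 2‖ ≤ 4 * π ^ 2 * M ^ 2 * |(-1 + 2 * δ) - (-1)| := by
      apply intervalIntegral.norm_integral_le_of_norm_le_const
      intro y hy
      rw [Set.uIoc_of_le (by linarith)] at hy
      exact hbound y (abs_le.2 ⟨hy.1.le, by linarith [hy.2]⟩)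
    have b3 : ‖∫ y in (1 - 2 * δ)..1, c y ^ 2 * η' y ^ 2‖ ≤ 4 * π ^ 2 * M ^ 2 * |1 - (1 - 2 * δ)| := by
      apply intervalIntegral.norm_integral_le_of_norm_le_const
      intro y hy
      rw [Set.uIoc_of_le (by linarith)] at hy
      exact hbound y (abs_le.2 ⟨by linarith [hy.1], hy.2⟩)
    have b2 : ‖∫ y in (-1 + 2 * δ)..(1 - 2 * δ), c y ^ 2 * η' y ^ 2‖ ≤ 0 * |(1 - 2 * δ) - (-1 + 2 * δ)| := by
      apply intervalIntegral.norm_integral_le_of_norm_le_const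
      intro y hy
      rw [Set.uIoc_of_le (by linarith)] at hy
      have : η' y = 0 := by
        simp only [hη']
        rw [S_deriv_zero _ (Or.inr _), zero_mul]
        simp only [hw]
        rw [le_sub_iff_add_le, le_div_iff₀ hδ]
        nlinarith [hy.1, hy.2]
      rw [this]; simp
    have e1 : |(-1 + 2 * δ) - (-1)| = 2 * δ := by
      rw [show (-1 + 2 * δ) - (-1) = 2 * δ by ring, abs_of_pos (by positivity)]
    have e3 : |1 - (1 - 2 * δ)| = 2 * δ := by
      rw [show 1 - (1 - 2 * δ) = 2 * δ by ring, abs_of_pos (by positivity)]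
    rw [e1] at b1
    rw [e3] at b3
    rw [zero_mul] at b2
    have := (Real.le_norm_self _).trans b1
    have := (Real.le_norm_self _).trans b2
    have := (Real.le_norm_self _).trans b3
    linarith
  have hhalf : ∀ y ∈ Set.Icc (-(1/2):ℝ) (1/2), 1 / 2 ≤ ψ y ^ 2 := by
    intro y hy
    have hη1 : η y = 1 := by
      simp only [hη]; apply smoothTransition.one_of_one_le
      simp only [hw]
      rw [le_sub_iff_add_le, le_div_iff₀ hδ]
      nlinarith [hy.1, hy.2]
    simp only [hψ, hη1, mul_one, hc]
    rw [Real.cos_sq]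
    have : 0 ≤ cos (2 * (π * y / 2)) := by
      apply cos_nonneg_of_neg_pi_div_two_le_of_le <;> nlinarith [hy.1, hy.2, pi_pos]
    linarith
  have hle1 : ∀ y, ψ y ^ 2 ≤ 1 := by
    intro y
    have h1 : |ψ y| ≤ 1 := by
      simp only [hψ, hη, hc]
      rw [abs_mul, abs_of_nonneg (smoothTransition.nonneg _)]
      exact mul_le_one₀ (abs_cos_le_one _) (smoothTransition.nonneg _) (smoothTransition.le_one _)
    rw [← sq_abs]
    exact pow_le_one₀ (abs_nonneg _) h1
  have hlow : ∀ (g : ℝ → ℝ) (k : ℝ), Continuous g → (∀ y, 0 ≤ g y) →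
      (∀ y ∈ Set.Icc (-(1/2):ℝ) (1/2), k ≤ g y) → k ≤ ∫ y in (-1:ℝ)..1, g y := by
    intro g k hg h0 hk
    have h1 : ∫ y in (-(1/2):ℝ)..(1/2), k ≤ ∫ y in (-(1/2):ℝ)..(1/2), g y :=
      intervalIntegral.integral_mono_on (by norm_num) (by simp) (hg.intervalIntegrable _ _) hk
    have h2 : ∫ y in (-(1/2):ℝ)..(1/2), g y ≤ ∫ y in (-1:ℝ)..1, g y :=
      intervalIntegral.integral_mono_interval (by norm_num) (by norm_num) (by norm_num)
        (Filter.Eventually.of_forall h0) (hg.intervalIntegrable _ _)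
    rw [intervalIntegral.integral_const] at h1
    norm_num at h1
    linarith
  refine ⟨ψ, δ, hδ, hψd, hsupp, ?_, ?_, ?_, ?_⟩
  · simp only [ne_eq, OfNat.ofNat_ne_zero, not_false_eq_true, zero_pow, mul_zero, sub_zero] at hftc
    linarith
  · rw [← hI2]
    exact hlow _ _ (by fun_prop) (fun y => by positivity) hhalf
  · rw [← hI2]
    have := intervalIntegral.integral_mono_on (μ := volume) (a := -1) (b := 1) (f := fun y => ψ y ^ 2) (g := fun _ => (1:ℝ)) (by norm_num)
      (Continuous.intervalIntegrable (by fun_prop) _ _) (by simp) (fun y _ => hle1 y)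
    rw [intervalIntegral.integral_const] at this
    norm_num at this
    linarith
  · rw [← hI4]
    refine hlow _ _ (by fun_prop) (fun y => by positivity) fun y hy => ?_
    have := hhalf y hy
    nlinarith

lemma prod_int (f g : ℝ → ℝ) (hf : Integrable f) (hg : Integrable g) :
    Integrable (fun x : E2 => f (x 0) * g (x 1)) ∧
      ∫ x : E2, f (x 0) * g (x 1) = (∫ s, f s) * ∫ t, g t := by
  have h1 := (EuclideanSpace.volume_preserving_symm_measurableEquiv_toLp (Fin 2))
  have h2 := (volume_preserving_finTwoArrow ℝ)
  have h3 := h2.comp h1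
  have hemb : MeasurableEmbedding ((MeasurableEquiv.finTwoArrow : (Fin 2 → ℝ) ≃ᵐ ℝ × ℝ) ∘
      (MeasurableEquiv.toLp 2 (Fin 2 → ℝ)).symm) :=
    (MeasurableEquiv.measurableEmbedding _).comp (MeasurableEquiv.measurableEmbedding _)
  constructor
  · have hp : Integrable (fun z : ℝ × ℝ => f z.1 * g z.2) := hf.mul_prod hg
    exact (h3.integrable_comp_emb hemb).2 hp
  · have := h3.integral_comp hemb (fun z : ℝ × ℝ => f z.1 * g z.2)
    rw [Measure.volume_eq_prod, integral_prod_mul] at this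
    exact this

lemma fderiv_bd (k a : ℝ) (φ ψ : ℝ → ℝ) (hφ : Differentiable ℝ φ) (hψ : Differentiable ℝ ψ) (x : E2) :
    ‖fderiv ℝ (fun x : E2 => a * (φ (x 0 / k) * ψ (x 1))) x‖ ^ 2 ≤
      a ^ 2 * ((k⁻¹ ^ 2 * deriv φ (x 0 / k) ^ 2) * ψ (x 1) ^ 2
        + φ (x 0 / k) ^ 2 * deriv ψ (x 1) ^ 2) := by
  have p0 : HasFDerivAt (fun x : E2 => x 0) (EuclideanSpace.proj 0 : E2 →L[ℝ] ℝ) x :=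
    (EuclideanSpace.proj 0 : E2 →L[ℝ] ℝ).hasFDerivAt
  have p1 : HasFDerivAt (fun x : E2 => x 1) (EuclideanSpace.proj 1 : E2 →L[ℝ] ℝ) x :=
    (EuclideanSpace.proj 1 : E2 →L[ℝ] ℝ).hasFDerivAt
  have dφ : HasDerivAt (fun s => φ (s / k)) (deriv φ (x 0 / k) * (1 / k)) (x 0) :=
    HasDerivAt.comp (h₂ := φ) (x 0) (hφ (x 0 / k)).hasDerivAt ((hasDerivAt_id (x 0)).div_const k)
  have f0 := dφ.comp_hasFDerivAt x p0
  have f1 := (hψ (x 1)).hasDerivAt.comp_hasFDerivAt x p1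
  have f2 := (f0.mul f1).const_mul a
  have e : fderiv ℝ (fun x : E2 => a * (φ (x 0 / k) * ψ (x 1))) x = _ := f2.fderiv
  rw [e]
  set A := a * (φ (x 0 / k) * deriv ψ (x 1)) with hA
  set B := a * (ψ (x 1) * (deriv φ (x 0 / k) * k⁻¹)) with hB
  have hn : ‖fderiv ℝ (fun x : E2 => a * (φ (x 0 / k) * ψ (x 1))) x‖ ≤ √(A ^ 2 + B ^ 2) := by
    apply ContinuousLinearMap.opNorm_le_bound _ (Real.sqrt_nonneg _)
    intro v
    rw [e]
    have hv : ‖v‖ = √(v 0 ^ 2 + v 1 ^ 2) := by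
      rw [EuclideanSpace.norm_eq]; simp
    rw [hv, ← Real.sqrt_mul (by positivity), Real.norm_eq_abs]
    apply Real.abs_le_sqrt
    have : (∀ w z : ℝ, (A * w + B * z) ^ 2 ≤ (A ^ 2 + B ^ 2) * (z ^ 2 + w ^ 2)) := by
      intro w z; nlinarith [sq_nonneg (A * z - B * w)]
    refine le_trans (le_of_eq ?_) (this (v 1) (v 0))
    congr 1
    simp [hA, hB]
    ring
  rw [e] at hn
  calc _ ≤ (√(A ^ 2 + B ^ 2)) ^ 2 := by gcongr
    _ = A ^ 2 + B ^ 2 := Real.sq_sqrt (by positivity)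
    _ = _ := by simp only [hA, hB]; ring

lemma final_alg (k a q F2 F2' F4 A A4 : ℝ) (hk : 1 ≤ k) (hF2 : 0 < F2) (hF2' : 0 ≤ F2') (hF4 : 0 < F4)
    (hA : 1 / 2 ≤ A) (hA2 : A ≤ 2) (hA4 : 1 / 4 ≤ A4)
    (hq : q = F2' * A / k + k * F2 * (π ^ 2 / 4 * A + 1 / k ^ 2)) (haq : a ^ 2 * q = 1) (hq0 : 0 < q)
    (hkk : (2 * F2' + F2 * (π ^ 2 / 2 + 1)) * (16 / π) * (2 * F2' + F2) < 2 * π ^ 2 * F4 * k) :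
    16 / π < 4 * π * (a ^ 2 * (k * F2 * A)) + 8 * π ^ 2 * (a ^ 4 * (k * F4 * A4)) := by
  have hk0 : 0 < k := by linarith
  have ha : a ^ 2 = 1 / q := by field_simp; linarith
  have ha4 : a ^ 4 = 1 / q ^ 2 := by rw [show a ^ 4 = (a ^ 2) ^ 2 by ring, ha]; ring
  have hπ := pi_pos
  set R := F2' * A + F2 with hR
  have hR1 : R ≤ 2 * F2' + F2 := by nlinarith
  have hR0 : 0 < R := by nlinarith
  have hqR : 4 * π * (k * F2 * A) = 16 / π * (q - R / k) := by
    rw [hq, hR]; field_simp; ring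
  have hqk : q ≤ k * (2 * F2' + F2 * (π ^ 2 / 2 + 1)) := by
    rw [hq]
    have h1 : F2' * A / k ≤ k * (2 * F2') := by
      rw [div_le_iff₀ hk0]
      have : F2' * A ≤ F2' * 2 := by gcongr
      nlinarith [mul_nonneg hF2' (show 0 ≤ k * k - 1 by nlinarith)]
    have h2 : 1 / k ^ 2 ≤ 1 := by rw [div_le_one (by positivity)]; nlinarith
    have h3 : π ^ 2 / 4 * A + 1 / k ^ 2 ≤ π ^ 2 / 2 + 1 := by nlinarith [sq_nonneg π]
    have h4 : k * F2 * (π ^ 2 / 4 * A + 1 / k ^ 2) ≤ k * F2 * (π ^ 2 / 2 + 1) := by gcongr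
    linarith
  have key : q * (16 / π) * (R / k) < 8 * π ^ 2 * (k * F4 * A4) := by
    have h1 : q * (16 / π) * (R / k) ≤ (2 * F2' + F2 * (π ^ 2 / 2 + 1)) * (16 / π) * (2 * F2' + F2) := by
      calc q * (16 / π) * (R / k) ≤ (k * (2 * F2' + F2 * (π ^ 2 / 2 + 1))) * (16 / π) * (R / k) := by gcongr
        _ = (2 * F2' + F2 * (π ^ 2 / 2 + 1)) * (16 / π) * R := by field_simp
        _ ≤ _ := by gcongr
    have h2 : 2 * π ^ 2 * F4 * k ≤ 8 * π ^ 2 * (k * F4 * A4) := by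
      have : 2 * π ^ 2 * F4 * k = 8 * π ^ 2 * (k * F4 * (1 / 4)) := by ring
      rw [this]; gcongr
    linarith
  have h5 : 4 * π * (a ^ 2 * (k * F2 * A)) = 16 / π - 16 / π * (R / k) / q := by
    have : 4 * π * (a ^ 2 * (k * F2 * A)) = a ^ 2 * (4 * π * (k * F2 * A)) := by ring
    rw [this, hqR, ha]; field_simp
  have h6 : 8 * π ^ 2 * (a ^ 4 * (k * F4 * A4)) = 8 * π ^ 2 * (k * F4 * A4) / q ^ 2 := by
    rw [ha4]; ring
  have h7 : 16 / π * (R / k) / q < 8 * π ^ 2 * (k * F4 * A4) / q ^ 2 := by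
    rw [lt_div_iff₀ (by positivity)]
    have : 16 / π * (R / k) / q * q ^ 2 = q * (16 / π) * (R / k) := by field_simp
    rw [this]; exact key
  rw [h5, h6]; linarith

theorem strip_lower : ∃ u : EuclideanSpace ℝ (Fin 2) → ℝ, IsTest strip u ∧
        (∫ x in strip, ‖fderiv ℝ u x‖ ^ 2) ≤ 1 ∧
        16 / π < ∫ x in strip, (Real.exp (4 * Real.pi * u x ^ 2) - 1) := by
  -- longitudinal profile
  obtain ⟨φ, hφd, hφc, hφ0⟩ : ∃ φ : ℝ → ℝ, ContDiff ℝ (⊤ : ℕ∞) φ ∧ HasCompactSupport φ ∧ φ 0 ≠ 0 := by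
    let b : ContDiffBump (0 : ℝ) := ⟨1, 2, one_pos, one_lt_two⟩
    refine ⟨b, b.contDiff, b.hasCompactSupport, ?_⟩
    rw [b.one_of_mem_closedBall (by simp [b])]
    exact one_ne_zero
  have hφcont := hφd.continuous
  have hdφcont : Continuous (deriv φ) := hφd.continuous_deriv (by simp)
  have cpow : ∀ (f : ℝ → ℝ), HasCompactSupport f → ∀ n : ℕ, n ≠ 0 →
      HasCompactSupport (fun s => f s ^ n) := by
    intro f hf n hn
    exact hf.comp_left (g := fun z => z ^ n) (by simp [hn])
  have hi : ∀ (f : ℝ → ℝ), Continuous f → HasCompactSupport f → ∀ n : ℕ, n ≠ 0 →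
      Integrable (fun s => f s ^ n) := fun f hf hc n hn =>
    (hf.pow n).integrable_of_hasCompactSupport (cpow f hc n hn)
  have hφpos : ∀ n : ℕ, n ≠ 0 → Even n → 0 < ∫ s, φ s ^ n := by
    intro n hn he
    exact (hφcont.pow n).integral_pos_of_hasCompactSupport_nonneg_nonzero (cpow φ hφc n hn)
      (fun s => he.pow_nonneg _) (x := 0) (pow_ne_zero n hφ0)
  set F2 := ∫ s, φ s ^ 2 with hF2
  set F2' := ∫ s, deriv φ s ^ 2 with hF2'
  set F4 := ∫ s, φ s ^ 4 with hF4
  have pF2 : 0 < F2 := hφpos 2 (by simp) (by decide)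
  have pF4 : 0 < F4 := hφpos 4 (by simp) (by decide)
  have pF2' : 0 ≤ F2' := integral_nonneg fun s => by positivity
  -- choice of the length
  obtain ⟨k, hk1, hkk⟩ : ∃ k : ℝ, 1 ≤ k ∧
      (2 * F2' + F2 * (π ^ 2 / 2 + 1)) * (16 / π) * (2 * F2' + F2) < 2 * π ^ 2 * F4 * k := by
    have hp : 0 < 2 * π ^ 2 * F4 := by positivity
    set C := (2 * F2' + F2 * (π ^ 2 / 2 + 1)) * (16 / π) * (2 * F2' + F2)
    refine ⟨max 1 (C / (2 * π ^ 2 * F4) + 1), le_max_left _ _, ?_⟩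
    calc C = 2 * π ^ 2 * F4 * (C / (2 * π ^ 2 * F4)) := by field_simp
      _ < 2 * π ^ 2 * F4 * (C / (2 * π ^ 2 * F4) + 1) := by gcongr; linarith
      _ ≤ _ := by gcongr; exact le_max_right _ _
  have hk0 : 0 < k := by linarith
  obtain ⟨ψ, δ, hδ, hψd, hψs, hψ1, hψ2, hψ3, hψ4⟩ := psi_exists (1 / k ^ 2) (by positivity)
  have hψcont := hψd.continuous
  have hdψcont : Continuous (deriv ψ) := hψd.continuous_deriv (by simp)
  have hψc : HasCompactSupport ψ := by
    apply HasCompactSupport.intro (isCompact_Icc (a := (-1 : ℝ)) (b := 1))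
    intro y hy
    by_contra h
    have := hψs y h
    apply hy
    constructor <;> nlinarith
  set A := ∫ y, ψ y ^ 2 with hA
  set A4 := ∫ y, ψ y ^ 4 with hA4
  set q := F2' * A / k + k * F2 * (π ^ 2 / 4 * A + 1 / k ^ 2) with hq
  have hA0 : 0 < A := by linarith
  have hq0 : 0 < q := by positivity
  set a := 1 / √q with ha
  have haq : a ^ 2 * q = 1 := by
    rw [ha, div_pow, Real.sq_sqrt hq0.le]; field_simp
  set u : E2 → ℝ := fun x => a * (φ (x 0 / k) * ψ (x 1)) with hu
  have hud : ContDiff ℝ (⊤ : ℕ∞) u := by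
    have c0 : ContDiff ℝ (⊤ : ℕ∞) (fun x : E2 => x 0 / k) := by fun_prop
    have c1 : ContDiff ℝ (⊤ : ℕ∞) (fun x : E2 => x 1) := by fun_prop
    exact contDiff_const.mul ((hφd.comp c0).mul (hψd.comp c1))
  have hus : ∀ x, u x ≠ 0 → δ ≤ 1 - x 1 ^ 2 := by
    intro x hx
    apply hψs
    intro h
    apply hx
    simp [hu, h]
  have hcl : tsupport u ⊆ {x : E2 | δ ≤ 1 - x 1 ^ 2} :=
    closure_minimal (fun x hx => hus x hx) (isClosed_le continuous_const (by fun_prop))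
  have hsub : {x : E2 | δ ≤ 1 - x 1 ^ 2} ⊆ strip := by
    intro x hx
    have hx' : δ ≤ 1 - x 1 ^ 2 := hx
    show x 1 ∈ Set.Ioo (-1 : ℝ) 1
    constructor <;> nlinarith
  have huc : HasCompactSupport u := by
    obtain ⟨R, hR⟩ := hφc.isCompact.isBounded.subset_closedBall 0
    apply HasCompactSupport.intro (isCompact_closedBall (0 : E2) (√((k * R) ^ 2 + 1)))
    intro x hx
    by_contra h
    apply hx
    have h1 := hus x h
    have h2 : φ (x 0 / k) ≠ 0 := by intro h'; apply h; simp [hu, h']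
    have h3 := hR (subset_tsupport _ h2)
    rw [mem_closedBall_zero_iff, Real.norm_eq_abs, abs_div, abs_of_pos hk0, div_le_iff₀ hk0] at h3
    rw [mem_closedBall_zero_iff, EuclideanSpace.norm_eq]
    apply Real.sqrt_le_sqrt
    simp only [Fin.sum_univ_two, Real.norm_eq_abs, sq_abs]
    have h4 : x 0 ^ 2 ≤ (k * R) ^ 2 := by
      rw [← sq_abs]; rw [mul_comm]; exact pow_le_pow_left₀ (abs_nonneg _) h3 2
    linarith
  have hucont := hud.continuous
  -- product integrals
  have scal : ∀ f : ℝ → ℝ, ∫ s, f (s / k) = k * ∫ s, f s := by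
    intro f
    rw [Measure.integral_comp_div, abs_of_pos hk0, smul_eq_mul]
  have prodI : ∀ f g : ℝ → ℝ, Integrable f → Integrable g →
      Integrable (fun x : E2 => f (x 0 / k) * g (x 1)) ∧
      ∫ x : E2, f (x 0 / k) * g (x 1) = k * (∫ s, f s) * ∫ t, g t := by
    intro f g hf hg
    have := prod_int (fun s => f (s / k)) g (hf.comp_div hk0.ne') hg
    rw [scal f] at this
    exact this
  have hdφc : HasCompactSupport (deriv φ) := hφc.deriv
  have hdψc : HasCompactSupport (deriv ψ) := hψc.deriv
  obtain ⟨i1, e1⟩ := prodI _ _ (hi _ hdφcont hdφc 2 two_ne_zero) (hi _ hψcont hψc 2 two_ne_zero)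
  obtain ⟨i2, e2⟩ := prodI _ _ (hi _ hφcont hφc 2 two_ne_zero) (hi _ hdψcont hdψc 2 two_ne_zero)
  obtain ⟨i3, e3⟩ := prodI _ _ (hi _ hφcont hφc 2 two_ne_zero) (hi _ hψcont hψc 2 two_ne_zero)
  obtain ⟨i4, e4⟩ := prodI _ _ (hi _ hφcont hφc 4 four_ne_zero) (hi _ hψcont hψc 4 four_ne_zero)
  refine ⟨u, ⟨hud, huc, hcl.trans hsub⟩, ?_, ?_⟩
  · -- energy
    have hG : Integrable (fun x : E2 => a ^ 2 * (k⁻¹ ^ 2 * (deriv φ (x 0 / k) ^ 2 * ψ (x 1) ^ 2)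
        + φ (x 0 / k) ^ 2 * deriv ψ (x 1) ^ 2)) := ((i1.const_mul _).add i2).const_mul _
    have hb : ∀ x : E2, ‖fderiv ℝ u x‖ ^ 2 ≤ a ^ 2 * (k⁻¹ ^ 2 * (deriv φ (x 0 / k) ^ 2 * ψ (x 1) ^ 2)
        + φ (x 0 / k) ^ 2 * deriv ψ (x 1) ^ 2) := by
      intro x
      refine (fderiv_bd k a φ ψ (hφd.differentiable (by simp)) (hψd.differentiable (by simp)) x).trans
        (le_of_eq (by ring))
    calc ∫ x in strip, ‖fderiv ℝ u x‖ ^ 2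
        ≤ ∫ x in strip, a ^ 2 * (k⁻¹ ^ 2 * (deriv φ (x 0 / k) ^ 2 * ψ (x 1) ^ 2)
            + φ (x 0 / k) ^ 2 * deriv ψ (x 1) ^ 2) :=
          integral_mono_of_nonneg (Filter.Eventually.of_forall fun x => by positivity)
            hG.integrableOn (Filter.Eventually.of_forall hb)
      _ ≤ ∫ x : E2, a ^ 2 * (k⁻¹ ^ 2 * (deriv φ (x 0 / k) ^ 2 * ψ (x 1) ^ 2)
            + φ (x 0 / k) ^ 2 * deriv ψ (x 1) ^ 2) :=
          setIntegral_le_integral hG (Filter.Eventually.of_forall fun x => by positivity)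
      _ = a ^ 2 * (k⁻¹ ^ 2 * (k * F2' * A) + k * F2 * ∫ t, deriv ψ t ^ 2) := by
          rw [integral_const_mul, integral_add (i1.const_mul _) i2, integral_const_mul, e1, e2]
      _ ≤ a ^ 2 * (k⁻¹ ^ 2 * (k * F2' * A) + k * F2 * (π ^ 2 / 4 * A + 1 / k ^ 2)) := by
          gcongr
      _ = a ^ 2 * q := by rw [hq]; field_simp
      _ = 1 := haq
  · -- functional
    have h0 : ∀ x, x ∉ strip → u x = 0 := by
      intro x hx
      by_contra h
      exact hx (hsub (hus x h))
    have hE : Integrable (fun x => Real.exp (4 * π * u x ^ 2) - 1) := by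
      apply Continuous.integrable_of_hasCompactSupport (by fun_prop)
      exact huc.comp_left (g := fun z => Real.exp (4 * π * z ^ 2) - 1) (by simp)
    rw [setIntegral_eq_integral_of_forall_compl_eq_zero (fun x hx => by rw [h0 x hx]; simp)]
    have hI : Integrable (fun x : E2 => 4 * π * (a ^ 2 * (φ (x 0 / k) ^ 2 * ψ (x 1) ^ 2))
        + 8 * π ^ 2 * (a ^ 4 * (φ (x 0 / k) ^ 4 * ψ (x 1) ^ 4))) :=
      ((i3.const_mul _).const_mul _).add ((i4.const_mul _).const_mul _)
    calc 16 / π < 4 * π * (a ^ 2 * (k * F2 * A)) + 8 * π ^ 2 * (a ^ 4 * (k * F4 * A4)) :=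
          final_alg k a q F2 F2' F4 A A4 hk1 pF2 pF2' pF4 hψ2 hψ3 hψ4 hq haq hq0 hkk
      _ = ∫ x : E2, (4 * π * (a ^ 2 * (φ (x 0 / k) ^ 2 * ψ (x 1) ^ 2))
        + 8 * π ^ 2 * (a ^ 4 * (φ (x 0 / k) ^ 4 * ψ (x 1) ^ 4))) := by
          rw [integral_add ((i3.const_mul _).const_mul _) ((i4.const_mul _).const_mul _),
            integral_const_mul, integral_const_mul, integral_const_mul, integral_const_mul, e3, e4]
      _ ≤ _ := by
          apply integral_mono hI hE
          intro x
          have := Real.quadratic_le_exp_of_nonneg (show 0 ≤ 4 * π * u x ^ 2 by positivity)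
          have h9 : 4 * π * (a ^ 2 * (φ (x 0 / k) ^ 2 * ψ (x 1) ^ 2))
              + 8 * π ^ 2 * (a ^ 4 * (φ (x 0 / k) ^ 4 * ψ (x 1) ^ 4)) =
              4 * π * u x ^ 2 + (4 * π * u x ^ 2) ^ 2 / 2 := by
            simp only [hu]; ring
          show 4 * π * (a ^ 2 * (φ (x 0 / k) ^ 2 * ψ (x 1) ^ 2))
              + 8 * π ^ 2 * (a ^ 4 * (φ (x 0 / k) ^ 4 * ψ (x 1) ^ 4)) ≤ Real.exp (4 * π * u x ^ 2) - 1
          rw [h9]; linarith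

/-- On the strip `Ω = ℝ × (-1,1)`, the Moser–Trudinger supremum exceeds
`16/π = 4π/λ₁(Ω)`, the vanishing level. -/
theorem strip_sup_exceeds_vanishing_level :
    16 / Real.pi <
      sSup {r : ℝ | ∃ u : EuclideanSpace ℝ (Fin 2) → ℝ, IsTest strip u ∧
        (∫ x in strip, ‖fderiv ℝ u x‖ ^ 2) ≤ 1 ∧
        r = ∫ x in strip, (Real.exp (4 * Real.pi * u x ^ 2) - 1)} := by
  obtain ⟨u, hu, hE, hlt⟩ := strip_lower
  exact lt_csSup_of_lt strip_bddAbove ⟨u, hu, hE, rfl⟩ hlt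
end
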